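/- arXiv:2208.09251 — 3 statements merged into one kernel-verified Lean document; each statement's English description precedes it below -/
import Mathlib

section
/- Let G be a finite connected simple graph. The connected subgraph arrangement 𝒜_G over ℚ is factored (admits a nice partition) if and only if G is isomorphic to a path graph or to a path-with-triangle graph Δ_{n,1} for some n ≥ 2. -/
open Finset

/-- The linear form `∑_{i ∈ I} x_i` on `ℚ^n`. -/
noncomputable def linForm {n : ℕ} (I : Finset (Fin n)) : (Fin n → ℚ) →ₗ[ℚ] ℚ :=
  ∑ i ∈ I, LinearMap.proj i

/-- `I` is a nonempty subset of vertices inducing a connected subgraph of `G`. -/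
def ConnSet {n : ℕ} (G : SimpleGraph (Fin n)) (I : Finset (Fin n)) : Prop :=
  I.Nonempty ∧ (G.induce (↑I : Set (Fin n))).Connected

/-- The connected subgraph arrangement of `G`, as a set of hyperplanes of `ℚ^n`. -/
def csa {n : ℕ} (G : SimpleGraph (Fin n)) : Set (Submodule ℚ (Fin n → ℚ)) :=
  {H | ∃ I : Finset (Fin n), ConnSet G I ∧ H = LinearMap.ker (linForm I)}

/-- The almost path graph `A_{n,k}` (paper notation, vertices `1,…,n+1` realized as
`Fin (n+1)` with `0,…,n`): a path `1–⋯–n` together with the edge `{k, n+1}`. -/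
def almostPath (n k : ℕ) : SimpleGraph (Fin (n + 1)) :=
  SimpleGraph.fromRel (fun a b =>
    (a.val + 1 = b.val ∧ b.val < n) ∨ (a.val = k - 1 ∧ b.val = n))

/-- The path-with-triangle graph `Δ_{n,k}` (paper notation): a path `1–⋯–n` together
with the edges `{k, n+1}` and `{k+1, n+1}`. -/
def pathTriangle (n k : ℕ) : SimpleGraph (Fin (n + 1)) :=
  SimpleGraph.fromRel (fun a b =>
    (a.val + 1 = b.val ∧ b.val < n) ∨ (a.val = k - 1 ∧ b.val = n) ∨ (a.val = k ∧ b.val = n))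

/-- The module of `𝒜_G`-derivations `D(𝒜_G) ⊆ Der_ℚ(ℚ[x_1,…,x_n])`. -/
noncomputable def derModule {n : ℕ} (G : SimpleGraph (Fin n)) :
    Submodule (MvPolynomial (Fin n) ℚ)
      (Derivation ℚ (MvPolynomial (Fin n) ℚ) (MvPolynomial (Fin n) ℚ)) where
  carrier := {θ | ∀ I : Finset (Fin n), ConnSet G I →
    (∑ i ∈ I, MvPolynomial.X i) ∣ θ (∑ i ∈ I, MvPolynomial.X i)}
  add_mem' := by
    intro a b ha hb I hI
    rw [Derivation.add_apply]
    exact dvd_add (ha I hI) (hb I hI)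
  zero_mem' := by
    intro I hI
    simp
  smul_mem' := by
    intro c θ hθ I hI
    rw [Derivation.smul_apply, smul_eq_mul]
    exact (hθ I hI).mul_left c

open Classical in
/-- The defining linear forms of the connected subgraph arrangement of `G`
(each hyperplane `H_I ∈ 𝒜_G` corresponds to its defining form `∑_{i∈I} x_i`;
this correspondence is bijective for 0/1-arrangements). -/
noncomputable def csaForms {n : ℕ} (G : SimpleGraph (Fin n)) :
    Finset ((Fin n → ℚ) →ₗ[ℚ] ℚ) :=
  (Finset.univ.filter fun I : Finset (Fin n) => ConnSet G I).image linForm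

/-- Membership in the intersection lattice `L(𝒜)` of the arrangement with defining
forms `F`: the intersections `⋂_{f ∈ B} ker f` over subsets `B ⊆ F` (with the ambient
space as the empty intersection). -/
def InLattice {n : ℕ} (F : Finset ((Fin n → ℚ) →ₗ[ℚ] ℚ))
    (X : Submodule ℚ (Fin n → ℚ)) : Prop :=
  ∃ B ⊆ F, X = ⨅ f ∈ B, LinearMap.ker f

/-- `π` is a nice partition (a factorization) of the arrangement with (pairwise
distinct) defining forms `F`: it is a partition of `F` into `s` nonempty blocks which
is independent (any choice of one form from each block is linearly independent), and
for every `X ∈ L(𝒜) ∖ {ambient space}` the induced partition of the localization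
`𝒜_X = {f ∈ F : X ⊆ ker f}` admits a singleton block. -/
def IsNicePartition {n s : ℕ} (F : Finset ((Fin n → ℚ) →ₗ[ℚ] ℚ))
    (π : Fin s → Finset ((Fin n → ℚ) →ₗ[ℚ] ℚ)) : Prop :=
  (∀ i, (π i).Nonempty) ∧
  (∀ i, π i ⊆ F) ∧
  (∀ f ∈ F, ∃! i, f ∈ π i) ∧
  (∀ g : Fin s → ((Fin n → ℚ) →ₗ[ℚ] ℚ), (∀ i, g i ∈ π i) → LinearIndependent ℚ g) ∧
  (∀ X : Submodule ℚ (Fin n → ℚ), InLattice F X → X ≠ ⊤ →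
    ∃ i, ∃ f ∈ π i, X ≤ LinearMap.ker f ∧
      ∀ g ∈ π i, X ≤ LinearMap.ker g → g = f)

/-- An arrangement (given by its defining forms `F`) is factored if it admits a nice
partition. -/
def IsFactored {n : ℕ} (F : Finset ((Fin n → ℚ) →ₗ[ℚ] ℚ)) : Prop :=
  ∃ (s : ℕ) (π : Fin s → Finset ((Fin n → ℚ) →ₗ[ℚ] ℚ)), IsNicePartition F π



/-! ### Cut characterization of connected sets -/

/-- Cut version of connectedness of `I`. -/
def CutConn {n : ℕ} (G : SimpleGraph (Fin n)) (I : Finset (Fin n)) : Prop :=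
  I.Nonempty ∧ ∀ S, S ⊆ I → S.Nonempty → S ≠ I → ∃ a ∈ S, ∃ b ∈ I, b ∉ S ∧ G.Adj a b

lemma connSet_iff {n : ℕ} (G : SimpleGraph (Fin n)) (I : Finset (Fin n)) :
    ConnSet G I ↔ CutConn G I := by
  classical
  constructor
  · rintro ⟨hne, hc⟩
    refine ⟨hne, fun S hS ⟨a, ha⟩ hSI => ?_⟩
    obtain ⟨b, hbI, hbS⟩ : ∃ b ∈ I, b ∉ S := by
      by_contra h
      push Not at h
      exact hSI (Finset.Subset.antisymm hS h)
    obtain ⟨w⟩ := hc.preconnected ⟨a, hS ha⟩ ⟨b, hbI⟩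
    obtain ⟨d, -, h1, h2⟩ := w.exists_boundary_dart {x | x.1 ∈ S} ha hbS
    exact ⟨d.fst.1, h1, d.snd.1, d.snd.2, h2, d.adj⟩
  · rintro ⟨⟨a, ha⟩, hcut⟩
    have hne : Nonempty (↑(↑I : Set (Fin n))) := ⟨⟨a, ha⟩⟩
    refine ⟨⟨a, ha⟩, ?_⟩
    have key : ∀ x : (↑(↑I : Set (Fin n))), (G.induce (↑I : Set (Fin n))).Reachable ⟨a, ha⟩ x := by
      by_contra hcon
      push Not at hcon
      obtain ⟨x, hx⟩ := hcon
      let S : Finset (Fin n) := I.filter fun y => ∃ h : y ∈ I, (G.induce (↑I : Set (Fin n))).Reachable ⟨a, ha⟩ ⟨y, h⟩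
      obtain ⟨p, hp, q, hq, hqS, hadj⟩ := hcut S (Finset.filter_subset _ _)
        ⟨a, Finset.mem_filter.2 ⟨ha, ha, SimpleGraph.Reachable.refl _⟩⟩ (by
          intro h
          have hxI : x.1 ∈ I := x.2
          have : x.1 ∈ S := by rw [h]; exact hxI
          obtain ⟨_, h1, h2⟩ := Finset.mem_filter.1 this
          exact hx h2)
      obtain ⟨hpI, _, hpr⟩ := Finset.mem_filter.1 hp
      apply hqS
      refine Finset.mem_filter.2 ⟨hq, hq, hpr.trans ?_⟩
      apply SimpleGraph.Adj.reachable
      exact hadj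
    exact ⟨fun x y => (key x).symm.trans (key y)⟩

lemma linForm_apply {n : ℕ} (I : Finset (Fin n)) (x : Fin n → ℚ) :
    linForm I x = ∑ i ∈ I, x i := by
  simp [linForm]

lemma linForm_single {n : ℕ} (I : Finset (Fin n)) (p : Fin n) :
    linForm I (Pi.single p 1) = if p ∈ I then 1 else 0 := by
  rw [linForm_apply]
  simp [Pi.single_apply]

lemma linForm_inj {n : ℕ} {I J : Finset (Fin n)} (h : linForm I = linForm J) : I = J := by
  ext p
  have := congrArg (fun f => f (Pi.single p 1)) h
  simp only [linForm_single] at this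
  by_cases h1 : p ∈ I <;> by_cases h2 : p ∈ J <;> simp_all

lemma mem_csaForms {n : ℕ} (G : SimpleGraph (Fin n)) (f) :
    f ∈ csaForms G ↔ ∃ I, ConnSet G I ∧ linForm I = f := by
  simp [csaForms]

lemma linForm_mem {n : ℕ} {G : SimpleGraph (Fin n)} {I} (h : ConnSet G I) :
    linForm I ∈ csaForms G := (mem_csaForms G _).2 ⟨I, h, rfl⟩

/-- The compatible position of two sets. -/
def Compat {α : Type*} (A B : Finset α) : Prop :=
  Disjoint A B ∨ A ⊆ B ∨ B ⊆ A

lemma span_lemma {n : ℕ} {A B I : Finset (Fin n)}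
    (hI : I.Nonempty)
    (h : LinearMap.ker (linForm A) ⊓ LinearMap.ker (linForm B) ≤ LinearMap.ker (linForm I)) :
    I = A ∨ I = B ∨ (Compat A B ∧ I = symmDiff A B) := by
  have h0 : ∀ p, p ∉ A → p ∉ B → p ∉ I := by
    intro p ha hb hi
    have := @h (Pi.single p 1) (by simp [linForm_single, ha, hb])
    simp [linForm_single, hi] at this
  have h1 : ∀ p q, (p ∈ A ↔ q ∈ A) → (p ∈ B ↔ q ∈ B) → p ∈ I → q ∈ I := by
    intro p q ha hb hi
    have := @h (Pi.single p 1 - Pi.single q 1) (by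
      simp [linForm_single, ha, hb])
    by_contra hq
    simp [linForm_single, hi, hq] at this
  have h2 : ∀ p q r, p ∈ A → p ∉ B → q ∉ A → q ∈ B → r ∈ A → r ∈ B →
      (¬ (p ∈ I ∧ q ∈ I)) ∧ (r ∈ I ↔ (p ∈ I ∨ q ∈ I)) := by
    intro p q r p1 p2 q1 q2 r1 r2
    have := @h (Pi.single p 1 + Pi.single q 1 - Pi.single r 1) (by
      simp [linForm_single, p1, p2, q1, q2, r1, r2])
    simp [linForm_single] at this
    by_cases a : p ∈ I <;> by_cases b : q ∈ I <;> by_cases c : r ∈ I <;> simp_all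
  have g1 : ∀ p q, p ∈ A → p ∈ B → q ∈ A → q ∈ B → p ∈ I → q ∈ I :=
    fun p q a b c d => h1 p q (by simp [a, c]) (by simp [b, d])
  have g2 : ∀ p q, p ∈ A → p ∉ B → q ∈ A → q ∉ B → p ∈ I → q ∈ I :=
    fun p q a b c d => h1 p q (by simp [a, c]) (by simp [b, d])
  have g3 : ∀ p q, p ∉ A → p ∈ B → q ∉ A → q ∈ B → p ∈ I → q ∈ I :=
    fun p q a b c d => h1 p q (by simp [a, c]) (by simp [b, d])
  clear h1 h
  obtain ⟨z, hz⟩ := hI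
  have hz' : (z ∈ A ∧ z ∈ B) ∨ (z ∈ A ∧ z ∉ B) ∨ (z ∉ A ∧ z ∈ B) := by
    have := h0 z
    tauto
  by_cases e1 : ∃ p, p ∈ A ∧ p ∉ B
  · obtain ⟨p, pA, pB⟩ := e1
    by_cases e2 : ∃ q, q ∉ A ∧ q ∈ B
    · obtain ⟨q, qA, qB⟩ := e2
      by_cases e3 : ∃ r, r ∈ A ∧ r ∈ B
      · obtain ⟨r, rA, rB⟩ := e3
        have := h2 p q r pA pB qA qB rA rB
        by_cases hp : p ∈ I
        · left; ext x; by_cases xA : x ∈ A <;> by_cases xB : x ∈ B <;> grind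
        · by_cases hq : q ∈ I
          · right; left; ext x; by_cases xA : x ∈ A <;> by_cases xB : x ∈ B <;> grind
          · exfalso; rcases hz' with ⟨a, b⟩ | ⟨a, b⟩ | ⟨a, b⟩ <;> grind
      · push Not at e3
        by_cases hp : p ∈ I
        · by_cases hq : q ∈ I
          · right; right
            refine ⟨Or.inl (Finset.disjoint_left.2 e3), ?_⟩
            ext x; simp only [Finset.mem_symmDiff]; by_cases xA : x ∈ A <;> by_cases xB : x ∈ B <;> grind
          · left; ext x; by_cases xA : x ∈ A <;> by_cases xB : x ∈ B <;> grind
        · right; left; ext x; by_cases xA : x ∈ A <;> by_cases xB : x ∈ B <;> grind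
    · push Not at e2
      have hBA : B ⊆ A := fun x hx => by by_contra h; exact e2 x h hx
      by_cases hp : p ∈ I
      · by_cases e3 : ∃ r, r ∈ A ∧ r ∈ B ∧ r ∈ I
        · left; ext x; by_cases xA : x ∈ A <;> by_cases xB : x ∈ B <;> grind
        · right; right
          refine ⟨Or.inr (Or.inr hBA), ?_⟩
          ext x; simp only [Finset.mem_symmDiff]; by_cases xA : x ∈ A <;> by_cases xB : x ∈ B <;> grind
      · right; left; ext x; by_cases xA : x ∈ A <;> by_cases xB : x ∈ B <;> grind
  · push Not at e1
    have hAB : A ⊆ B := e1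
    by_cases e2 : ∃ q, q ∉ A ∧ q ∈ B ∧ q ∈ I
    · by_cases e3 : ∃ r, r ∈ A ∧ r ∈ B ∧ r ∈ I
      · right; left; ext x; by_cases xA : x ∈ A <;> by_cases xB : x ∈ B <;> grind
      · right; right
        refine ⟨Or.inr (Or.inl hAB), ?_⟩
        ext x; simp only [Finset.mem_symmDiff]; by_cases xA : x ∈ A <;> by_cases xB : x ∈ B <;> grind
    · left; ext x; by_cases xA : x ∈ A <;> by_cases xB : x ∈ B <;> grind

/-- The rank two constraints satisfied by the block function of a nice partition. -/
def Col {n : ℕ} (G : SimpleGraph (Fin n)) : Prop :=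
  ∃ c : Finset (Fin n) → ℕ, ∀ A B, ConnSet G A → ConnSet G B → A ≠ B →
    (c A = c B → Compat A B ∧ ConnSet G (symmDiff A B) ∧ c (symmDiff A B) ≠ c A) ∧
    (Compat A B → ConnSet G (symmDiff A B) → c A ≠ c B →
      c (symmDiff A B) = c A ∨ c (symmDiff A B) = c B)

lemma compat_rel {n : ℕ} {A B : Finset (Fin n)} (h : Compat A B) :
    ∃ u v w : ℚ, w ≠ 0 ∧ u • linForm A + v • linForm B + w • linForm (symmDiff A B) = 0 := by
  have key : ∀ (C D : Finset (Fin n)), Disjoint C D → linForm (C ∪ D) = linForm C + linForm D :=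
    fun C D h => Finset.sum_union h
  rcases h with h | h | h
  · refine ⟨1, 1, -1, by norm_num, ?_⟩
    have e : symmDiff A B = A ∪ B := by
      rw [h.symmDiff_eq_sup]; rfl
    rw [e, key _ _ h]
    module
  · refine ⟨1, -1, 1, by norm_num, ?_⟩
    have e : symmDiff A B = B \ A := symmDiff_of_le h
    have e2 : B = A ∪ (B \ A) := (Finset.union_sdiff_of_subset h).symm
    have e3 := key A (B \ A) Finset.disjoint_sdiff
    rw [← e2] at e3
    rw [e, e3]
    module
  · refine ⟨-1, 1, 1, by norm_num, ?_⟩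
    have e : symmDiff A B = A \ B := symmDiff_of_ge h
    have e2 : A = B ∪ (A \ B) := (Finset.union_sdiff_of_subset h).symm
    have e3 := key B (A \ B) Finset.disjoint_sdiff
    rw [← e2] at e3
    rw [e, e3]
    module

lemma col_of_factored {n : ℕ} (G : SimpleGraph (Fin n)) (h : IsFactored (csaForms G)) :
    Col G := by
  classical
  obtain ⟨s, π, hne, hsub, huniq, hind, hnice⟩ := h
  by_cases hs : Nonempty (Fin s)
  swap
  · refine ⟨fun _ => 0, fun A B hA _ _ => ?_⟩
    obtain ⟨i, -⟩ := huniq _ (linForm_mem hA)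
    exact (hs ⟨i⟩).elim
  have huniq' : ∀ f, ∃ i, f ∈ csaForms G → (f ∈ π i ∧ ∀ j, f ∈ π j → j = i) := by
    intro f
    by_cases hf : f ∈ csaForms G
    · obtain ⟨i, h1, h2⟩ := huniq f hf
      exact ⟨i, fun _ => ⟨h1, h2⟩⟩
    · exact ⟨hs.some, fun h => (hf h).elim⟩
  choose c hc' using huniq'
  have hc := fun f hf => (hc' f hf).1
  have hcu := fun f hf => (hc' f hf).2
  have hcc : ∀ A, ConnSet G A → ∀ i, linForm A ∈ π i → i = c (linForm A) :=
    fun A hA i hi => hcu _ (linForm_mem hA) i hi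
  refine ⟨fun A => (c (linForm A)).val, fun A B hA hB hAB => ⟨?_, ?_⟩⟩
  · intro hcAB
    replace hcAB : c (linForm A) = c (linForm B) := Fin.ext hcAB
    have hX := hnice (LinearMap.ker (linForm A) ⊓ LinearMap.ker (linForm B))
      ⟨{linForm A, linForm B}, by
        intro f hf
        simp only [Finset.mem_insert, Finset.mem_singleton] at hf
        rcases hf with rfl | rfl
        · exact linForm_mem hA
        · exact linForm_mem hB, by
        rw [Finset.iInf_insert, Finset.iInf_singleton]⟩ (by
        intro htop
        obtain ⟨a, ha⟩ := hA.1
        have : (Pi.single a 1 : Fin n → ℚ) ∈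
          LinearMap.ker (linForm A) ⊓ LinearMap.ker (linForm B) := by rw [htop]; trivial
        simp [linForm_single, ha] at this)
    obtain ⟨i, f, hfi, hle, hun⟩ := hX
    obtain ⟨I, hI, rfl⟩ := (mem_csaForms G f).1 (hsub i hfi)
    have hi : i = c (linForm I) := hcc I hI i hfi
    have hnot : i ≠ c (linForm A) := by
      intro hiA
      have h1 := hun (linForm A) (hiA ▸ hc _ (linForm_mem hA)) inf_le_left
      have h2 := hun (linForm B) (by rw [hiA, hcAB]; exact hc _ (linForm_mem hB)) inf_le_right
      exact hAB (linForm_inj (h1.trans h2.symm))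
    rcases span_lemma hI.1 hle with rfl | rfl | ⟨h1, rfl⟩
    · exact (hnot hi).elim
    · exact (hnot (hi.trans hcAB.symm)).elim
    · refine ⟨h1, hI, fun h => hnot (hi.trans (Fin.ext h))⟩
  · intro hcomp hC hne'
    by_contra hcon
    push Not at hcon
    obtain ⟨h1, h2⟩ := hcon
    set C := symmDiff A B with hCdef
    have n1 : c (linForm A) ≠ c (linForm B) := fun h => hne' (congrArg _ h)
    have n2 : c (linForm C) ≠ c (linForm A) := fun h => h1 (congrArg _ h)
    have n3 : c (linForm C) ≠ c (linForm B) := fun h => h2 (congrArg _ h)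
    choose g0 hg0 using hne
    let g : Fin s → ((Fin n → ℚ) →ₗ[ℚ] ℚ) := fun i =>
      if i = c (linForm A) then linForm A else if i = c (linForm B) then linForm B
      else if i = c (linForm C) then linForm C else g0 i
    have hg := hind g (by
      intro i
      simp only [g]
      split_ifs with e1 e2 e3
      · rw [e1]; exact hc _ (linForm_mem hA)
      · rw [e2]; exact hc _ (linForm_mem hB)
      · rw [e3]; exact hc _ (linForm_mem hC)
      · exact hg0 i)
    obtain ⟨u, v, w, hw, hrel⟩ := compat_rel hcomp
    have gA : g (c (linForm A)) = linForm A := by simp [g]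
    have gB : g (c (linForm B)) = linForm B := by simp [g, n1.symm]
    have gC : g (c (linForm C)) = linForm C := by simp [g, n2, n3]
    rw [Fintype.linearIndependent_iff] at hg
    have := hg (fun i => if i = c (linForm A) then u else if i = c (linForm B) then v
      else if i = c (linForm C) then w else 0) (by
        rw [← hrel]
        have : ∀ i, (if i = c (linForm A) then u else if i = c (linForm B) then v
          else if i = c (linForm C) then w else 0) • g i =
          (if i = c (linForm A) then u • linForm A else 0) +
          (if i = c (linForm B) then v • linForm B else 0) +
          (if i = c (linForm C) then w • linForm C else 0) := by
          intro i
          by_cases e1 : i = c (linForm A)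
          · subst e1; simp [gA, n1, n2.symm]
          by_cases e2 : i = c (linForm B)
          · subst e2; simp [gB, n1.symm, n3.symm]
          by_cases e3 : i = c (linForm C)
          · subst e3; simp [gC, n2, n3]
          simp [e1, e2, e3]
        simp only [this, Finset.sum_add_distrib]
        simp
        rw [hCdef]) (c (linForm C))
    simp [n2, n3] at this
    exact hw this


/-! ### Exhaustive search for the rank two constraints on small graphs -/

/-- The subset of `Fin k` coded by a bit mask. -/
def maskSet (k m : ℕ) : Finset (Fin k) := Finset.univ.filter fun i => m.testBit i.val

lemma mem_maskSet {k m : ℕ} {i : Fin k} : i ∈ maskSet k m ↔ m.testBit i.val = true := by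
  simp [maskSet]

lemma maskSet_inj {k a b : ℕ} (ha : a < 2 ^ k) (hb : b < 2 ^ k) (h : maskSet k a = maskSet k b) :
    a = b := by
  apply Nat.eq_of_testBit_eq
  intro i
  by_cases hi : i < k
  · have := congrArg (fun s => (⟨i, hi⟩ : Fin k) ∈ s) h
    simp only [mem_maskSet, eq_iff_iff] at this
    exact Bool.eq_iff_iff.2 this
  · have h2 : 2 ^ k ≤ 2 ^ i := Nat.pow_le_pow_right (by norm_num) (by omega)
    rw [Nat.testBit_lt_two_pow (by omega), Nat.testBit_lt_two_pow (by omega)]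

lemma maskSet_xor (k a b : ℕ) : maskSet k (a ^^^ b) = symmDiff (maskSet k a) (maskSet k b) := by
  ext i
  simp only [mem_maskSet, Finset.mem_symmDiff, Nat.testBit_xor]
  cases a.testBit i.val <;> cases b.testBit i.val <;> simp

lemma maskSet_and (k a b : ℕ) : maskSet k (a &&& b) = maskSet k a ∩ maskSet k b := by
  ext i
  simp [mem_maskSet, Nat.testBit_and]

lemma maskSet_zero (k : ℕ) : maskSet k 0 = ∅ := by
  ext i
  simp [mem_maskSet]

/-- Boolean test for the third element of a rank two flat. -/
def tcond (L : List ℕ) (a b : ℕ) : Bool :=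
  (Nat.beq (a &&& b) 0 || Nat.beq (a &&& b) a || Nat.beq (a &&& b) b) && L.any (Nat.beq (a ^^^ b))

/-- All ways to take one entry out of a list. -/
def picks : List (List ℕ) → List (List ℕ × List (List ℕ))
  | [] => []
  | g :: t => (g, t) :: (picks t).map fun x => (x.1, g :: x.2)

/-- May `m` be put into the group `g`, the other groups being `rest`? -/
def okIns (L : List ℕ) (m : ℕ) (g : List ℕ) (rest : List (List ℕ)) : Bool :=
  (g.all fun a => tcond L m a && !(g.any (Nat.beq (m ^^^ a)))) &&
  rest.all fun h => h.all fun a =>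
    !(tcond L m a) || h.any (Nat.beq (m ^^^ a)) || !(rest.any fun h' => h'.any (Nat.beq (m ^^^ a)))

/-- Backtracking search for a block function. -/
def search (L : List ℕ) : List ℕ → List (List ℕ) → Bool
  | [], _ => true
  | m :: t, gs =>
    (([], gs) :: picks gs).any fun x => okIns L m x.1 x.2 && search L t ((m :: x.1) :: x.2)

lemma picks_spec (g : List ℕ) : ∀ gs : List (List ℕ), g ∈ gs →
    ∃ rest, (g, rest) ∈ picks gs ∧ gs.Perm (g :: rest)
  | [], h => by simp at h
  | a :: t, h => by
    rcases List.mem_cons.1 h with rfl | h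
    · exact ⟨t, by simp [picks], List.Perm.refl _⟩
    · obtain ⟨r, h1, h2⟩ := picks_spec g t h
      refine ⟨a :: r, ?_, ?_⟩
      · simp only [picks, List.mem_cons, List.mem_map]
        right
        exact ⟨_, h1, rfl⟩
      · exact (List.Perm.cons a h2).trans (List.Perm.swap _ _ _)

lemma any_beq {l : List ℕ} {x : ℕ} : l.any (Nat.beq x) = true ↔ x ∈ l := by
  simp [List.any_eq_true, Nat.beq_eq]

lemma search_sound (L : List ℕ) (c : ℕ → ℕ)
    (hc : ∀ a ∈ L, ∀ b ∈ L, a ≠ b →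
      (c a = c b → tcond L a b = true ∧ c (a ^^^ b) ≠ c a) ∧
      (tcond L a b = true → c a ≠ c b → c (a ^^^ b) = c a ∨ c (a ^^^ b) = c b)) :
    ∀ (todo : List ℕ) (gs : List (List ℕ)), (∀ m ∈ todo, m ∈ L) → todo.Nodup →
      (∀ g ∈ gs, ∀ a ∈ g, a ∈ L ∧ a ∉ todo ∧ ∀ b ∈ g, c a = c b) →
      gs.Pairwise (fun g h => ∀ a ∈ g, ∀ b ∈ h, c a ≠ c b) → search L todo gs = true
  | [], gs, _, _, _, _ => by simp [search]
  | m :: t, gs, hL, hnd, hg, hp => by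
    have hsym : Std.Symm (fun g h : List ℕ => ∀ a ∈ g, ∀ b ∈ h, c a ≠ c b) :=
      ⟨fun g h H a ha b hb => (H b hb a ha).symm⟩
    obtain ⟨g, rest, hmem, hgm, hrm, hgr⟩ : ∃ g rest, (g, rest) ∈ (([], gs) :: picks gs) ∧
        (∀ a ∈ g, a ∈ L ∧ a ∉ m :: t ∧ c a = c m) ∧ (∀ h ∈ rest, ∀ a ∈ h, c a ≠ c m) ∧
        (∀ h ∈ rest, h ∈ gs) ∧ rest.Pairwise (fun g h => ∀ a ∈ g, ∀ b ∈ h, c a ≠ c b) := by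
      by_cases hex : ∃ g ∈ gs, ∃ a ∈ g, c a = c m
      · obtain ⟨g, hgs, a, ha, hca⟩ := hex
        obtain ⟨r, h1, h2⟩ := picks_spec g gs hgs
        have h3 := (h2.pairwise_iff (fun h => hsym.symm _ _ h)).1 hp
        rw [List.pairwise_cons] at h3
        refine ⟨g, r, List.mem_cons_of_mem _ h1, ?_, ?_, ?_, h3.2⟩
        · intro b hb
          obtain ⟨k1, k2, k3⟩ := hg g hgs b hb
          exact ⟨k1, k2, (k3 a ha).trans hca⟩
        · intro h hh b hb
          have := h3.1 h hh a ha b hb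
          rw [← hca]
          exact this.symm
        · intro h hh
          exact h2.symm.subset (List.mem_cons_of_mem _ hh)
      · push Not at hex
        exact ⟨[], gs, by simp, by simp, hex, fun _ h => h, hp⟩
    rw [List.nodup_cons] at hnd
    have hmL := hL m (by simp)
    simp only [search, List.any_eq_true]
    refine ⟨(g, rest), hmem, ?_⟩
    simp only [Bool.and_eq_true]
    constructor
    · simp only [okIns, Bool.and_eq_true, List.all_eq_true, Bool.or_eq_true, Bool.not_eq_true',
        ← Bool.not_eq_true, any_beq]
      constructor
      · intro a ha
        obtain ⟨k1, k2, k3⟩ := hgm a ha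
        have hma : m ≠ a := by rintro rfl; simp at k2
        obtain ⟨q1, q2⟩ := (hc m hmL a k1 hma).1 k3.symm
        exact ⟨q1, fun hin => q2 (hgm _ hin).2.2⟩
      · intro h hh a ha
        by_cases ht : tcond L m a = true
        swap
        · exact Or.inl (Or.inl ht)
        obtain ⟨k1, k2, k3⟩ := hg h (hgr.1 h hh) a ha
        have hma : m ≠ a := by rintro rfl; simp at k2
        have := (hc m hmL a k1 hma).2 ht (hrm h hh a ha).symm
        by_cases hr : rest.any (fun h' => h'.any (Nat.beq (m ^^^ a))) = true
        swap
        · exact Or.inr hr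
        left; right
        rw [List.any_eq_true] at hr
        obtain ⟨h', hh', hin⟩ := hr
        rw [any_beq] at hin
        have e : c (m ^^^ a) = c a := this.resolve_left (hrm h' hh' _ hin)
        by_cases hee : h' = h
        · rwa [← hee]
        · exact (hgr.2.forall hh' hh hee _ hin a ha e).elim
    · apply search_sound L c hc t
      · exact fun x hx => hL x (List.mem_cons_of_mem _ hx)
      · exact hnd.2
      · intro h hh a ha
        rcases List.mem_cons.1 hh with rfl | hh
        · have hgm' : ∀ b ∈ m :: g, c b = c m := by
            intro b hb
            rcases List.mem_cons.1 hb with rfl | hb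
            · rfl
            · exact (hgm b hb).2.2
          refine ⟨?_, ?_, fun b hb => (hgm' a ha).trans (hgm' b hb).symm⟩
          · rcases List.mem_cons.1 ha with rfl | hb
            · exact hmL
            · exact (hgm a hb).1
          · rcases List.mem_cons.1 ha with rfl | hb
            · exact hnd.1
            · exact fun h => (hgm a hb).2.1 (List.mem_cons_of_mem _ h)
        · obtain ⟨k1, k2, k3⟩ := hg h (hgr.1 h hh) a ha
          exact ⟨k1, fun h => k2 (List.mem_cons_of_mem _ h), k3⟩
      · rw [List.pairwise_cons]
        refine ⟨?_, hgr.2⟩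
        intro h hh a ha b hb
        have : c a = c m := by
          rcases List.mem_cons.1 ha with rfl | hb
          · rfl
          · exact (hgm a hb).2.2
        rw [this]
        exact (hrm h hh b hb).symm

instance {n : ℕ} (G : SimpleGraph (Fin n)) [DecidableRel G.Adj] (I : Finset (Fin n)) :
    Decidable (CutConn G I) := by unfold CutConn; infer_instance

lemma not_col {k : ℕ} (H : SimpleGraph (Fin k)) (L todo : List ℕ)
    (hL : ∀ m, m < 2 ^ k → (CutConn H (maskSet k m) ↔ m ∈ L))
    (hLk : ∀ m ∈ L, m < 2 ^ k) (htodo : ∀ m ∈ todo, m ∈ L) (hnd : todo.Nodup)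
    (hs : search L todo [] = false) : ¬ Col H := by
  rintro ⟨c, hc⟩
  have hz : 0 < 2 ^ k := by positivity
  have hcomp : ∀ a < 2 ^ k, ∀ b < 2 ^ k, (tcond L a b = true ↔
      Compat (maskSet k a) (maskSet k b) ∧ ConnSet H (symmDiff (maskSet k a) (maskSet k b))) := by
    intro a ha b hb
    have hab : a &&& b < 2 ^ k := Nat.and_lt_two_pow _ hb
    rw [connSet_iff, ← maskSet_xor, hL _ (Nat.xor_lt_two_pow ha hb)]
    simp only [tcond, Bool.and_eq_true, Bool.or_eq_true, any_beq, Nat.beq_eq, Compat]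
    apply and_congr_left'
    rw [or_assoc]
    apply or_congr
    · rw [Finset.disjoint_iff_inter_eq_empty, ← maskSet_and, ← maskSet_zero]
      exact ⟨fun h => by rw [h], fun h => maskSet_inj hab hz h⟩
    apply or_congr
    · rw [← Finset.inter_eq_left, ← maskSet_and]
      exact ⟨fun h => by rw [h], fun h => maskSet_inj hab ha h⟩
    · rw [← Finset.inter_eq_right, ← maskSet_and]
      exact ⟨fun h => by rw [h], fun h => maskSet_inj hab hb h⟩
  have hconn : ∀ a ∈ L, ConnSet H (maskSet k a) := fun a ha => by
    rw [connSet_iff, hL a (hLk a ha)]; exact ha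
  have := search_sound L (fun m => c (maskSet k m)) (by
    intro a ha b hb hab
    obtain ⟨h1, h2⟩ := hc _ _ (hconn a ha) (hconn b hb)
      (fun h => hab (maskSet_inj (hLk a ha) (hLk b hb) h))
    have hcab := hcomp a (hLk a ha) b (hLk b hb)
    constructor
    · intro h
      obtain ⟨k1, k2, k3⟩ := h1 h
      simp only [maskSet_xor]
      exact ⟨hcab.2 ⟨k1, k2⟩, k3⟩
    · intro h h'
      simp only [maskSet_xor]
      obtain ⟨k1, k2⟩ := hcab.1 h
      exact h2 k1 k2 h') todo [] htodo hnd (by simp) List.Pairwise.nil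
  rw [this] at hs
  exact Bool.noConfusion hs

/-- Graph on `Fin k` from a list of edges. -/
def edgeGraph (k : ℕ) (E : List (ℕ × ℕ)) : SimpleGraph (Fin k) where
  Adj a b := a ≠ b ∧ ((a.val, b.val) ∈ E ∨ (b.val, a.val) ∈ E)
  symm := ⟨fun _ _ h => ⟨h.1.symm, h.2.symm⟩⟩
  loopless := ⟨fun _ h => h.1 rfl⟩

instance (k : ℕ) (E : List (ℕ × ℕ)) : DecidableRel (edgeGraph k E).Adj := fun a b => by
  unfold edgeGraph; infer_instance

lemma not_col_claw : ¬ Col (edgeGraph 4 [(0, 1), (0, 2), (0, 3)]) :=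
  not_col _ [1, 2, 3, 4, 5, 7, 8, 9, 11, 13, 15]
    [1, 2, 4, 8, 3, 5, 9, 7, 11, 13, 15]
    (by decide +kernel) (by decide) (by decide) (by decide) (by decide +kernel)

lemma not_col_cycle4 : ¬ Col (edgeGraph 4 [(0, 1), (1, 2), (2, 3), (0, 3)]) :=
  not_col _ [1, 2, 3, 4, 6, 7, 8, 9, 11, 12, 13, 14, 15]
    [1, 2, 4, 8, 3, 6, 9, 12, 7, 11, 13, 14, 15]
    (by decide +kernel) (by decide) (by decide) (by decide) (by decide +kernel)

lemma not_col_diamond : ¬ Col (edgeGraph 4 [(0, 1), (1, 2), (2, 3), (0, 3), (0, 2)]) :=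
  not_col _ [1, 2, 3, 4, 5, 6, 7, 8, 9, 11, 12, 13, 14, 15]
    [1, 2, 4, 8, 3, 5, 6, 9, 12, 7, 11, 13, 14, 15]
    (by decide +kernel) (by decide) (by decide) (by decide) (by decide +kernel)

lemma not_col_k4 : ¬ Col (edgeGraph 4 [(0, 1), (0, 2), (1, 2), (0, 3), (1, 3), (2, 3)]) :=
  not_col _ [1, 2, 3, 4, 5, 6, 7, 8, 9, 10, 11, 12, 13, 14, 15]
    [1, 2, 4, 8, 3, 5, 6, 9, 10, 12, 7, 11, 13, 14, 15]
    (by decide +kernel) (by decide) (by decide) (by decide) (by decide +kernel)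

lemma not_col_butterfly : ¬ Col (edgeGraph 5 [(0, 1), (0, 2), (1, 2), (0, 3), (0, 4), (3, 4)]) :=
  not_col _ [1, 2, 3, 4, 5, 6, 7, 8, 9, 11, 13, 15, 16, 17, 19, 21, 23, 24, 25, 27, 29, 31]
    [1, 2, 4, 8, 16, 3, 5, 6, 9, 17, 24, 7, 11, 13, 19, 21, 25, 15, 23, 27, 29, 31]
    (by decide +kernel) (by decide) (by decide) (by decide) (by decide +kernel)


/-! ### Induced minors -/

/-- There is an edge between `A` and `B`. -/
def Touch {n : ℕ} (G : SimpleGraph (Fin n)) (A B : Finset (Fin n)) : Prop :=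
  ∃ a ∈ A, ∃ b ∈ B, G.Adj a b

lemma Touch.symm {n : ℕ} {G : SimpleGraph (Fin n)} {A B : Finset (Fin n)} (h : Touch G A B) :
    Touch G B A := by
  obtain ⟨a, ha, b, hb, h⟩ := h
  exact ⟨b, hb, a, ha, h.symm⟩

lemma conn_biUnion {n k : ℕ} (G : SimpleGraph (Fin n)) (H : SimpleGraph (Fin k))
    (V : Fin k → Finset (Fin n)) (hV : ∀ j, ConnSet G (V j))
    (hd : ∀ i j, i ≠ j → Disjoint (V i) (V j))
    (ha : ∀ i j, i ≠ j → (H.Adj i j ↔ Touch G (V i) (V j))) (J : Finset (Fin k)) :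
    ConnSet G (J.biUnion V) ↔ ConnSet H J := by
  classical
  have huniq : ∀ i j x, x ∈ V i → x ∈ V j → i = j := by
    intro i j x h1 h2
    by_contra h
    exact (Finset.disjoint_left.1 (hd i j h)) h1 h2
  rw [connSet_iff, connSet_iff]
  simp only [connSet_iff] at hV
  constructor
  · rintro ⟨⟨x, hx⟩, hcut⟩
    obtain ⟨j0, hj0, -⟩ := Finset.mem_biUnion.1 hx
    refine ⟨⟨j0, hj0⟩, fun S hS ⟨s, hs⟩ hSJ => ?_⟩
    obtain ⟨t, ht, hts⟩ : ∃ t ∈ J, t ∉ S := by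
      by_contra h
      push Not at h
      exact hSJ (Finset.Subset.antisymm hS h)
    obtain ⟨y, hy⟩ := (hV t).1
    obtain ⟨z, hz⟩ := (hV s).1
    obtain ⟨a, haS, b, hb, hbS, hab⟩ := hcut (S.biUnion V)
      (Finset.biUnion_subset_biUnion_of_subset_left _ hS)
      ⟨z, Finset.mem_biUnion.2 ⟨s, hs, hz⟩⟩ (by
        intro h
        have : y ∈ S.biUnion V := by rw [h]; exact Finset.mem_biUnion.2 ⟨t, ht, hy⟩
        obtain ⟨t', ht', hy'⟩ := Finset.mem_biUnion.1 this
        exact hts (huniq _ _ _ hy' hy ▸ ht'))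
    obtain ⟨i, hi, hai⟩ := Finset.mem_biUnion.1 haS
    obtain ⟨j, hj, hbj⟩ := Finset.mem_biUnion.1 hb
    have hjS : j ∉ S := fun h => hbS (Finset.mem_biUnion.2 ⟨j, h, hbj⟩)
    refine ⟨i, hi, j, hj, hjS, (ha i j ?_).2 ⟨a, hai, b, hbj, hab⟩⟩
    rintro rfl
    exact hjS hi
  · rintro ⟨⟨j0, hj0⟩, hcut⟩
    obtain ⟨x0, hx0⟩ := (hV j0).1
    refine ⟨⟨x0, Finset.mem_biUnion.2 ⟨j0, hj0, hx0⟩⟩, fun S hS ⟨s, hs⟩ hSJ => ?_⟩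
    by_cases hsplit : ∃ j ∈ J, (∃ x ∈ V j, x ∈ S) ∧ (∃ y ∈ V j, y ∉ S)
    · obtain ⟨j, hj, ⟨x, hx, hxS⟩, ⟨y, hy, hyS⟩⟩ := hsplit
      obtain ⟨a, ha1, b, hb1, hb2, hab⟩ := (hV j).2 (V j ∩ S) Finset.inter_subset_left
        ⟨x, Finset.mem_inter.2 ⟨hx, hxS⟩⟩ (by
          intro h
          have : y ∈ V j ∩ S := by rw [h]; exact hy
          exact hyS (Finset.mem_inter.1 this).2)
      refine ⟨a, (Finset.mem_inter.1 ha1).2, b, Finset.mem_biUnion.2 ⟨j, hj, hb1⟩, ?_, hab⟩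
      exact fun h => hb2 (Finset.mem_inter.2 ⟨hb1, h⟩)
    · push Not at hsplit
      obtain ⟨js, hjs, hsV⟩ := Finset.mem_biUnion.1 (hS hs)
      obtain ⟨t, ht, htS⟩ : ∃ t ∈ J.biUnion V, t ∉ S := by
        by_contra h
        push Not at h
        exact hSJ (Finset.Subset.antisymm hS h)
      obtain ⟨jt, hjt, htV⟩ := Finset.mem_biUnion.1 ht
      obtain ⟨i, hi, j, hj, hjS, hij⟩ := hcut (J.filter fun j => ∃ x ∈ V j, x ∈ S)
        (Finset.filter_subset _ _) ⟨js, Finset.mem_filter.2 ⟨hjs, s, hsV, hs⟩⟩ (by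
          intro h
          have : jt ∈ J.filter fun j => ∃ x ∈ V j, x ∈ S := by rw [h]; exact hjt
          obtain ⟨_, x, hx, hxS⟩ := Finset.mem_filter.1 this
          exact htS (hsplit jt hjt ⟨x, hx, hxS⟩ t htV))
      obtain ⟨hiJ, x, hx, hxS⟩ := Finset.mem_filter.1 hi
      obtain ⟨a, haV, b, hbV, hab⟩ := (ha i j hij.ne).1 hij
      refine ⟨a, hsplit i hiJ ⟨x, hx, hxS⟩ a haV, b, Finset.mem_biUnion.2 ⟨j, hj, hbV⟩, ?_, hab⟩
      exact fun h => hjS (Finset.mem_filter.2 ⟨hj, b, hbV, h⟩)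

lemma minor_col {n k : ℕ} (G : SimpleGraph (Fin n)) (H : SimpleGraph (Fin k))
    (V : Fin k → Finset (Fin n)) (hV : ∀ j, ConnSet G (V j))
    (hd : ∀ i j, i < j → Disjoint (V i) (V j))
    (ha : ∀ i j, i < j → (H.Adj i j ↔ Touch G (V i) (V j))) (hG : Col G) : Col H := by
  classical
  have hd' : ∀ i j, i ≠ j → Disjoint (V i) (V j) := by
    intro i j hij
    rcases lt_or_gt_of_ne hij with h | h
    · exact hd i j h
    · exact (hd j i h).symm
  have ha' : ∀ i j, i ≠ j → (H.Adj i j ↔ Touch G (V i) (V j)) := by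
    intro i j hij
    rcases lt_or_gt_of_ne hij with h | h
    · exact ha i j h
    · rw [SimpleGraph.adj_comm, ha j i h]
      exact ⟨Touch.symm, Touch.symm⟩
  have huniq : ∀ i j x, x ∈ V i → x ∈ V j → i = j := by
    intro i j x h1 h2
    by_contra h
    exact (Finset.disjoint_left.1 (hd' i j h)) h1 h2
  have hmem : ∀ (J : Finset (Fin k)) j x, x ∈ V j → (x ∈ J.biUnion V ↔ j ∈ J) := by
    intro J j x hx
    rw [Finset.mem_biUnion]
    constructor
    · rintro ⟨i, hi, hxi⟩
      rwa [huniq j i x hx hxi]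
    · exact fun h => ⟨j, h, hx⟩
  have hsub : ∀ A B : Finset (Fin k), A.biUnion V ⊆ B.biUnion V ↔ A ⊆ B := by
    intro A B
    refine ⟨fun h j hj => ?_, Finset.biUnion_subset_biUnion_of_subset_left _⟩
    obtain ⟨x, hx⟩ := (hV j).1
    exact (hmem B j x hx).1 (h ((hmem A j x hx).2 hj))
  have hdis : ∀ A B : Finset (Fin k), Disjoint (A.biUnion V) (B.biUnion V) ↔ Disjoint A B := by
    intro A B
    rw [Finset.disjoint_left, Finset.disjoint_left]
    constructor
    · intro h j hj hj'
      obtain ⟨x, hx⟩ := (hV j).1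
      exact h ((hmem A j x hx).2 hj) ((hmem B j x hx).2 hj')
    · intro h x hx hx'
      obtain ⟨j, hj, hxj⟩ := Finset.mem_biUnion.1 hx
      exact h hj ((hmem B j x hxj).1 hx')
  have hsymm : ∀ A B : Finset (Fin k),
      (symmDiff A B).biUnion V = symmDiff (A.biUnion V) (B.biUnion V) := by
    intro A B
    ext x
    by_cases hx : ∃ j, x ∈ V j
    · obtain ⟨j, hj⟩ := hx
      rw [Finset.mem_symmDiff, hmem _ j x hj, hmem _ j x hj, hmem _ j x hj, Finset.mem_symmDiff]
    · push Not at hx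
      simp [Finset.mem_symmDiff, hx]
  have hcomp : ∀ A B : Finset (Fin k), Compat (A.biUnion V) (B.biUnion V) ↔ Compat A B := by
    intro A B
    simp only [Compat, hsub, hdis]
  have hconn := conn_biUnion G H V hV hd' ha'
  obtain ⟨c, hc⟩ := hG
  refine ⟨fun J => c (J.biUnion V), fun A B hA hB hAB => ?_⟩
  have := hc _ _ ((hconn A).2 hA) ((hconn B).2 hB) (by
    intro h
    exact hAB (Finset.Subset.antisymm ((hsub _ _).1 h.subset) ((hsub _ _).1 h.symm.subset)))
  rw [hcomp, ← hsymm, hconn] at this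
  exact this

lemma connSet_singleton {n : ℕ} (G : SimpleGraph (Fin n)) (x : Fin n) : ConnSet G {x} := by
  rw [connSet_iff]
  refine ⟨by simp, fun S hS hne hS' => ?_⟩
  rcases Finset.subset_singleton_iff.1 hS with h | h
  · simp [h] at hne
  · exact (hS' h).elim

lemma connSet_union {n : ℕ} {G : SimpleGraph (Fin n)} {A B : Finset (Fin n)}
    (hA : ConnSet G A) (hB : ConnSet G B) (h : Touch G A B) : ConnSet G (A ∪ B) := by
  rw [connSet_iff] at *
  refine ⟨hA.1.mono Finset.subset_union_left, fun S hS ⟨s, hs⟩ hne => ?_⟩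
  have aux : ∀ C, CutConn G C → C ⊆ A ∪ B → (∃ x ∈ C, x ∈ S) → (∃ y ∈ C, y ∉ S) →
      ∃ a ∈ S, ∃ b ∈ A ∪ B, b ∉ S ∧ G.Adj a b := by
    rintro C hC hCAB ⟨x, hx, hxS⟩ ⟨y, hy, hyS⟩
    obtain ⟨a, ha1, b, hb1, hb2, hab⟩ := hC.2 (C ∩ S) Finset.inter_subset_left
        ⟨x, Finset.mem_inter.2 ⟨hx, hxS⟩⟩ (by
          intro h
          have : y ∈ C ∩ S := by rw [h]; exact hy
          exact hyS (Finset.mem_inter.1 this).2)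
    exact ⟨a, (Finset.mem_inter.1 ha1).2, b, hCAB hb1,
      fun h => hb2 (Finset.mem_inter.2 ⟨hb1, h⟩), hab⟩
  by_cases h1 : (∃ x ∈ A, x ∈ S) ∧ (∃ y ∈ A, y ∉ S)
  · exact aux A hA Finset.subset_union_left h1.1 h1.2
  by_cases h2 : (∃ x ∈ B, x ∈ S) ∧ (∃ y ∈ B, y ∉ S)
  · exact aux B hB Finset.subset_union_right h2.1 h2.2
  obtain ⟨a, ha, b, hb, hab⟩ := h
  have hdiff : ¬ (a ∈ S ↔ b ∈ S) := by
    intro hiff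
    apply hne
    apply Finset.Subset.antisymm hS
    have h3 : s ∈ A ∨ s ∈ B := Finset.mem_union.1 (hS hs)
    intro x hx
    rw [Finset.mem_union] at hx
    grind
  by_cases haS : a ∈ S
  · exact ⟨a, haS, b, Finset.mem_union_right _ hb, by tauto, hab⟩
  · exact ⟨b, by tauto, a, Finset.mem_union_left _ ha, haS, hab.symm⟩

section Obstructions
variable {n : ℕ} {G : SimpleGraph (Fin n)} {A B C D E : Finset (Fin n)}

lemma obs4 (El : List (ℕ × ℕ)) (hnot : ¬ Col (edgeGraph 4 El)) (hG : Col G)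
    (hA : ConnSet G A) (hB : ConnSet G B) (hC : ConnSet G C) (hD : ConnSet G D)
    (dAB : Disjoint A B) (dAC : Disjoint A C) (dAD : Disjoint A D)
    (dBC : Disjoint B C) (dBD : Disjoint B D) (dCD : Disjoint C D)
    (tAB : (edgeGraph 4 El).Adj 0 1 ↔ Touch G A B) (tAC : (edgeGraph 4 El).Adj 0 2 ↔ Touch G A C)
    (tAD : (edgeGraph 4 El).Adj 0 3 ↔ Touch G A D) (tBC : (edgeGraph 4 El).Adj 1 2 ↔ Touch G B C)
    (tBD : (edgeGraph 4 El).Adj 1 3 ↔ Touch G B D)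
    (tCD : (edgeGraph 4 El).Adj 2 3 ↔ Touch G C D) : False := by
  refine hnot (minor_col G _ ![A, B, C, D] ?_ ?_ ?_ hG)
  · intro j; fin_cases j <;> assumption
  · intro i j hij
    fin_cases i <;> fin_cases j <;> first | exact absurd hij (by decide) | assumption
  · intro i j hij
    fin_cases i <;> fin_cases j <;> first | exact absurd hij (by decide) | assumption

lemma no_claw (hG : Col G)
    (hA : ConnSet G A) (hB : ConnSet G B) (hC : ConnSet G C) (hD : ConnSet G D)
    (dAB : Disjoint A B) (dAC : Disjoint A C) (dAD : Disjoint A D)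
    (dBC : Disjoint B C) (dBD : Disjoint B D) (dCD : Disjoint C D)
    (tAB : Touch G A B) (tAC : Touch G A C) (tAD : Touch G A D)
    (tBC : ¬ Touch G B C) (tBD : ¬ Touch G B D) (tCD : ¬ Touch G C D) : False :=
  obs4 _ not_col_claw hG hA hB hC hD dAB dAC dAD dBC dBD dCD
    (iff_of_true (by decide) tAB) (iff_of_true (by decide) tAC) (iff_of_true (by decide) tAD)
    (iff_of_false (by decide) tBC) (iff_of_false (by decide) tBD) (iff_of_false (by decide) tCD)

/-- The cycle is `A B C D`. -/
lemma no_cycle4 (hG : Col G)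
    (hA : ConnSet G A) (hB : ConnSet G B) (hC : ConnSet G C) (hD : ConnSet G D)
    (dAB : Disjoint A B) (dAC : Disjoint A C) (dAD : Disjoint A D)
    (dBC : Disjoint B C) (dBD : Disjoint B D) (dCD : Disjoint C D)
    (tAB : Touch G A B) (tBC : Touch G B C) (tCD : Touch G C D) (tAD : Touch G A D)
    (tAC : ¬ Touch G A C) (tBD : ¬ Touch G B D) : False :=
  obs4 _ not_col_cycle4 hG hA hB hC hD dAB dAC dAD dBC dBD dCD
    (iff_of_true (by decide) tAB) (iff_of_false (by decide) tAC) (iff_of_true (by decide) tAD)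
    (iff_of_true (by decide) tBC) (iff_of_false (by decide) tBD) (iff_of_true (by decide) tCD)

/-- The only non-edge is `B D`. -/
lemma no_diamond (hG : Col G)
    (hA : ConnSet G A) (hB : ConnSet G B) (hC : ConnSet G C) (hD : ConnSet G D)
    (dAB : Disjoint A B) (dAC : Disjoint A C) (dAD : Disjoint A D)
    (dBC : Disjoint B C) (dBD : Disjoint B D) (dCD : Disjoint C D)
    (tAB : Touch G A B) (tBC : Touch G B C) (tCD : Touch G C D) (tAD : Touch G A D)
    (tAC : Touch G A C) (tBD : ¬ Touch G B D) : False :=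
  obs4 _ not_col_diamond hG hA hB hC hD dAB dAC dAD dBC dBD dCD
    (iff_of_true (by decide) tAB) (iff_of_true (by decide) tAC) (iff_of_true (by decide) tAD)
    (iff_of_true (by decide) tBC) (iff_of_false (by decide) tBD) (iff_of_true (by decide) tCD)

lemma no_k4 (hG : Col G)
    (hA : ConnSet G A) (hB : ConnSet G B) (hC : ConnSet G C) (hD : ConnSet G D)
    (dAB : Disjoint A B) (dAC : Disjoint A C) (dAD : Disjoint A D)
    (dBC : Disjoint B C) (dBD : Disjoint B D) (dCD : Disjoint C D)
    (tAB : Touch G A B) (tBC : Touch G B C) (tCD : Touch G C D) (tAD : Touch G A D)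
    (tAC : Touch G A C) (tBD : Touch G B D) : False :=
  obs4 _ not_col_k4 hG hA hB hC hD dAB dAC dAD dBC dBD dCD
    (iff_of_true (by decide) tAB) (iff_of_true (by decide) tAC) (iff_of_true (by decide) tAD)
    (iff_of_true (by decide) tBC) (iff_of_true (by decide) tBD) (iff_of_true (by decide) tCD)

/-- Triangles `A B C` and `A D E`. -/
lemma no_butterfly (hG : Col G)
    (hA : ConnSet G A) (hB : ConnSet G B) (hC : ConnSet G C) (hD : ConnSet G D)
    (hE : ConnSet G E)
    (dAB : Disjoint A B) (dAC : Disjoint A C) (dAD : Disjoint A D) (dAE : Disjoint A E)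
    (dBC : Disjoint B C) (dBD : Disjoint B D) (dBE : Disjoint B E) (dCD : Disjoint C D)
    (dCE : Disjoint C E) (dDE : Disjoint D E)
    (tAB : Touch G A B) (tAC : Touch G A C) (tBC : Touch G B C) (tAD : Touch G A D)
    (tAE : Touch G A E) (tDE : Touch G D E)
    (tBD : ¬ Touch G B D) (tBE : ¬ Touch G B E) (tCD : ¬ Touch G C D) (tCE : ¬ Touch G C E) :
    False := by
  refine not_col_butterfly (minor_col G _ ![A, B, C, D, E] ?_ ?_ ?_ hG)
  · intro j; fin_cases j <;> assumption
  · intro i j hij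
    fin_cases i <;> fin_cases j <;> first | exact absurd hij (by decide) | assumption
  · intro i j hij
    fin_cases i <;> fin_cases j <;> first
      | exact absurd hij (by decide)
      | exact iff_of_true (by decide) (by assumption)
      | exact iff_of_false (by decide) (by assumption)

end Obstructions


/-! ### Obstructions with singletons -/

lemma touch_singleton {n : ℕ} {G : SimpleGraph (Fin n)} {x y : Fin n} :
    Touch G {x} {y} ↔ G.Adj x y := by
  simp [Touch]

lemma touch_set_singleton {n : ℕ} {G : SimpleGraph (Fin n)} {A : Finset (Fin n)} {y : Fin n} :
    Touch G A {y} ↔ ∃ i ∈ A, G.Adj i y := by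
  simp [Touch]

lemma claw_s {n : ℕ} {G : SimpleGraph (Fin n)} (hG : Col G) {A : Finset (Fin n)} {b c d : Fin n}
    (hA : ConnSet G A) (hb : b ∉ A) (hc : c ∉ A) (hd : d ∉ A)
    (bc : b ≠ c) (bd : b ≠ d) (cd : c ≠ d)
    (tb : ∃ i ∈ A, G.Adj i b) (tc : ∃ i ∈ A, G.Adj i c) (td : ∃ i ∈ A, G.Adj i d)
    (nbc : ¬ G.Adj b c) (nbd : ¬ G.Adj b d) (ncd : ¬ G.Adj c d) : False := by
  refine no_claw hG hA (connSet_singleton G b) (connSet_singleton G c) (connSet_singleton G d)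
    ?_ ?_ ?_ ?_ ?_ ?_ ?_ ?_ ?_ ?_ ?_ ?_ <;>
    simp only [touch_set_singleton, exists_eq_left, Finset.disjoint_singleton_right,
      Finset.mem_singleton] <;> first | assumption | exact Ne.symm (by assumption)

/-- `A`, `b`, `c`, `d` in cyclic order. -/
lemma cycle_s {n : ℕ} {G : SimpleGraph (Fin n)} (hG : Col G) {A : Finset (Fin n)} {b c d : Fin n}
    (hA : ConnSet G A) (hb : b ∉ A) (hc : c ∉ A) (hd : d ∉ A)
    (bc : b ≠ c) (bd : b ≠ d) (cd : c ≠ d)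
    (tb : ∃ i ∈ A, G.Adj i b) (tc : ¬ ∃ i ∈ A, G.Adj i c) (td : ∃ i ∈ A, G.Adj i d)
    (nbc : G.Adj b c) (nbd : ¬ G.Adj b d) (ncd : G.Adj c d) : False := by
  refine no_cycle4 hG hA (connSet_singleton G b) (connSet_singleton G c) (connSet_singleton G d)
    ?_ ?_ ?_ ?_ ?_ ?_ ?_ ?_ ?_ ?_ ?_ ?_ <;>
    simp only [touch_set_singleton, exists_eq_left, Finset.disjoint_singleton_right,
      Finset.mem_singleton] <;> first | assumption | exact Ne.symm (by assumption)

lemma diamond_s {n : ℕ} {G : SimpleGraph (Fin n)} (hG : Col G) {a b c d : Fin n}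
    (ab : G.Adj a b) (bc : G.Adj b c) (cd : G.Adj c d) (ad : G.Adj a d) (ac : G.Adj a c)
    (hbd : b ≠ d) (bd : ¬ G.Adj b d) : False := by
  refine no_diamond hG (connSet_singleton G a) (connSet_singleton G b) (connSet_singleton G c)
    (connSet_singleton G d) ?_ ?_ ?_ ?_ ?_ ?_ ?_ ?_ ?_ ?_ ?_ ?_ <;>
    simp only [touch_singleton, Finset.disjoint_singleton_right,
      Finset.mem_singleton] <;> first | assumption | skip
  exacts [ab.ne', ac.ne', ad.ne', bc.ne', fun h => hbd h.symm, cd.ne']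

lemma k4_s {n : ℕ} {G : SimpleGraph (Fin n)} (hG : Col G) {a b c d : Fin n}
    (ab : G.Adj a b) (bc : G.Adj b c) (cd : G.Adj c d) (ad : G.Adj a d) (ac : G.Adj a c)
    (bd : G.Adj b d) : False := by
  refine no_k4 hG (connSet_singleton G a) (connSet_singleton G b) (connSet_singleton G c)
    (connSet_singleton G d) ?_ ?_ ?_ ?_ ?_ ?_ ?_ ?_ ?_ ?_ ?_ ?_ <;>
    simp only [touch_singleton, Finset.disjoint_singleton_right,
      Finset.mem_singleton] <;> first | assumption | skip
  exacts [ab.ne', ac.ne', ad.ne', bc.ne', bd.ne', cd.ne']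

lemma butterfly_s {n : ℕ} {G : SimpleGraph (Fin n)} (hG : Col G) {A : Finset (Fin n)}
    {b c d e : Fin n}
    (hA : ConnSet G A) (hb : b ∉ A) (hc : c ∉ A) (hd : d ∉ A) (he : e ∉ A)
    (hbd : b ≠ d) (hbe : b ≠ e) (hcd : c ≠ d) (hce : c ≠ e)
    (tb : ∃ i ∈ A, G.Adj i b) (tc : ∃ i ∈ A, G.Adj i c) (td : ∃ i ∈ A, G.Adj i d)
    (te : ∃ i ∈ A, G.Adj i e)
    (bc : G.Adj b c) (de : G.Adj d e)
    (nbd : ¬ G.Adj b d) (nbe : ¬ G.Adj b e) (ncd : ¬ G.Adj c d) (nce : ¬ G.Adj c e) :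
    False := by
  refine no_butterfly hG hA (connSet_singleton G b) (connSet_singleton G c)
    (connSet_singleton G d) (connSet_singleton G e)
    ?_ ?_ ?_ ?_ ?_ ?_ ?_ ?_ ?_ ?_ ?_ ?_ ?_ ?_ ?_ ?_ ?_ ?_ ?_ ?_ <;>
    simp only [touch_set_singleton, exists_eq_left, Finset.disjoint_singleton_right,
      Finset.mem_singleton] <;> first | assumption | (exact Ne.symm (by assumption)) | skip
  exacts [bc.ne', de.ne']

/-- Interval of vertices. -/
def Iv (n a b : ℕ) : Finset (Fin n) := Finset.univ.filter fun x => a ≤ x.val ∧ x.val ≤ b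

lemma mem_Iv {n a b : ℕ} {x : Fin n} : x ∈ Iv n a b ↔ a ≤ x.val ∧ x.val ≤ b := by
  simp [Iv]

lemma connSet_Iv {n : ℕ} {G : SimpleGraph (Fin n)} (a : ℕ) : ∀ b, a ≤ b → b < n →
    (∀ x y : Fin n, a ≤ x.val → y.val ≤ b → x.val + 1 = y.val → G.Adj x y) →
    ConnSet G (Iv n a b) := by
  intro b hab
  induction b, hab using Nat.le_induction with
  | base =>
    intro hb _
    have : Iv n a a = {⟨a, hb⟩} := by
      ext x
      simp only [mem_Iv, Finset.mem_singleton, Fin.ext_iff]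
      omega
    rw [this]
    exact connSet_singleton _ _
  | succ b hab ih =>
    intro hb h
    have : Iv n a (b + 1) = Iv n a b ∪ {⟨b + 1, hb⟩} := by
      ext x
      simp only [mem_Iv, Finset.mem_singleton, Fin.ext_iff, Finset.mem_union]
      omega
    rw [this]
    refine connSet_union (ih (by omega) fun x y h1 h2 h3 => h x y h1 (by omega) h3)
      (connSet_singleton _ _) ?_
    rw [touch_set_singleton]
    exact ⟨⟨b, by omega⟩, mem_Iv.2 ⟨hab, le_rfl⟩, h _ _ hab le_rfl rfl⟩

lemma connSet_pair {n : ℕ} {G : SimpleGraph (Fin n)} {x y : Fin n} (h : G.Adj x y) :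
    ConnSet G {x, y} :=
  connSet_union (connSet_singleton G x) (connSet_singleton G y) (touch_singleton.2 h)

/-! ### The graph-theoretic classification -/

/-- The graphs in the classification. -/
def Good {n : ℕ} (G : SimpleGraph (Fin n)) : Prop :=
  (∃ m : ℕ, Nonempty (G ≃g SimpleGraph.pathGraph m)) ∨
    (∃ m : ℕ, 2 ≤ m ∧ Nonempty (G ≃g pathTriangle m 1))

/-- Adjacency of the path-with-triangle on natural numbers. -/
def TriAdj (m i j : ℕ) : Prop :=
  (i + 1 = j ∧ j < m) ∨ (j + 1 = i ∧ i < m) ∨ (i ≤ 1 ∧ j = m) ∨ (j ≤ 1 ∧ i = m)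

lemma pathTriangle_adj {m : ℕ} (hm : 2 ≤ m) (x y : Fin (m + 1)) :
    (pathTriangle m 1).Adj x y ↔ TriAdj m x.val y.val := by
  simp only [pathTriangle, SimpleGraph.fromRel_adj, TriAdj, ne_eq, Fin.ext_iff]
  omega

lemma exists_equiv {n : ℕ} (f : ℕ → ℕ) (hf : ∀ x < n, f x < n)
    (hi : ∀ x < n, ∀ y < n, f x = f y → x = y) :
    ∃ e : Fin n ≃ Fin n, ∀ x, (e x).val = f x.val := by
  let g : Fin n → Fin n := fun x => ⟨f x.val, hf _ x.2⟩
  have hg : Function.Injective g := by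
    intro x y h
    exact Fin.ext (hi _ x.2 _ y.2 (Fin.ext_iff.1 h))
  exact ⟨Equiv.ofBijective g (Finite.injective_iff_bijective.1 hg), fun x => rfl⟩

lemma good_path {n : ℕ} {G : SimpleGraph (Fin n)} (f : ℕ → ℕ) (hf : ∀ x < n, f x < n)
    (hi : ∀ x < n, ∀ y < n, f x = f y → x = y)
    (h : ∀ x y : Fin n, G.Adj x y ↔ (f x.val + 1 = f y.val ∨ f y.val + 1 = f x.val)) :
    Good G := by
  obtain ⟨e, he⟩ := exists_equiv f hf hi
  refine Or.inl ⟨n, ⟨⟨e, ?_⟩⟩⟩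
  intro a b
  rw [SimpleGraph.pathGraph_adj, he, he, h]

lemma good_tri {m : ℕ} {G : SimpleGraph (Fin (m + 1))} (hm : 2 ≤ m) (f : ℕ → ℕ)
    (hf : ∀ x < m + 1, f x < m + 1)
    (hi : ∀ x < m + 1, ∀ y < m + 1, f x = f y → x = y)
    (h : ∀ x y : Fin (m + 1), G.Adj x y ↔ TriAdj m (f x.val) (f y.val)) :
    Good G := by
  obtain ⟨e, he⟩ := exists_equiv f hf hi
  refine Or.inr ⟨m, hm, ⟨⟨e, ?_⟩⟩⟩
  intro a b
  rw [pathTriangle_adj hm, he, he, h]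

/-- Adjacency of a path with one more vertex. -/
def PathExt (m : ℕ) (N : ℕ → Prop) (i j : ℕ) : Prop :=
  (i < m ∧ j < m ∧ (i + 1 = j ∨ j + 1 = i)) ∨ (i = m ∧ j < m ∧ N j) ∨ (j = m ∧ i < m ∧ N i)

lemma pathExt_congr {m : ℕ} {N N' : ℕ → Prop} (h : ∀ j < m, (N j ↔ N' j)) (x y : ℕ) :
    PathExt m N x y ↔ PathExt m N' x y := by
  unfold PathExt
  have h1 := h x
  have h2 := h y
  tauto

lemma pathExt_left {m j : ℕ} {N : ℕ → Prop} (hj : j < m) (h : N j) : PathExt m N m j :=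
  Or.inr (Or.inl ⟨rfl, hj, h⟩)

lemma pathExt_right {m j : ℕ} {N : ℕ → Prop} (hj : j < m) (h : N j) : PathExt m N j m :=
  Or.inr (Or.inr ⟨rfl, hj, h⟩)

lemma pathExt_path {m i j : ℕ} {N : ℕ → Prop} (hi : i < m) (hj : j < m) :
    PathExt m N i j ↔ (i + 1 = j ∨ j + 1 = i) := by
  unfold PathExt
  omega

lemma path_case_one {m i : ℕ} {G : SimpleGraph (Fin (m + 1))} (hG : Col G) (hi : i < m)
    (hadj : ∀ x y : Fin (m + 1), G.Adj x y ↔ PathExt m (fun j => j = i) x.val y.val) : Good G := by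
  by_cases h0 : i = 0
  · refine good_path (fun x => if x < m then x + 1 else 0) ?_ ?_ ?_
    · intro x hx; split_ifs <;> omega
    · intro x hx y hy h; split_ifs at h <;> omega
    intro x y
    have := x.2
    have := y.2
    rw [hadj]
    unfold PathExt
    clear hadj
    grind
  by_cases hl : i + 1 = m
  · refine good_path id (fun x h => h) (fun x _ y _ h => h) ?_
    intro x y
    have := x.2
    have := y.2
    rw [hadj]
    unfold PathExt
    simp only [id]
    omega
  exfalso
  refine claw_s hG (connSet_singleton G ⟨i, by omega⟩) (b := ⟨i - 1, by omega⟩)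
    (c := ⟨i + 1, by omega⟩) (d := ⟨m, by omega⟩) ?_ ?_ ?_ ?_ ?_ ?_ ?_ ?_ ?_ ?_ ?_ ?_ <;>
    simp only [hadj, Fin.ext_iff, ne_eq, Finset.mem_singleton]
  any_goals first | omega | (unfold PathExt; beta_reduce; omega)
  · exact ⟨⟨i, by omega⟩, rfl, by dsimp only; unfold PathExt; beta_reduce; omega⟩
  · exact ⟨⟨i, by omega⟩, rfl, by dsimp only; unfold PathExt; beta_reduce; omega⟩
  · exact ⟨⟨i, by omega⟩, rfl, by dsimp only; unfold PathExt; beta_reduce; omega⟩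

lemma path_case_two {m i : ℕ} {G : SimpleGraph (Fin (m + 1))} (hG : Col G) (hi : i + 1 < m)
    (hadj : ∀ x y : Fin (m + 1), G.Adj x y ↔
      PathExt m (fun j => j = i ∨ j = i + 1) x.val y.val) : Good G := by
  by_cases h0 : i = 0
  · refine good_tri (by omega) id (fun x h => h) (fun x _ y _ h => h) ?_
    intro x y
    have := x.2
    have := y.2
    rw [hadj]
    simp only [PathExt, TriAdj, id]
    omega
  by_cases hl : i + 2 = m
  · refine good_tri (by omega) (fun x => if x < m then m - 1 - x else m) ?_ ?_ ?_
    · intro x hx; split_ifs <;> omega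
    · intro x hx y hy h; split_ifs at h <;> omega
    intro x y
    have := x.2
    have := y.2
    rw [hadj]
    simp only [PathExt, TriAdj]
    split_ifs <;> omega
  exfalso
  have hx : G.Adj ⟨i, by omega⟩ ⟨i + 1, by omega⟩ := by
    rw [hadj]; dsimp only; unfold PathExt; beta_reduce; omega
  refine claw_s hG (connSet_pair hx) (b := ⟨i - 1, by omega⟩) (c := ⟨i + 2, by omega⟩)
    (d := ⟨m, by omega⟩) ?_ ?_ ?_ ?_ ?_ ?_ ?_ ?_ ?_ ?_ ?_ ?_ <;>
    simp only [hadj, Fin.ext_iff, ne_eq, Finset.mem_insert, Finset.mem_singleton]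
  any_goals first | omega | (unfold PathExt; beta_reduce; omega)
  · exact ⟨⟨i, by omega⟩, by simp, by dsimp only; unfold PathExt; beta_reduce; omega⟩
  · exact ⟨⟨i + 1, by omega⟩, by simp, by dsimp only; unfold PathExt; beta_reduce; omega⟩
  · exact ⟨⟨i + 1, by omega⟩, by simp, by dsimp only; unfold PathExt; beta_reduce; omega⟩

lemma path_case {m : ℕ} {G : SimpleGraph (Fin (m + 1))} (hG : Col G) (N : ℕ → Prop)
    (hadj : ∀ x y : Fin (m + 1), G.Adj x y ↔ PathExt m N x.val y.val)
    (hN : ∃ i, i < m ∧ N i) : Good G := by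
  classical
  obtain ⟨hi, hNi⟩ := Nat.find_spec hN
  have hmin : ∀ j < m, N j → Nat.find hN ≤ j := fun j hj h => Nat.find_min' hN ⟨hj, h⟩
  generalize Nat.find hN = i at hi hNi hmin
  -- gaps are impossible
  have gap : ∀ a b, a + 1 < b → b < m → N a → N b → (∀ j, a < j → j < b → ¬ N j) → False := by
    intro a b hab hbm ha hb hj
    refine cycle_s hG (A := Iv (m + 1) (a + 1) (b - 1)) (b := ⟨a, by omega⟩)
      (c := ⟨m, by omega⟩) (d := ⟨b, by omega⟩)
      (connSet_Iv _ _ (by omega) (by omega) ?_) ?_ ?_ ?_ ?_ ?_ ?_ ?_ ?_ ?_ ?_ ?_ ?_ <;>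
      simp only [hadj, mem_Iv, Fin.ext_iff, ne_eq]
    any_goals omega
    · intro x y h1 h2 h3
      rw [pathExt_path] <;> omega
    · refine ⟨⟨a + 1, by omega⟩, by simp only; omega, ?_⟩
      dsimp only
      rw [pathExt_path] <;> omega
    · rintro ⟨x, hx, h⟩
      rcases h with h | h | h
      · omega
      · omega
      · exact hj x (by omega) (by omega) h.2.2
    · refine ⟨⟨b - 1, by omega⟩, by simp only; omega, ?_⟩
      dsimp only
      rw [pathExt_path] <;> omega
    · exact pathExt_right (by omega) ha
    · rw [pathExt_path] <;> omega
    · exact pathExt_left (by omega) hb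
  have gap' : ∀ a b, a < b → b < m → N a → N b → N (a + 1) := by
    intro a b hab hbm ha hb
    by_contra h
    have hex : ∃ c, a < c ∧ N c := ⟨b, hab, hb⟩
    obtain ⟨h1, h2⟩ := Nat.find_spec hex
    have h3 : ∀ j, j < Nat.find hex → ¬ (a < j ∧ N j) := fun j hj => Nat.find_min hex hj
    have h4 : Nat.find hex ≤ b := Nat.find_min' hex ⟨hab, hb⟩
    generalize Nat.find hex = c at h1 h2 h3 h4
    have : c ≠ a + 1 := by rintro rfl; exact h h2
    exact gap a c (by omega) (by omega) ha h2 fun j hj1 hj2 hj3 => h3 j hj2 ⟨hj1, hj3⟩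
  by_cases h1 : i + 1 < m ∧ N (i + 1)
  · obtain ⟨h1m, h1⟩ := h1
    by_cases h2 : i + 2 < m ∧ N (i + 2)
    · exfalso
      obtain ⟨h2m, h2⟩ := h2
      refine diamond_s hG (a := ⟨m, by omega⟩) (b := ⟨i, by omega⟩) (c := ⟨i + 1, by omega⟩)
        (d := ⟨i + 2, by omega⟩) ?_ ?_ ?_ ?_ ?_ ?_ ?_ <;>
        simp only [hadj, Fin.ext_iff, ne_eq]
      · exact pathExt_left (by omega) hNi
      · rw [pathExt_path] <;> omega
      · rw [pathExt_path] <;> omega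
      · exact pathExt_left (by omega) h2
      · exact pathExt_left (by omega) h1
      · omega
      · rw [pathExt_path] <;> omega
    · refine path_case_two hG h1m fun x y => (hadj x y).trans (pathExt_congr ?_ _ _)
      intro j hj
      constructor
      · intro h
        have := hmin j hj h
        by_contra hc
        exact h2 ⟨by omega, gap' (i + 1) j (by omega) hj h1 h⟩
      · rintro (rfl | rfl) <;> assumption
  · refine path_case_one hG hi fun x y => (hadj x y).trans (pathExt_congr ?_ _ _)
    intro j hj
    constructor
    · intro h
      have := hmin j hj h
      by_contra hc
      exact h1 ⟨by omega, gap' i j (by omega) hj hNi h⟩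
    · rintro rfl; assumption

/-- Adjacency of a path-with-triangle with one more vertex. -/
def TriExt (m : ℕ) (N : ℕ → Prop) (i j : ℕ) : Prop :=
  (i ≤ m ∧ j ≤ m ∧ TriAdj m i j) ∨ (i = m + 1 ∧ j ≤ m ∧ N j) ∨ (j = m + 1 ∧ i ≤ m ∧ N i)

lemma triExt_in {m i j : ℕ} {N : ℕ → Prop} (hi : i ≤ m) (hj : j ≤ m) :
    TriExt m N i j ↔ TriAdj m i j := by
  unfold TriExt TriAdj
  omega

lemma triExt_left {m j : ℕ} {N : ℕ → Prop} (hj : j ≤ m) : TriExt m N (m + 1) j ↔ N j := by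
  unfold TriExt
  constructor
  · rintro (h | h | h)
    · omega
    · exact h.2.2
    · omega
  · exact fun h => Or.inr (Or.inl ⟨rfl, hj, h⟩)

lemma triExt_right {m j : ℕ} {N : ℕ → Prop} (hj : j ≤ m) : TriExt m N j (m + 1) ↔ N j := by
  unfold TriExt
  constructor
  · rintro (h | h | h)
    · omega
    · omega
    · exact h.2.2
  · exact fun h => Or.inr (Or.inr ⟨rfl, hj, h⟩)

lemma triExt_congr {m : ℕ} {N N' : ℕ → Prop} (h : ∀ j ≤ m, (N j ↔ N' j)) (x y : ℕ) :
    TriExt m N x y ↔ TriExt m N' x y := by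
  unfold TriExt
  have h1 := h x
  have h2 := h y
  tauto

/-- Two neighbours in the triangle. -/
lemma tri_two {n : ℕ} {G : SimpleGraph (Fin n)} (hG : Col G) {a b c v : Fin n}
    (hvc : v ≠ c) (ab : G.Adj a b) (ac : G.Adj a c) (bc : G.Adj b c) (va : G.Adj v a)
    (vb : G.Adj v b) :
    False := by
  by_cases vc : G.Adj v c
  · exact k4_s hG va ab bc vc vb ac
  · exact diamond_s hG (a := a) (b := v) (c := b) (d := c) va.symm vb bc ac ab
      hvc vc

lemma tri_case {m : ℕ} {G : SimpleGraph (Fin (m + 2))} (hm : 2 ≤ m) (hG : Col G) (N : ℕ → Prop)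
    (hadj : ∀ x y : Fin (m + 2), G.Adj x y ↔ TriExt m N x.val y.val)
    (hN : ∃ i, i ≤ m ∧ N i) : Good G := by
  classical
  have h01 : ¬ (N 0 ∧ N 1) := by
    rintro ⟨h0, h1⟩
    refine tri_two hG (a := ⟨0, by omega⟩) (b := ⟨1, by omega⟩) (c := ⟨m, by omega⟩)
      (v := ⟨m + 1, by omega⟩) ?_ ?_ ?_ ?_ ?_ ?_ <;> simp only [hadj, Fin.ext_iff, ne_eq]
    all_goals first
      | omega
      | (rw [triExt_in] <;> (try unfold TriAdj) <;> omega)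
      | (rw [triExt_left] <;> first | assumption | omega)
  have h0m : ¬ (N 0 ∧ N m) := by
    rintro ⟨h0, h1⟩
    refine tri_two hG (a := ⟨0, by omega⟩) (b := ⟨m, by omega⟩) (c := ⟨1, by omega⟩)
      (v := ⟨m + 1, by omega⟩) ?_ ?_ ?_ ?_ ?_ ?_ <;> simp only [hadj, Fin.ext_iff, ne_eq]
    all_goals first
      | omega
      | (rw [triExt_in] <;> (try unfold TriAdj) <;> omega)
      | (rw [triExt_left] <;> first | assumption | omega)
  have h1m : ¬ (N 1 ∧ N m) := by
    rintro ⟨h0, h1⟩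
    refine tri_two hG (a := ⟨1, by omega⟩) (b := ⟨m, by omega⟩) (c := ⟨0, by omega⟩)
      (v := ⟨m + 1, by omega⟩) ?_ ?_ ?_ ?_ ?_ ?_ <;> simp only [hadj, Fin.ext_iff, ne_eq]
    all_goals first
      | omega
      | (rw [triExt_in] <;> (try unfold TriAdj) <;> omega)
      | (rw [triExt_left] <;> first | assumption | omega)
  -- `v` adjacent to `a ∈ {0, m}`, the other being `c`
  have key : ∀ a c, ((a = 0 ∧ c = m) ∨ (a = m ∧ c = 0)) → N a → 3 ≤ m → False := by
    intro a c hac ha hm3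
    have hc : ¬ N c := by rcases hac with ⟨rfl, rfl⟩ | ⟨rfl, rfl⟩ <;> tauto
    have h1 : ¬ N 1 := by rcases hac with ⟨rfl, rfl⟩ | ⟨rfl, rfl⟩ <;> tauto
    by_cases ht : ∃ t, 2 ≤ t ∧ t < m ∧ N t
    · obtain ⟨t, ht2, htm, ht⟩ := ht
      refine cycle_s hG (A := Iv (m + 2) 2 t) (b := ⟨1, by omega⟩)
        (c := ⟨a, by omega⟩) (d := ⟨m + 1, by omega⟩)
        (connSet_Iv _ _ (by omega) (by omega) ?_) ?_ ?_ ?_ ?_ ?_ ?_ ?_ ?_ ?_ ?_ ?_ ?_ <;>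
        simp only [hadj, mem_Iv, Fin.ext_iff, ne_eq]
      any_goals first
        | omega
        | (rw [triExt_in] <;> (try unfold TriAdj) <;> omega)
        | (rw [triExt_right] <;> first | assumption | omega)
      · intro x y h1 h2 h3
        rw [triExt_in] <;> (try unfold TriAdj) <;> omega
      · refine ⟨⟨2, by omega⟩, by dsimp only; omega, ?_⟩
        dsimp only
        rw [triExt_in] <;> (try unfold TriAdj) <;> omega
      · rintro ⟨x, hx, h⟩
        rw [triExt_in] at h <;> (try unfold TriAdj at h) <;> omega
      · refine ⟨⟨t, by omega⟩, by dsimp only; omega, ?_⟩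
        dsimp only
        rw [triExt_right] <;> first | assumption | omega
    · push Not at ht
      have hx : G.Adj ⟨a, by omega⟩ ⟨1, by omega⟩ := by
        rw [hadj]; dsimp only; rw [triExt_in] <;> (try unfold TriAdj) <;> omega
      refine claw_s hG (connSet_pair hx) (b := ⟨m + 1, by omega⟩) (c := ⟨2, by omega⟩)
        (d := ⟨c, by omega⟩) ?_ ?_ ?_ ?_ ?_ ?_ ?_ ?_ ?_ ?_ ?_ ?_ <;>
        simp only [hadj, Fin.ext_iff, ne_eq, Finset.mem_insert, Finset.mem_singleton]
      any_goals first
        | omega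
        | (rw [triExt_in] <;> (try unfold TriAdj) <;> omega)
        | (rw [triExt_left] <;> first | assumption | omega)
      · refine ⟨⟨a, by omega⟩, by simp, ?_⟩
        dsimp only
        rw [triExt_right] <;> first | assumption | omega
      · refine ⟨⟨1, by omega⟩, by simp, ?_⟩
        dsimp only
        rw [triExt_in] <;> (try unfold TriAdj) <;> omega
      · refine ⟨⟨1, by omega⟩, by simp, ?_⟩
        dsimp only
        rw [triExt_in] <;> (try unfold TriAdj) <;> omega
      · rw [triExt_left (by omega)]
        exact ht 2 le_rfl (by omega)
  by_cases h0 : N 0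
  · have hm2 : m = 2 := by
      by_contra h
      exact key 0 m (Or.inl ⟨rfl, rfl⟩) h0 (by omega)
    subst hm2
    have hadj' : ∀ x y : Fin (2 + 2), G.Adj x y ↔ TriExt 2 (fun j => j = 0) x.val y.val := by
      intro x y
      refine (hadj x y).trans (triExt_congr ?_ _ _)
      intro j hj
      interval_cases j <;> simp <;> tauto
    refine good_tri (by omega) (fun x => if x = 0 then 1 else if x = 1 then 0 else 5 - x) ?_ ?_ ?_
    · intro x hx; split_ifs <;> omega
    · intro x hx y hy h; split_ifs at h <;> omega
    · intro x y
      rw [hadj']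
      clear hadj hadj'
      unfold TriExt TriAdj
      revert x y
      decide
  by_cases hNm : N m
  · have hm2 : m = 2 := by
      by_contra h
      exact key m 0 (Or.inr ⟨rfl, rfl⟩) hNm (by omega)
    subst hm2
    have hadj' : ∀ x y : Fin (2 + 2), G.Adj x y ↔ TriExt 2 (fun j => j = 2) x.val y.val := by
      intro x y
      refine (hadj x y).trans (triExt_congr ?_ _ _)
      intro j hj
      interval_cases j <;> simp <;> tauto
    refine good_tri (by omega) (fun x => if x = 0 then 0 else if x = 1 then 3 else x - 1) ?_ ?_ ?_
    · intro x hx; split_ifs <;> omega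
    · intro x hx y hy h; split_ifs at h <;> omega
    · intro x y
      rw [hadj']
      clear hadj hadj'
      unfold TriExt TriAdj
      revert x y
      decide
  have hNt : ∃ t, t < m ∧ N t := by
    obtain ⟨i, hi, h⟩ := hN
    have : i ≠ m := by rintro rfl; exact hNm h
    exact ⟨i, by omega, h⟩
  obtain ⟨ht, hNt'⟩ := Nat.find_spec hNt
  have hmin : ∀ j < m, N j → Nat.find hNt ≤ j := fun j hj h => Nat.find_min' hNt ⟨hj, h⟩
  generalize Nat.find hNt = t at ht hNt' hmin
  have ht0 : 1 ≤ t := by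
    rcases Nat.eq_zero_or_pos t with rfl | h
    · exact (h0 hNt').elim
    · exact h
  by_cases hlast : t + 1 = m
  · have hadj' : ∀ x y : Fin (m + 2), G.Adj x y ↔ TriExt m (fun j => j = t) x.val y.val := by
      intro x y
      refine (hadj x y).trans (triExt_congr ?_ _ _)
      intro j hj
      constructor
      · intro h
        have : j ≠ m := by rintro rfl; exact hNm h
        have := hmin j (by omega) h
        omega
      · rintro rfl; exact hNt'
    refine good_tri (by omega) (fun x => if x < m then x else if x = m then m + 1 else m) ?_ ?_ ?_
    · intro x hx; split_ifs <;> omega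
    · intro x hx y hy h; split_ifs at h <;> omega
    · intro x y
      have := x.2
      have := y.2
      rw [hadj']
      clear hadj hadj'
      unfold TriExt TriAdj
      split_ifs <;> omega
  exfalso
  have hlow : ∀ j, j < t → ¬ N j := by
    intro j hj h
    have := hmin j (by omega) h
    omega
  by_cases ht1 : N (t + 1)
  · refine butterfly_s hG (A := Iv (m + 2) 1 t) (b := ⟨0, by omega⟩) (c := ⟨m, by omega⟩)
      (d := ⟨t + 1, by omega⟩) (e := ⟨m + 1, by omega⟩)
      (connSet_Iv _ _ (by omega) (by omega) ?_)
      ?_ ?_ ?_ ?_ ?_ ?_ ?_ ?_ ?_ ?_ ?_ ?_ ?_ ?_ ?_ ?_ ?_ ?_ <;>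
      simp only [hadj, mem_Iv, Fin.ext_iff, ne_eq]
    any_goals first
      | omega
      | (rw [triExt_in] <;> (try unfold TriAdj) <;> omega)
      | (rw [triExt_right] <;> first | assumption | omega)
    · intro x y h1 h2 h3
      rw [triExt_in] <;> (try unfold TriAdj) <;> omega
    · refine ⟨⟨1, by omega⟩, by dsimp only; omega, ?_⟩
      dsimp only
      rw [triExt_in] <;> (try unfold TriAdj) <;> omega
    · refine ⟨⟨1, by omega⟩, by dsimp only; omega, ?_⟩
      dsimp only
      rw [triExt_in] <;> (try unfold TriAdj) <;> omega
    · refine ⟨⟨t, by omega⟩, by dsimp only; omega, ?_⟩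
      dsimp only
      rw [triExt_in] <;> (try unfold TriAdj) <;> omega
    · refine ⟨⟨t, by omega⟩, by dsimp only; omega, ?_⟩
      dsimp only
      rw [triExt_right] <;> first | assumption | omega
  · refine claw_s hG (connSet_singleton G ⟨t, by omega⟩) (b := ⟨t - 1, by omega⟩)
      (c := ⟨t + 1, by omega⟩) (d := ⟨m + 1, by omega⟩) ?_ ?_ ?_ ?_ ?_ ?_ ?_ ?_ ?_ ?_ ?_ ?_ <;>
      simp only [hadj, Fin.ext_iff, ne_eq, Finset.mem_singleton]
    any_goals first
      | omega
      | (rw [triExt_in] <;> (try unfold TriAdj) <;> omega)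
      | (rw [triExt_right] <;> first | assumption | omega)
    · refine ⟨⟨t, by omega⟩, rfl, ?_⟩
      dsimp only
      rw [triExt_in] <;> (try unfold TriAdj) <;> omega
    · refine ⟨⟨t, by omega⟩, rfl, ?_⟩
      dsimp only
      rw [triExt_in] <;> (try unfold TriAdj) <;> omega
    · refine ⟨⟨t, by omega⟩, rfl, ?_⟩
      dsimp only
      rw [triExt_right] <;> first | assumption | omega
    · rw [triExt_right (by omega)]
      exact hlow _ (by omega)

lemma Good.iso {n k : ℕ} {G : SimpleGraph (Fin n)} {H : SimpleGraph (Fin k)} (e : G ≃g H)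
    (h : Good H) : Good G := by
  rcases h with ⟨m, ⟨f⟩⟩ | ⟨m, hm, ⟨f⟩⟩
  · exact Or.inl ⟨m, ⟨e.trans f⟩⟩
  · exact Or.inr ⟨m, hm, ⟨e.trans f⟩⟩

lemma col_of_embedding {n k : ℕ} {G : SimpleGraph (Fin n)} {H : SimpleGraph (Fin k)}
    (f : Fin k → Fin n) (hf : Function.Injective f) (ha : ∀ i j, H.Adj i j ↔ G.Adj (f i) (f j))
    (hG : Col G) : Col H := by
  refine minor_col G H (fun i => {f i}) (fun j => connSet_singleton G _) ?_ ?_ hG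
  · intro i j hij
    rw [Finset.disjoint_singleton]
    exact fun h => hij.ne (hf h)
  · intro i j _
    rw [touch_singleton, ha]

lemma extend_graph {n : ℕ} {G : SimpleGraph (Fin (n + 1))} (v : Fin (n + 1))
    {K : SimpleGraph (Fin n)} (f : G.comap v.succAbove ≃g K) (hcol : Col G)
    (hw : ∃ w, G.Adj w v) :
    ∃ (H : SimpleGraph (Fin (n + 1))) (N : ℕ → Prop), Nonempty (G ≃g H) ∧ Col H ∧
      (∀ (x y : Fin (n + 1)) (hx : x.val < n) (hy : y.val < n),
        H.Adj x y ↔ K.Adj ⟨x.val, hx⟩ ⟨y.val, hy⟩) ∧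
      (∀ x : Fin (n + 1), H.Adj x (Fin.last n) ↔ x.val < n ∧ N x.val) ∧
      ∃ i, i < n ∧ N i := by
  let p : Fin (n + 1) → Fin (n + 1) := fun x =>
    if h : x.val < n then v.succAbove (f.symm ⟨x.val, h⟩) else v
  have hp1 : ∀ (x : Fin (n + 1)) (h : x.val < n), p x = v.succAbove (f.symm ⟨x.val, h⟩) := by
    intro x h
    simp only [p, dif_pos h]
  have hp2 : ∀ x : Fin (n + 1), ¬ x.val < n → p x = v := by
    intro x h
    simp only [p, dif_neg h]
  have hinj : Function.Injective p := by
    intro x y hxy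
    by_cases hx : x.val < n <;> by_cases hy : y.val < n
    · rw [hp1 x hx, hp1 y hy] at hxy
      have := f.symm.injective (Fin.succAbove_right_injective hxy)
      exact Fin.ext (Fin.mk.inj_iff.1 this)
    · rw [hp1 x hx, hp2 y hy] at hxy
      exact absurd hxy (Fin.succAbove_ne _ _)
    · rw [hp2 x hx, hp1 y hy] at hxy
      exact absurd hxy.symm (Fin.succAbove_ne _ _)
    · have := x.2
      have := y.2
      exact Fin.ext (by omega)
  have hbij : Function.Bijective p := Finite.injective_iff_bijective.1 hinj
  let e : G.comap p ≃g G := ⟨Equiv.ofBijective p hbij, by intro a b; exact Iff.rfl⟩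
  refine ⟨G.comap p, fun i => ∃ h : i < n + 1, G.Adj (p ⟨i, h⟩) v, ⟨e.symm⟩,
    col_of_embedding p hinj (fun i j => Iff.rfl) hcol, ?_, ?_, ?_⟩
  · intro x y hx hy
    rw [SimpleGraph.comap_adj, hp1 x hx, hp1 y hy, ← f.symm.map_adj_iff, SimpleGraph.comap_adj]
  · intro x
    rw [SimpleGraph.comap_adj, hp2 (Fin.last n) (by simp)]
    constructor
    · intro h
      refine ⟨?_, x.2, h⟩
      by_contra hx
      rw [hp2 x hx] at h
      exact G.loopless.irrefl _ h
    · rintro ⟨_, _, h⟩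
      exact h
  · obtain ⟨w, hw⟩ := hw
    obtain ⟨x, rfl⟩ := hbij.2 w
    refine ⟨x.val, ?_, x.2, hw⟩
    by_contra hx
    rw [hp2 x hx] at hw
    exact G.loopless.irrefl _ hw

theorem good_of_col : ∀ (n : ℕ) (G : SimpleGraph (Fin n)), G.Connected → Col G → Good G := by
  intro n
  induction n with
  | zero =>
    intro G hG _
    exact (hG.nonempty.some).elim0
  | succ n ih =>
    intro G hG hcol
    rcases Nat.eq_zero_or_pos n with rfl | hn
    · refine good_path id (fun x h => h) (fun x _ y _ h => h) ?_
      intro x y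
      have : x = y := Fin.ext (by omega)
      subst this
      simp
    have : Nontrivial (Fin (n + 1)) := Fin.nontrivial_iff_two_le.2 (by omega)
    obtain ⟨v, hv⟩ := hG.exists_connected_induce_compl_singleton_of_finite_nontrivial
    -- the graph with `v` removed
    have hconn : (G.comap v.succAbove).Connected := by
      let e : (G.comap v.succAbove) ≃g (G.induce ({v}ᶜ : Set (Fin (n + 1)))) :=
        { toEquiv := finSuccAboveEquiv v
          map_rel_iff' := by
            intro a b
            exact Iff.rfl }
      exact e.connected_iff.2 hv
    have hcol' : Col (G.comap v.succAbove) :=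
      col_of_embedding v.succAbove (Fin.succAbove_right_injective) (fun i j => Iff.rfl) hcol
    -- neighbours of `v`
    obtain ⟨w, hw⟩ : ∃ w, G.Adj w v := by
      obtain ⟨w, hw⟩ := hG.preconnected.exists_adj_of_nontrivial v
      exact ⟨w, hw.symm⟩
    rcases ih _ hconn hcol' with ⟨m, ⟨f⟩⟩ | ⟨m, hm, ⟨f⟩⟩
    · have hcard : n = m := by simpa using Fintype.card_congr f.toEquiv
      subst hcard
      obtain ⟨H, N, ⟨e⟩, hH, h1, h2, h3⟩ := extend_graph v f hcol ⟨w, hw⟩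
      refine Good.iso e (path_case hH N ?_ h3)
      intro x y
      have hxn := x.2
      have hyn := y.2
      by_cases hx : x.val < n <;> by_cases hy : y.val < n
      · rw [h1 x y hx hy, pathExt_path hx hy, SimpleGraph.pathGraph_adj]
      · have hyl : y = Fin.last n := Fin.ext (by simp only [Fin.val_last]; omega)
        subst hyl
        rw [h2, PathExt, Fin.val_last]
        grind
      · have hxl : x = Fin.last n := Fin.ext (by simp only [Fin.val_last]; omega)
        subst hxl
        rw [SimpleGraph.adj_comm, h2, PathExt, Fin.val_last]
        grind
      · have hyl : y = Fin.last n := Fin.ext (by simp only [Fin.val_last]; omega)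
        subst hyl
        rw [h2, PathExt, Fin.val_last]
        grind
    · have hcard : n = m + 1 := by simpa using Fintype.card_congr f.toEquiv
      subst hcard
      obtain ⟨H, N, ⟨e⟩, hH, h1, h2, h3⟩ := extend_graph v f hcol ⟨w, hw⟩
      refine Good.iso e (tri_case hm hH N ?_ (by
        obtain ⟨i, hi, h⟩ := h3
        exact ⟨i, by omega, h⟩))
      intro x y
      have hxn := x.2
      have hyn := y.2
      by_cases hx : x.val < m + 1 <;> by_cases hy : y.val < m + 1
      · rw [h1 x y hx hy, triExt_in (by omega) (by omega), pathTriangle_adj hm]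
      · have hyl : y = Fin.last (m + 1) := Fin.ext (by simp only [Fin.val_last]; omega)
        subst hyl
        rw [h2, Fin.val_last, triExt_right (by omega)]
        grind
      · have hxl : x = Fin.last (m + 1) := Fin.ext (by simp only [Fin.val_last]; omega)
        subst hxl
        rw [SimpleGraph.adj_comm, h2, Fin.val_last, triExt_left (by omega)]
        grind
      · have hyl : y = Fin.last (m + 1) := Fin.ext (by simp only [Fin.val_last]; omega)
        subst hyl
        rw [h2, TriExt, TriAdj, Fin.val_last]
        grind

/-! ### A criterion for being factored -/

lemma linearIndependent_of_common_zero {n : ℕ} (g : Fin n → ((Fin n → ℚ) →ₗ[ℚ] ℚ))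
    (h : ∀ x, (∀ i, g i x = 0) → x = 0) : LinearIndependent ℚ g := by
  -- the map `x ↦ (g i x)_i` is injective, hence surjective
  have hinj : Function.Injective (LinearMap.pi g) := by
    rw [← LinearMap.ker_eq_bot, LinearMap.ker_eq_bot']
    intro x hx
    exact h x fun i => congrFun hx i
  have hsurj : Function.Surjective (LinearMap.pi g) := LinearMap.surjective_of_injective hinj
  rw [Fintype.linearIndependent_iff]
  intro c hc i
  obtain ⟨x, hx⟩ := hsurj (Pi.single i 1)
  have h1 : (∑ j, c j • g j) x = 0 := by rw [hc]; rfl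
  have h2 : ∀ j, g j x = (Pi.single i 1 : Fin n → ℚ) j := fun j => congrFun hx j
  simpa [LinearMap.sum_apply, h2, Pi.single_apply] using h1

/-- Nice data: a block function on connected sets. -/
def Fac {n : ℕ} (G : SimpleGraph (Fin n)) (b : Finset (Fin n) → ℕ) : Prop :=
  (∀ I, ConnSet G I → b I < n) ∧
  (∀ i < n, ∃ I, ConnSet G I ∧ b I = i) ∧
  (∀ x : Fin n → ℚ, (∀ i < n, ∃ I, ConnSet G I ∧ b I = i ∧ ∑ j ∈ I, x j = 0) → x = 0) ∧
  (∀ (M : Type) [AddCommGroup M] (c : Fin n → M), (∃ I, ConnSet G I ∧ ∑ j ∈ I, c j = 0) →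
    ∃ I, ConnSet G I ∧ ∑ j ∈ I, c j = 0 ∧
      ∀ J, ConnSet G J → ∑ j ∈ J, c j = 0 → b J = b I → J = I)

lemma le_ker_iff {n : ℕ} (X : Submodule ℚ (Fin n → ℚ)) (I : Finset (Fin n)) :
    X ≤ LinearMap.ker (linForm I) ↔ ∑ j ∈ I, (fun x : X => x.1 j) = 0 := by
  constructor
  · intro h
    funext x
    have := h x.2
    rw [LinearMap.mem_ker, linForm_apply] at this
    simpa using this
  · intro h x hx
    rw [LinearMap.mem_ker, linForm_apply]
    have := congrFun h ⟨x, hx⟩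
    simpa using this

lemma factored_of_fac {n : ℕ} (G : SimpleGraph (Fin n)) (b : Finset (Fin n) → ℕ) (h : Fac G b) :
    IsFactored (csaForms G) := by
  classical
  obtain ⟨h0, h1, h2, h3⟩ := h
  let π : Fin n → Finset ((Fin n → ℚ) →ₗ[ℚ] ℚ) := fun i =>
    (Finset.univ.filter fun I : Finset (Fin n) => ConnSet G I ∧ b I = i.val).image linForm
  have hπ : ∀ i f, f ∈ π i ↔ ∃ I, (ConnSet G I ∧ b I = i.val) ∧ linForm I = f := by
    intro i f
    simp [π]
  refine ⟨n, π, ?_, ?_, ?_, ?_, ?_⟩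
  · intro i
    obtain ⟨I, hI, hb⟩ := h1 i.val i.2
    exact ⟨linForm I, (hπ _ _).2 ⟨I, ⟨hI, hb⟩, rfl⟩⟩
  · intro i f hf
    obtain ⟨I, ⟨hI, -⟩, rfl⟩ := (hπ _ _).1 hf
    exact (mem_csaForms G _).2 ⟨I, hI, rfl⟩
  · intro f hf
    obtain ⟨I, hI, rfl⟩ := (mem_csaForms G _).1 hf
    refine ⟨⟨b I, h0 I hI⟩, (hπ _ _).2 ⟨I, ⟨hI, rfl⟩, rfl⟩, ?_⟩
    intro j hj
    obtain ⟨J, ⟨hJ, hbJ⟩, hIJ⟩ := (hπ _ _).1 hj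
    have : J = I := linForm_inj hIJ
    subst this
    exact Fin.ext hbJ.symm
  · intro g hg
    refine linearIndependent_of_common_zero g fun x hx => h2 x fun i hi => ?_
    obtain ⟨I, ⟨hI, hb⟩, hIg⟩ := (hπ _ _).1 (hg ⟨i, hi⟩)
    refine ⟨I, hI, hb, ?_⟩
    rw [← linForm_apply, hIg]
    exact hx _
  · intro X hX hne
    obtain ⟨B, hB, hXB⟩ := hX
    obtain ⟨f, hf⟩ : B.Nonempty := by
      rw [Finset.nonempty_iff_ne_empty]
      rintro rfl
      exact hne (by simpa using hXB)
    obtain ⟨I, hI, rfl⟩ := (mem_csaForms G _).1 (hB hf)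
    have hXf : X ≤ LinearMap.ker (linForm I) := by
      rw [hXB]
      exact iInf₂_le _ hf
    obtain ⟨K, hK, hK0, huniq⟩ := h3 (X → ℚ) (fun j x => x.1 j) ⟨I, hI, (le_ker_iff X I).1 hXf⟩
    refine ⟨⟨b K, h0 K hK⟩, linForm K, (hπ _ _).2 ⟨K, ⟨hK, rfl⟩, rfl⟩, (le_ker_iff X K).2 hK0, ?_⟩
    intro g hg hXg
    obtain ⟨J, ⟨hJ, hbJ⟩, rfl⟩ := (hπ _ _).1 hg
    rw [huniq J hJ ((le_ker_iff X J).1 hXg) hbJ]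

lemma Fac.iso {n : ℕ} {G H : SimpleGraph (Fin n)} (e : G ≃g H) (b : Finset (Fin n) → ℕ)
    (h : Fac H b) : Fac G fun I => b (I.map e.toEquiv.toEmbedding) := by
  have hconn : ∀ I, ConnSet G I ↔ ConnSet H (I.map e.toEquiv.toEmbedding) := by
    intro I
    have := conn_biUnion H G (fun i => {e i}) (fun j => connSet_singleton H _) (by
      intro i j hij
      rw [Finset.disjoint_singleton]
      exact fun h => hij (e.injective h)) (by
      intro i j _
      rw [touch_singleton, e.map_adj_iff]) I
    rw [← this]
    have : I.biUnion (fun i => {e i}) = I.map e.toEquiv.toEmbedding := by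
      ext x
      simp only [Finset.mem_biUnion, Finset.mem_singleton, Finset.mem_map]
      constructor
      · rintro ⟨a, ha, rfl⟩
        exact ⟨a, ha, rfl⟩
      · rintro ⟨a, ha, rfl⟩
        exact ⟨a, ha, rfl⟩
    rw [this]
  have hex : ∀ J : Finset (Fin n), ∃ I : Finset (Fin n), I.map e.toEquiv.toEmbedding = J := by
    intro J
    refine ⟨J.map e.symm.toEquiv.toEmbedding, ?_⟩
    ext x
    simp only [Finset.mem_map]
    constructor
    · rintro ⟨a, ⟨b, hb, rfl⟩, rfl⟩
      show e (e.symm b) ∈ J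
      rwa [e.apply_symm_apply]
    · intro hx
      exact ⟨e.symm x, ⟨x, hx, rfl⟩, e.apply_symm_apply x⟩
  have hsum : ∀ {M : Type} [AddCommGroup M] (c : Fin n → M) (I : Finset (Fin n)),
      ∑ j ∈ I, c j = ∑ j ∈ I.map e.toEquiv.toEmbedding, c (e.symm j) := by
    intro M _ c I
    simp
  obtain ⟨h0, h1, h2, h3⟩ := h
  refine ⟨fun I hI => h0 _ ((hconn I).1 hI), ?_, ?_, ?_⟩
  · intro i hi
    obtain ⟨J, hJ, hb⟩ := h1 i hi
    obtain ⟨I, rfl⟩ := hex J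
    exact ⟨I, (hconn I).2 hJ, hb⟩
  · intro x hx
    have := h2 (fun j => x (e.symm j)) (by
      intro i hi
      obtain ⟨I, hI, hb, hs⟩ := hx i hi
      exact ⟨_, (hconn I).1 hI, hb, by rw [← hsum]; exact hs⟩)
    funext j
    simpa using congrFun this (e j)
  · rintro M _ c ⟨I, hI, hs⟩
    obtain ⟨K, hK, hK0, hu⟩ := h3 M (fun j => c (e.symm j))
      ⟨_, (hconn I).1 hI, by rw [← hsum]; exact hs⟩
    obtain ⟨K, rfl⟩ := hex K
    refine ⟨K, (hconn K).2 hK, by rw [hsum]; exact hK0, ?_⟩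
    intro J hJ hJ0 hb
    exact Finset.map_injective _ (hu _ ((hconn J).1 hJ) (by rw [← hsum]; exact hJ0) hb)

/-- Prefix sums. -/
def pre {n : ℕ} {M : Type} [AddCommGroup M] (c : Fin n → M) (k : ℕ) : M :=
  ∑ x ∈ Finset.univ.filter (fun x : Fin n => x.val < k), c x

lemma pre_zero {n : ℕ} {M : Type} [AddCommGroup M] (c : Fin n → M) : pre c 0 = 0 := by
  simp [pre]

lemma sum_Iv {n : ℕ} {M : Type} [AddCommGroup M] (c : Fin n → M) (i j : ℕ) (h : i ≤ j + 1) :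
    ∑ x ∈ Iv n i j, c x = pre c (j + 1) - pre c i := by
  rw [eq_sub_iff_add_eq, pre, pre, ← Finset.sum_union]
  · congr 1
    ext x
    simp only [Finset.mem_union, mem_Iv, Finset.mem_filter, Finset.mem_univ, true_and]
    omega
  · rw [Finset.disjoint_left]
    simp only [mem_Iv, Finset.mem_filter, Finset.mem_univ, true_and]
    intro x
    omega

lemma pre_succ {n : ℕ} {M : Type} [AddCommGroup M] (c : Fin n → M) (i : ℕ) (h : i < n) :
    c ⟨i, h⟩ = pre c (i + 1) - pre c i := by
  rw [← sum_Iv c i i (by omega)]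
  have : Iv n i i = {⟨i, h⟩} := by
    ext x
    simp only [mem_Iv, Finset.mem_singleton, Fin.ext_iff]
    omega
  rw [this, Finset.sum_singleton]

/-! ### Paths are factored -/

lemma path_shape {n : ℕ} {I : Finset (Fin n)} (hI : ConnSet (SimpleGraph.pathGraph n) I) :
    ∃ i j, i ≤ j ∧ j < n ∧ I = Iv n i j := by
  rw [connSet_iff] at hI
  obtain ⟨hne, hcut⟩ := hI
  refine ⟨(I.min' hne).val, (I.max' hne).val, I.min'_le _ (I.max'_mem hne), (I.max' hne).2, ?_⟩
  ext x
  rw [mem_Iv]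
  constructor
  · exact fun hx => ⟨I.min'_le x hx, I.le_max' x hx⟩
  · rintro ⟨h1, h2⟩
    by_contra hx
    have h3 : (I.min' hne).val ≠ x.val := fun h => hx (Fin.ext h ▸ I.min'_mem hne)
    have h4 : (I.max' hne).val ≠ x.val := fun h => hx (Fin.ext h ▸ I.max'_mem hne)
    obtain ⟨a, ha, b, hb, hbS, hab⟩ := hcut (I.filter fun y => y.val < x.val)
      (Finset.filter_subset _ _)
      ⟨I.min' hne, Finset.mem_filter.2 ⟨I.min'_mem hne, by omega⟩⟩ (by
        intro h
        have : I.max' hne ∈ I.filter fun y => y.val < x.val := by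
          rw [h]; exact I.max'_mem hne
        have := (Finset.mem_filter.1 this).2
        omega)
    rw [Finset.mem_filter] at ha hbS
    rw [SimpleGraph.pathGraph_adj] at hab
    have h5 : ¬ b.val < x.val := fun h => hbS ⟨hb, h⟩
    have h6 : b.val ≠ x.val := fun h => hx (Fin.ext h ▸ hb)
    have := ha.2
    omega

lemma sup_Iv {n i j : ℕ} (hij : i ≤ j) (hj : j < n) :
    (Iv n i j).sup (fun x => x.val) = j := by
  apply le_antisymm
  · exact Finset.sup_le fun x hx => (mem_Iv.1 hx).2
  · exact Finset.le_sup (f := fun x : Fin n => x.val) (b := ⟨j, hj⟩) (mem_Iv.2 ⟨hij, le_rfl⟩)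

lemma path_conn_Iv {n i j : ℕ} (hij : i ≤ j) (hj : j < n) :
    ConnSet (SimpleGraph.pathGraph n) (Iv n i j) := by
  refine connSet_Iv i j hij hj fun x y _ _ h => ?_
  rw [SimpleGraph.pathGraph_adj]
  exact Or.inl h

lemma path_fac (n : ℕ) : Fac (SimpleGraph.pathGraph n) fun I => I.sup (fun x => x.val) := by
  classical
  refine ⟨?_, ?_, ?_, ?_⟩
  · intro I hI
    obtain ⟨i, j, hij, hj, rfl⟩ := path_shape hI
    show (Iv n i j).sup _ < n
    rwa [sup_Iv hij hj]
  · intro i hi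
    exact ⟨_, path_conn_Iv le_rfl hi, sup_Iv le_rfl hi⟩
  · intro x hx
    have key : ∀ k, k ≤ n → pre x k = 0 := by
      intro k
      induction k using Nat.strong_induction_on with
      | _ k ih =>
        intro hk
        rcases Nat.eq_zero_or_pos k with rfl | hk0
        · exact pre_zero x
        obtain ⟨I, hI, hb, hs⟩ := hx (k - 1) (by omega)
        obtain ⟨i, j, hij, hj, rfl⟩ := path_shape hI
        dsimp only at hb
        rw [sup_Iv hij hj] at hb
        subst hb
        rw [sum_Iv x _ _ (by omega), ih i (by omega) (by omega), sub_zero] at hs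
        rwa [show k - 1 + 1 = k by omega] at hs
    funext j
    rw [show j = ⟨j.val, j.2⟩ from rfl, pre_succ x j.val j.2, key _ (by omega), key _ (by omega)]
    simp
  · rintro M _ c ⟨I, hI, hs⟩
    have hex : ∃ j, ∃ i, i ≤ j ∧ j < n ∧ pre c (j + 1) = pre c i := by
      obtain ⟨i, j, hij, hj, rfl⟩ := path_shape hI
      rw [sum_Iv c _ _ (by omega), sub_eq_zero] at hs
      exact ⟨j, i, hij, hj, hs⟩
    obtain ⟨i, hij, hj, he⟩ := Nat.find_spec hex
    have hmin : ∀ k < Nat.find hex, _ := fun k hk => Nat.find_min hex hk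
    generalize Nat.find hex = j at hij hj he hmin
    refine ⟨Iv n i j, path_conn_Iv hij hj, ?_, ?_⟩
    · rw [sum_Iv c _ _ (by omega), he, sub_self]
    · intro J hJ hJ0 hb
      obtain ⟨i', j', hij', hj', rfl⟩ := path_shape hJ
      dsimp only at hb
      rw [sup_Iv hij hj, sup_Iv hij' hj'] at hb
      subst hb
      rw [sum_Iv c _ _ (by omega), sub_eq_zero] at hJ0
      rcases lt_trichotomy i i' with h | h | h
      · refine (hmin (i' - 1) (by omega) ⟨i, by omega, by omega, ?_⟩).elim
        rw [show i' - 1 + 1 = i' by omega, ← hJ0, he]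
      · rw [h]
      · refine (hmin (i - 1) (by omega) ⟨i', by omega, by omega, ?_⟩).elim
        rw [show i - 1 + 1 = i by omega, ← hJ0, he]

/-! ### Paths with a triangle are factored -/

lemma tri_cases {m : ℕ} (hm : 2 ≤ m) {I : Finset (Fin (m + 1))}
    (hI : ConnSet (pathTriangle m 1) I) :
    (∃ i j, 1 ≤ i ∧ i ≤ j ∧ j < m ∧ I = Iv (m + 1) i j) ∨
    (∃ k < m, I = Iv (m + 1) 0 k) ∨
    (∃ k < m, I = insert (Fin.last m) (Iv (m + 1) 1 k)) ∨
    (∃ k < m, I = insert (Fin.last m) (Iv (m + 1) 0 k)) := by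
  classical
  rw [connSet_iff] at hI
  obtain ⟨hne, hcut⟩ := hI
  have hadj := pathTriangle_adj (m := m) hm
  by_cases hL : Fin.last m ∈ I
  · right; right
    -- the part of `I` away from the last vertex
    have hfill : ∀ x y : Fin (m + 1), 1 ≤ x.val → x.val ≤ y.val → y.val < m → y ∈ I → x ∈ I := by
      intro x y hx hxy hy hyI
      by_contra hxI
      have hne : x.val ≠ y.val := fun h => hxI (Fin.ext h ▸ hyI)
      obtain ⟨a, ha, b, hb, hbS, hab⟩ := hcut (I.filter fun z => x.val < z.val ∧ z.val < m)
        (Finset.filter_subset _ _) ⟨y, Finset.mem_filter.2 ⟨hyI, by omega, hy⟩⟩ (by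
          intro h
          have : Fin.last m ∈ I.filter fun z => x.val < z.val ∧ z.val < m := by rw [h]; exact hL
          have := (Finset.mem_filter.1 this).2.2
          simp at this)
      rw [Finset.mem_filter] at ha hbS
      rw [hadj, TriAdj] at hab
      have h5 : ¬ (x.val < b.val ∧ b.val < m) := fun h => hbS ⟨hb, h⟩
      have h6 : b.val ≠ x.val := fun h => hxI (Fin.ext h ▸ hb)
      have := ha.2
      omega
    obtain ⟨k, hk, hkI, hkmax⟩ : ∃ k < m, (∀ x : Fin (m + 1), 1 ≤ x.val → x.val ≤ k → x ∈ I) ∧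
        ∀ x ∈ I, x.val < m → x.val ≤ k := by
      by_cases hT : (I.filter fun z => z.val < m).Nonempty
      · obtain ⟨y, hmem, hle⟩ : ∃ y ∈ I.filter fun z => z.val < m,
            ∀ x ∈ I.filter fun z => z.val < m, x ≤ y :=
          ⟨_, (I.filter fun z => z.val < m).max'_mem hT,
            fun x hx => (I.filter fun z => z.val < m).le_max' x hx⟩
        rw [Finset.mem_filter] at hmem
        exact ⟨y.val, hmem.2, fun x h1 h2 => hfill x y h1 h2 hmem.2 hmem.1,
          fun x hx hxm => hle x (Finset.mem_filter.2 ⟨hx, hxm⟩)⟩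
      · refine ⟨0, by omega, fun x h1 h2 => by omega, fun x hx hxm => ?_⟩
        exact (hT ⟨x, Finset.mem_filter.2 ⟨hx, hxm⟩⟩).elim
    by_cases h0 : (0 : Fin (m + 1)) ∈ I
    · refine Or.inr ⟨k, hk, ?_⟩
      ext x
      rw [Finset.mem_insert, mem_Iv, Fin.ext_iff, Fin.val_last]
      constructor
      · intro hx
        have := hkmax x hx
        omega
      · rintro (h | ⟨-, h⟩)
        · exact (Fin.ext h : x = Fin.last m) ▸ hL
        · by_cases h1 : x.val = 0
          · exact (Fin.ext h1 : x = 0) ▸ h0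
          · exact hkI x (by omega) h
    · refine Or.inl ⟨k, hk, ?_⟩
      ext x
      rw [Finset.mem_insert, mem_Iv, Fin.ext_iff, Fin.val_last]
      constructor
      · intro hx
        have := hkmax x hx
        have : x.val ≠ 0 := fun h => h0 ((Fin.ext h : x = 0) ▸ hx)
        omega
      · rintro (h | ⟨h1, h⟩)
        · exact (Fin.ext h : x = Fin.last m) ▸ hL
        · exact hkI x h1 h
  · have hlt : ∀ x ∈ I, x.val < m := by
      intro x hx
      have : x.val ≠ m := fun h => hL ((Fin.ext h : x = Fin.last m) ▸ hx)
      omega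
    obtain ⟨i, j, hij, hj, hI⟩ : ∃ i j, i ≤ j ∧ j < m ∧ I = Iv (m + 1) i j := by
      refine ⟨(I.min' hne).val, (I.max' hne).val, I.min'_le _ (I.max'_mem hne),
        hlt _ (I.max'_mem hne), ?_⟩
      ext x
      rw [mem_Iv]
      constructor
      · exact fun hx => ⟨I.min'_le x hx, I.le_max' x hx⟩
      · rintro ⟨h1, h2⟩
        by_contra hx
        have h3 : (I.min' hne).val ≠ x.val := fun h => hx (Fin.ext h ▸ I.min'_mem hne)
        have h4 : (I.max' hne).val ≠ x.val := fun h => hx (Fin.ext h ▸ I.max'_mem hne)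
        obtain ⟨a, ha, b, hb, hbS, hab⟩ := hcut (I.filter fun y => y.val < x.val)
          (Finset.filter_subset _ _)
          ⟨I.min' hne, Finset.mem_filter.2 ⟨I.min'_mem hne, by omega⟩⟩ (by
            intro h
            have : I.max' hne ∈ I.filter fun y => y.val < x.val := by
              rw [h]; exact I.max'_mem hne
            have := (Finset.mem_filter.1 this).2
            omega)
        rw [Finset.mem_filter] at ha hbS
        rw [hadj, TriAdj] at hab
        have h5 : ¬ b.val < x.val := fun h => hbS ⟨hb, h⟩
        have h6 : b.val ≠ x.val := fun h => hx (Fin.ext h ▸ hb)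
        have := ha.2
        have := hlt _ ha.1
        have := hlt _ hb
        omega
    rcases Nat.eq_zero_or_pos i with rfl | hi
    · exact Or.inr (Or.inl ⟨j, hj, hI⟩)
    · exact Or.inl ⟨i, j, hi, hij, hj, hI⟩

lemma tri_conn_Iv {m i j : ℕ} (hm : 2 ≤ m) (hij : i ≤ j) (hj : j < m) :
    ConnSet (pathTriangle m 1) (Iv (m + 1) i j) := by
  refine connSet_Iv i j hij (by omega) fun x y _ _ h => ?_
  rw [pathTriangle_adj hm, TriAdj]
  omega

lemma tri_conn_insert {m i j : ℕ} (hm : 2 ≤ m) (hi : i ≤ 1) (hj : j < m) :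
    ConnSet (pathTriangle m 1) (insert (Fin.last m) (Iv (m + 1) i j)) := by
  rcases Nat.lt_or_ge j i with h | h
  · have : Iv (m + 1) i j = ∅ := by
      ext x
      simp only [mem_Iv, Finset.notMem_empty, iff_false]
      omega
    rw [this]
    exact connSet_singleton _ _
  · rw [Finset.insert_eq]
    refine connSet_union (connSet_singleton _ _) (tri_conn_Iv hm h hj) ?_
    refine ⟨Fin.last m, by simp, ⟨i, by omega⟩, mem_Iv.2 ⟨le_rfl, h⟩, ?_⟩
    rw [pathTriangle_adj hm, TriAdj, Fin.val_last]
    right; right; right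
    exact ⟨hi, rfl⟩

lemma sum_insert_Iv {m i j : ℕ} {M : Type} [AddCommGroup M] (c : Fin (m + 1) → M)
    (h : i ≤ j + 1) (hj : j < m) :
    ∑ x ∈ insert (Fin.last m) (Iv (m + 1) i j), c x
      = c (Fin.last m) + (pre c (j + 1) - pre c i) := by
  rw [Finset.sum_insert, sum_Iv c i j h]
  rw [mem_Iv, Fin.val_last]
  omega

open Classical in
/-- The block function of the path with a triangle. -/
noncomputable def triB (m : ℕ) (I : Finset (Fin (m + 1))) : ℕ :=
  if ((0 : Fin (m + 1)) ∈ I ∧ Fin.last m ∉ I) ∨ I = {Fin.last m} then m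
  else I.sup fun x => if x.val < m then x.val else 0

lemma triB_T {m i j : ℕ} (hi : 1 ≤ i) (hij : i ≤ j) (hj : j < m) :
    triB m (Iv (m + 1) i j) = j := by
  rw [triB, if_neg]
  · apply le_antisymm
    · refine Finset.sup_le fun x hx => ?_
      have := mem_Iv.1 hx
      split_ifs <;> omega
    · have := Finset.le_sup (s := Iv (m + 1) i j)
        (f := fun x : Fin (m + 1) => if x.val < m then x.val else 0) (b := ⟨j, by omega⟩)
        (mem_Iv.2 ⟨hij, le_rfl⟩)
      simpa [hj] using this
  · rintro (⟨h, -⟩ | h)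
    · have := (mem_Iv.1 h).1
      simp at this
      omega
    · have : Fin.last m ∈ Iv (m + 1) i j := by rw [h]; simp
      have := (mem_Iv.1 this).2
      rw [Fin.val_last] at this
      omega

lemma triB_A {m k : ℕ} (hk : k < m) : triB m (Iv (m + 1) 0 k) = m := by
  rw [triB, if_pos]
  refine Or.inl ⟨mem_Iv.2 (by simp), fun h => ?_⟩
  have := (mem_Iv.1 h).2
  rw [Fin.val_last] at this
  omega

lemma triB_B0 {m : ℕ} : triB m (insert (Fin.last m) (Iv (m + 1) 1 0)) = m := by
  rw [triB, if_pos]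
  right
  ext x
  rw [Finset.mem_insert, mem_Iv, Finset.mem_singleton]
  constructor
  · rintro (h | h)
    · exact h
    · omega
  · exact Or.inl

lemma triB_insert {m i k : ℕ} (hik : i ≤ k) (hk : k < m) :
    triB m (insert (Fin.last m) (Iv (m + 1) i k)) = k := by
  rw [triB, if_neg]
  · apply le_antisymm
    · refine Finset.sup_le fun x hx => ?_
      rw [Finset.mem_insert, mem_Iv, Fin.ext_iff, Fin.val_last] at hx
      split_ifs <;> omega
    · have := Finset.le_sup (s := insert (Fin.last m) (Iv (m + 1) i k))
        (f := fun x : Fin (m + 1) => if x.val < m then x.val else 0) (b := ⟨k, by omega⟩)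
        (Finset.mem_insert_of_mem (mem_Iv.2 ⟨hik, le_rfl⟩))
      simpa [hk] using this
  · rintro (⟨-, h⟩ | h)
    · exact h (Finset.mem_insert_self _ _)
    · have : (⟨k, by omega⟩ : Fin (m + 1)) ∈ insert (Fin.last m) (Iv (m + 1) i k) :=
        Finset.mem_insert_of_mem (mem_Iv.2 ⟨hik, le_rfl⟩)
      rw [h, Finset.mem_singleton, Fin.ext_iff, Fin.val_last] at this
      simp at this
      omega

lemma tri_fac {m : ℕ} (hm : 2 ≤ m) : Fac (pathTriangle m 1) (triB m) := by
  classical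
  refine ⟨?_, ?_, ?_, ?_⟩
  · intro I hI
    rcases tri_cases hm hI with ⟨i, j, hi, hij, hj, rfl⟩ | ⟨k, hk, rfl⟩ | ⟨k, hk, rfl⟩ | ⟨k, hk, rfl⟩
    · rw [triB_T hi hij hj]; omega
    · rw [triB_A hk]; omega
    · rcases Nat.eq_zero_or_pos k with rfl | hk0
      · rw [triB_B0]; omega
      · rw [triB_insert hk0 hk]; omega
    · rw [triB_insert (Nat.zero_le _) hk]; omega
  · intro i hi
    rcases Nat.eq_zero_or_pos i with rfl | h0
    · exact ⟨_, tri_conn_insert hm (Nat.zero_le 1) (by omega), triB_insert (k := 0) le_rfl (by omega)⟩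
    rcases Nat.lt_or_ge i m with h | h
    · exact ⟨_, tri_conn_Iv hm le_rfl h, triB_T h0 le_rfl h⟩
    · obtain rfl : i = m := by omega
      exact ⟨_, tri_conn_Iv hm (Nat.zero_le 0) (by omega), triB_A (by omega)⟩
  · intro x hx
    have hP0 := pre_zero x
    -- block 0
    have hβ : x (Fin.last m) = - pre x 1 := by
      obtain ⟨I, hI, hb, hs⟩ := hx 0 (by omega)
      rcases tri_cases hm hI with
        ⟨i, j, hi, hij, hj, rfl⟩ | ⟨k, hk, rfl⟩ | ⟨k, hk, rfl⟩ | ⟨k, hk, rfl⟩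
      · rw [triB_T hi hij hj] at hb; omega
      · rw [triB_A hk] at hb; omega
      · rcases Nat.eq_zero_or_pos k with rfl | hk0
        · rw [triB_B0] at hb; omega
        · rw [triB_insert hk0 hk] at hb; omega
      · rw [triB_insert (Nat.zero_le _) hk] at hb
        subst hb
        rw [sum_insert_Iv x (by omega) hk, hP0] at hs
        simp only [zero_add] at hs
        linarith
    -- the blocks `1, …, m - 1`
    have key : ∀ k, 1 ≤ k → k ≤ m → pre x k = pre x 1 ∨ pre x k = 2 * pre x 1 := by
      intro k
      induction k using Nat.strong_induction_on with
      | _ k ih =>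
        intro hk1 hkm
        rcases Nat.eq_or_lt_of_le hk1 with rfl | hk2
        · exact Or.inl rfl
        obtain ⟨I, hI, hb, hs⟩ := hx (k - 1) (by omega)
        rcases tri_cases hm hI with
          ⟨i, j, hi, hij, hj, rfl⟩ | ⟨l, hl, rfl⟩ | ⟨l, hl, rfl⟩ | ⟨l, hl, rfl⟩
        · rw [triB_T hi hij hj] at hb
          obtain rfl : k = j + 1 := by omega
          rw [sum_Iv x _ _ (by omega), sub_eq_zero] at hs
          rw [hs]
          exact ih i (by omega) hi (by omega)
        · rw [triB_A hl] at hb; omega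
        · rcases Nat.eq_zero_or_pos l with rfl | hl0
          · rw [triB_B0] at hb; omega
          · rw [triB_insert hl0 hl] at hb
            obtain rfl : k = l + 1 := by omega
            rw [sum_insert_Iv x (by omega) hl, hβ] at hs
            right; linarith
        · rw [triB_insert (Nat.zero_le _) hl] at hb
          obtain rfl : k = l + 1 := by omega
          rw [sum_insert_Iv x (by omega) hl, hβ, hP0] at hs
          left; linarith
    -- block `m`
    have hP1 : pre x 1 = 0 := by
      obtain ⟨I, hI, hb, hs⟩ := hx m (by omega)
      rcases tri_cases hm hI with
        ⟨i, j, hi, hij, hj, rfl⟩ | ⟨k, hk, rfl⟩ | ⟨k, hk, rfl⟩ | ⟨k, hk, rfl⟩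
      · rw [triB_T hi hij hj] at hb; omega
      · rw [sum_Iv x _ _ (by omega), hP0] at hs
        rcases key (k + 1) (by omega) (by omega) with h | h <;> linarith
      · rcases Nat.eq_zero_or_pos k with rfl | hk0
        · rw [sum_insert_Iv x (by omega) hk, hβ] at hs
          simp only [zero_add] at hs
          linarith
        · rw [triB_insert hk0 hk] at hb; omega
      · rw [triB_insert (Nat.zero_le _) hk] at hb; omega
    have hP : ∀ k, k ≤ m → pre x k = 0 := by
      intro k hk
      rcases Nat.eq_zero_or_pos k with rfl | h
      · exact hP0
      · rcases key k h hk with h | h <;> rw [h, hP1]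
        simp
    funext j
    rcases Nat.lt_or_ge j.val m with h | h
    · rw [show j = ⟨j.val, j.2⟩ from rfl, pre_succ x j.val j.2, hP _ (by omega), hP _ (by omega)]
      simp
    · have : j = Fin.last m := Fin.ext (by rw [Fin.val_last]; omega)
      rw [this, hβ, hP1]
      simp
  · rintro M _ c ⟨I, hI, hs⟩
    have hP0 := pre_zero c
    have sT : ∀ i j, i ≤ j + 1 → ∑ x ∈ Iv (m + 1) i j, c x = pre c (j + 1) - pre c i :=
      fun i j h => sum_Iv c i j h
    have sA : ∀ k, ∑ x ∈ Iv (m + 1) 0 k, c x = pre c (k + 1) := by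
      intro k
      rw [sum_Iv c _ _ (by omega), hP0, sub_zero]
    have sB : ∀ k, k < m → ∑ x ∈ insert (Fin.last m) (Iv (m + 1) 1 k), c x
        = c (Fin.last m) + (pre c (k + 1) - pre c 1) :=
      fun k hk => sum_insert_Iv c (by omega) hk
    have sAB : ∀ k, k < m → ∑ x ∈ insert (Fin.last m) (Iv (m + 1) 0 k), c x
        = c (Fin.last m) + pre c (k + 1) := by
      intro k hk
      rw [sum_insert_Iv c (by omega) hk, hP0, sub_zero]
    generalize c (Fin.last m) = β at sB sAB
    by_cases hr : β + pre c 1 = 0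
    · refine ⟨_, tri_conn_insert hm (Nat.zero_le 1) (show 0 < m by omega), ?_, ?_⟩
      · rw [sAB 0 (by omega)]; exact hr
      intro J hJ _ hb
      rw [triB_insert le_rfl (by omega)] at hb
      rcases tri_cases hm hJ with
        ⟨i, j, hi, hij, hj, rfl⟩ | ⟨k, hk, rfl⟩ | ⟨k, hk, rfl⟩ | ⟨k, hk, rfl⟩
      · rw [triB_T hi hij hj] at hb; omega
      · rw [triB_A hk] at hb; omega
      · rcases Nat.eq_zero_or_pos k with rfl | hk0
        · rw [triB_B0] at hb; omega
        · rw [triB_insert hk0 hk] at hb; omega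
      · rw [triB_insert (Nat.zero_le _) hk] at hb
        rw [hb]
    by_cases hq : β = 0
    · subst hq
      rw [zero_add] at hr
      by_cases hex : ∃ j, 1 ≤ j ∧ j < m ∧ pre c (j + 1) = 0
      · obtain ⟨hj1, hjm, he⟩ := Nat.find_spec hex
        have hmin : ∀ k < Nat.find hex, _ := fun k hk => Nat.find_min hex hk
        generalize Nat.find hex = j at hj1 hjm he hmin
        refine ⟨_, tri_conn_insert hm (Nat.zero_le 1) hjm, ?_, ?_⟩
        · rw [sAB j hjm, he, zero_add]
        intro J hJ hJ0 hb
        rw [triB_insert (Nat.zero_le _) hjm] at hb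
        rcases tri_cases hm hJ with
          ⟨i, l, hi, hil, hl, rfl⟩ | ⟨k, hk, rfl⟩ | ⟨k, hk, rfl⟩ | ⟨k, hk, rfl⟩
        · rw [triB_T hi hil hl] at hb
          subst hb
          rw [sT _ _ (by omega), he, zero_sub, neg_eq_zero] at hJ0
          rcases Nat.eq_or_lt_of_le hi with rfl | hi2
          · exact (hr hJ0).elim
          · refine (hmin (i - 1) (by omega) ⟨by omega, by omega, ?_⟩).elim
            rwa [show i - 1 + 1 = i by omega]
        · rw [triB_A hk] at hb; omega
        · rcases Nat.eq_zero_or_pos k with rfl | hk0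
          · rw [triB_B0] at hb; omega
          · rw [triB_insert hk0 hk] at hb
            subst hb
            rw [sB _ hk, he, zero_sub, zero_add, neg_eq_zero] at hJ0
            exact (hr hJ0).elim
        · rw [triB_insert (Nat.zero_le _) hk] at hb
          rw [hb]
      · refine ⟨_, tri_conn_insert hm (le_refl 1) (show 0 < m by omega), ?_, ?_⟩
        · rw [sB 0 (by omega), zero_add, zero_add, sub_self]
        intro J hJ hJ0 hb
        rw [triB_B0] at hb
        rcases tri_cases hm hJ with
          ⟨i, l, hi, hil, hl, rfl⟩ | ⟨k, hk, rfl⟩ | ⟨k, hk, rfl⟩ | ⟨k, hk, rfl⟩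
        · rw [triB_T hi hil hl] at hb; omega
        · rw [sA] at hJ0
          rcases Nat.eq_zero_or_pos k with rfl | hk0
          · exact (hr hJ0).elim
          · exact (hex ⟨k, hk0, hk, hJ0⟩).elim
        · rcases Nat.eq_zero_or_pos k with rfl | hk0
          · rfl
          · rw [triB_insert hk0 hk] at hb; omega
        · rw [triB_insert (Nat.zero_le _) hk] at hb; omega
    by_cases hp : pre c 1 = 0
    · by_cases hex : ∃ j, 1 ≤ j ∧ j < m ∧ pre c (j + 1) = 0
      · obtain ⟨hj1, hjm, he⟩ := Nat.find_spec hex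
        have hmin : ∀ k < Nat.find hex, _ := fun k hk => Nat.find_min hex hk
        generalize Nat.find hex = j at hj1 hjm he hmin
        refine ⟨_, tri_conn_Iv hm hj1 hjm, ?_, ?_⟩
        · rw [sT _ _ (by omega), he, hp, sub_zero]
        intro J hJ hJ0 hb
        rw [triB_T le_rfl hj1 hjm] at hb
        rcases tri_cases hm hJ with
          ⟨i, l, hi, hil, hl, rfl⟩ | ⟨k, hk, rfl⟩ | ⟨k, hk, rfl⟩ | ⟨k, hk, rfl⟩
        · rw [triB_T hi hil hl] at hb
          subst hb
          rw [sT _ _ (by omega), he, zero_sub, neg_eq_zero] at hJ0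
          rcases Nat.eq_or_lt_of_le hi with rfl | hi2
          · rfl
          · refine (hmin (i - 1) (by omega) ⟨by omega, by omega, ?_⟩).elim
            rwa [show i - 1 + 1 = i by omega]
        · rw [triB_A hk] at hb; omega
        · rcases Nat.eq_zero_or_pos k with rfl | hk0
          · rw [triB_B0] at hb; omega
          · rw [triB_insert hk0 hk] at hb
            subst hb
            rw [sB _ hk, he, hp, sub_zero, add_zero] at hJ0
            exact (hq hJ0).elim
        · rw [triB_insert (Nat.zero_le _) hk] at hb
          subst hb
          rw [sAB _ hk, he, add_zero] at hJ0
          exact (hq hJ0).elim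
      · refine ⟨_, tri_conn_Iv hm (le_refl 0) (show 0 < m by omega), ?_, ?_⟩
        · rw [sA]; exact hp
        intro J hJ hJ0 hb
        rw [triB_A (by omega)] at hb
        rcases tri_cases hm hJ with
          ⟨i, l, hi, hil, hl, rfl⟩ | ⟨k, hk, rfl⟩ | ⟨k, hk, rfl⟩ | ⟨k, hk, rfl⟩
        · rw [triB_T hi hil hl] at hb; omega
        · rw [sA] at hJ0
          rcases Nat.eq_zero_or_pos k with rfl | hk0
          · rfl
          · exact (hex ⟨k, hk0, hk, hJ0⟩).elim
        · rcases Nat.eq_zero_or_pos k with rfl | hk0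
          · rw [sB 0 hk] at hJ0
            simp only [zero_add, sub_self, add_zero] at hJ0
            exact (hq hJ0).elim
          · rw [triB_insert hk0 hk] at hb; omega
        · rw [triB_insert (Nat.zero_le _) hk] at hb; omega
    -- consequences of the absence of vanishing sets in the blocks `1, …, j - 1`
    have noT : ∀ j, j ≤ m → (∀ l, 1 ≤ l → l < j → ∀ J, ConnSet (pathTriangle m 1) J →
        ∑ x ∈ J, c x = 0 → triB m J ≠ l) → ∀ i i', 1 ≤ i → i < i' → i' ≤ j →
        pre c i ≠ pre c i' := by
      intro j hj hno i i' hi hii hi' he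
      refine hno (i' - 1) (by omega) (by omega) _ (tri_conn_Iv hm (i := i) (j := i' - 1) (by omega)
        (by omega)) ?_ (triB_T hi (by omega) (by omega))
      rw [sT _ _ (by omega), show i' - 1 + 1 = i' by omega, he, sub_self]
    by_cases hex : ∃ j, 1 ≤ j ∧ j < m ∧ ∃ J, ConnSet (pathTriangle m 1) J ∧
        ∑ x ∈ J, c x = 0 ∧ triB m J = j
    · obtain ⟨hj1, hjm, K, hK, hK0, hKb⟩ := Nat.find_spec hex
      have hmin : ∀ k < Nat.find hex, _ := fun k hk => Nat.find_min hex hk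
      generalize Nat.find hex = j at hj1 hjm hKb hmin
      have hno : ∀ l, 1 ≤ l → l < j → ∀ J, ConnSet (pathTriangle m 1) J →
          ∑ x ∈ J, c x = 0 → triB m J ≠ l :=
        fun l hl hlj J hJ hJ0 hJb => hmin l hlj ⟨hl, by omega, J, hJ, hJ0, hJb⟩
      have nT := noT j hjm.le hno
      have nB : ∀ i, 1 ≤ i → i ≤ j → β + (pre c i - pre c 1) ≠ 0 := by
        intro i hi hij he
        rcases Nat.eq_or_lt_of_le hi with rfl | hi2
        · exact hq (by simpa using he)
        · refine hno (i - 1) (by omega) (by omega) _ (tri_conn_insert hm (le_refl 1)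
            (j := i - 1) (by omega)) ?_ (triB_insert (by omega) (by omega))
          rwa [sB _ (by omega), show i - 1 + 1 = i by omega]
      have nAB : ∀ i, 1 ≤ i → i ≤ j → β + pre c i ≠ 0 := by
        intro i hi hij he
        rcases Nat.eq_or_lt_of_le hi with rfl | hi2
        · exact hr he
        · refine hno (i - 1) (by omega) (by omega) _ (tri_conn_insert hm (Nat.zero_le 1)
            (j := i - 1) (by omega)) ?_ (triB_insert (by omega) (by omega))
          rwa [sAB _ (by omega), show i - 1 + 1 = i by omega]
      -- the three types of vanishing sets in block `j`
      have typ : ∀ J, ConnSet (pathTriangle m 1) J → ∑ x ∈ J, c x = 0 → triB m J = j →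
          (∃ i, 1 ≤ i ∧ i ≤ j ∧ J = Iv (m + 1) i j ∧ pre c (j + 1) = pre c i) ∨
          (J = insert (Fin.last m) (Iv (m + 1) 1 j) ∧ β + (pre c (j + 1) - pre c 1) = 0) ∨
          (J = insert (Fin.last m) (Iv (m + 1) 0 j) ∧ β + pre c (j + 1) = 0) := by
        intro J hJ hJ0 hb
        rcases tri_cases hm hJ with
          ⟨i, l, hi, hil, hl, rfl⟩ | ⟨k, hk, rfl⟩ | ⟨k, hk, rfl⟩ | ⟨k, hk, rfl⟩
        · rw [triB_T hi hil hl] at hb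
          subst hb
          rw [sT _ _ (by omega), sub_eq_zero] at hJ0
          exact Or.inl ⟨i, hi, hil, rfl, hJ0⟩
        · rw [triB_A hk] at hb; omega
        · rcases Nat.eq_zero_or_pos k with rfl | hk0
          · rw [triB_B0] at hb; omega
          · rw [triB_insert hk0 hk] at hb
            subst hb
            rw [sB _ hk] at hJ0
            exact Or.inr (Or.inl ⟨rfl, hJ0⟩)
        · rw [triB_insert (Nat.zero_le _) hk] at hb
          subst hb
          rw [sAB _ hk] at hJ0
          exact Or.inr (Or.inr ⟨rfl, hJ0⟩)
      have hBAB : β + (pre c (j + 1) - pre c 1) = 0 → β + pre c (j + 1) = 0 → False := by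
        intro h1 h2
        rw [← add_sub_assoc, h2, zero_sub, neg_eq_zero] at h1
        exact hp h1
      refine ⟨K, hK, hK0, fun J hJ hJ0 hb => ?_⟩
      rcases typ K hK hK0 hKb with ⟨i, hi, hij, rfl, he⟩ | ⟨rfl, he⟩ | ⟨rfl, he⟩ <;>
      rcases typ J hJ hJ0 (hb.trans hKb) with ⟨i', hi', hij', rfl, he'⟩ | ⟨rfl, he'⟩ | ⟨rfl, he'⟩
      · rcases lt_trichotomy i i' with h | h | h
        · exact (nT i i' hi h hij' (he.symm.trans he')).elim
        · rw [h]
        · exact (nT i' i hi' h hij (he'.symm.trans he)).elim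
      · rw [he] at he'
        exact (nB i hi hij he').elim
      · rw [he] at he'
        exact (nAB i hi hij he').elim
      · rw [he'] at he
        exact (nB i' hi' hij' he).elim
      · rfl
      · exact (hBAB he he').elim
      · rw [he'] at he
        exact (nAB i' hi' hij' he).elim
      · exact (hBAB he' he).elim
      · rfl
    · have hno : ∀ l, 1 ≤ l → l < m → ∀ J, ConnSet (pathTriangle m 1) J →
          ∑ x ∈ J, c x = 0 → triB m J ≠ l :=
        fun l hl hlj J hJ hJ0 hJb => hex ⟨l, hl, hlj, J, hJ, hJ0, hJb⟩
      have nT := noT m le_rfl hno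
      have typ : ∀ J, ConnSet (pathTriangle m 1) J → ∑ x ∈ J, c x = 0 →
          ∃ k < m, J = Iv (m + 1) 0 k ∧ pre c (k + 1) = 0 := by
        intro J hJ hJ0
        have hno' := fun l h1 h2 => hno l h1 h2 J hJ hJ0
        rcases tri_cases hm hJ with
          ⟨i, l, hi, hil, hl, rfl⟩ | ⟨k, hk, rfl⟩ | ⟨k, hk, rfl⟩ | ⟨k, hk, rfl⟩
        · exact (hno' l (by omega) hl (triB_T hi hil hl)).elim
        · rw [sA] at hJ0
          exact ⟨k, hk, rfl, hJ0⟩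
        · rcases Nat.eq_zero_or_pos k with rfl | hk0
          · rw [sB 0 hk] at hJ0
            simp only [zero_add, sub_self, add_zero] at hJ0
            exact (hq hJ0).elim
          · exact (hno' k hk0 hk (triB_insert hk0 hk)).elim
        · rcases Nat.eq_zero_or_pos k with rfl | hk0
          · rw [sAB 0 hk] at hJ0
            exact (hr hJ0).elim
          · exact (hno' k hk0 hk (triB_insert (Nat.zero_le _) hk)).elim
      refine ⟨I, hI, hs, fun J hJ hJ0 _ => ?_⟩
      obtain ⟨k, hk, rfl, he⟩ := typ I hI hs
      obtain ⟨k', hk', rfl, he'⟩ := typ J hJ hJ0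
      rcases lt_trichotomy k k' with h | h | h
      · exact (nT (k + 1) (k' + 1) (by omega) (by omega) (by omega) (he.trans he'.symm)).elim
      · rw [h]
      · exact (nT (k' + 1) (k + 1) (by omega) (by omega) (by omega) (he'.trans he.symm)).elim

/-- For a finite connected simple graph `G`, the connected subgraph
arrangement `𝒜_G` is factored if and only if `G` is a path graph or a
path-with-triangle graph `Δ_{m,1}` for some `m ≥ 2`. -/
theorem csa_factored_iff {n : ℕ} (G : SimpleGraph (Fin n)) (hG : G.Connected) :
    IsFactored (csaForms G) ↔
      ((∃ m : ℕ, Nonempty (G ≃g SimpleGraph.pathGraph m)) ∨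
       (∃ m : ℕ, 2 ≤ m ∧ Nonempty (G ≃g pathTriangle m 1))) := by
  constructor
  · exact fun h => good_of_col n G hG (col_of_factored G h)
  · rintro (⟨m, ⟨f⟩⟩ | ⟨m, hm, ⟨f⟩⟩)
    · have hn : n = m := by simpa using Fintype.card_congr f.toEquiv
      subst hn
      exact factored_of_fac _ _ (Fac.iso f _ (path_fac n))
    · have hn : n = m + 1 := by simpa using Fintype.card_congr f.toEquiv
      subst hn
      exact factored_of_fac _ _ (Fac.iso f _ (tri_fac hm))
end

section
/- Let G be a finite connected simple graph. The connected subgraph arrangement 𝒜_G over ℚ is supersolvable if and only if G is isomorphic to a path graph. -/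
open Finset

/-- An element `X` of the intersection lattice of the arrangement with defining forms
`F` is modular if `X + Y ∈ L(𝒜)` for every `Y ∈ L(𝒜)`. -/
def IsModular {n : ℕ} (F : Finset ((Fin n → ℚ) →ₗ[ℚ] ℚ))
    (X : Submodule ℚ (Fin n → ℚ)) : Prop :=
  InLattice F X ∧ ∀ Y : Submodule ℚ (Fin n → ℚ), InLattice F Y → InLattice F (X ⊔ Y)

/-- The rank of the arrangement with defining forms `F` in `ℚ^n`: the codimension of
the intersection of all of its hyperplanes. -/
noncomputable def arrRank {n : ℕ} (F : Finset ((Fin n → ℚ) →ₗ[ℚ] ℚ)) : ℕ :=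
  n - Module.finrank ℚ ↥(⨅ f ∈ F, LinearMap.ker f)

/-- The arrangement with defining forms `F` and rank `r` is supersolvable if its
intersection lattice contains a chain `X_0 < X_1 < ⋯ < X_r` (in the reverse-inclusion
order, i.e. a strictly decreasing chain of subspaces) of modular elements. -/
noncomputable def IsSupersolvable {n : ℕ} (F : Finset ((Fin n → ℚ) →ₗ[ℚ] ℚ)) : Prop :=
  ∃ X : Fin (arrRank F + 1) → Submodule ℚ (Fin n → ℚ),
    (∀ i, IsModular F (X i)) ∧ StrictAnti X


namespace CSA

lemma linForm_apply {n : ℕ} (I : Finset (Fin n)) (x : Fin n → ℚ) :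
    linForm I x = ∑ i ∈ I, x i := by
  simp [linForm]

lemma linForm_single {n : ℕ} (I : Finset (Fin n)) (i : Fin n) :
    linForm I (Pi.single i 1) = if i ∈ I then 1 else 0 := by
  rw [linForm_apply]
  simp [Pi.single_apply]

lemma mem_csaForms {n : ℕ} {G : SimpleGraph (Fin n)} {f : (Fin n → ℚ) →ₗ[ℚ] ℚ} :
    f ∈ csaForms G ↔ ∃ I, ConnSet G I ∧ linForm I = f := by
  simp [csaForms]

lemma connSet_singleton {n : ℕ} (G : SimpleGraph (Fin n)) (i : Fin n) : ConnSet G {i} := by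
  refine ⟨Finset.singleton_nonempty _, ?_⟩
  rw [Finset.coe_singleton]
  have : Nonempty ({i} : Set (Fin n)) := ⟨⟨i, rfl⟩⟩
  have : Subsingleton ({i} : Set (Fin n)) := by infer_instance
  exact SimpleGraph.Connected.mk SimpleGraph.Preconnected.of_subsingleton

lemma connSet_insert {n : ℕ} {G : SimpleGraph (Fin n)} {I : Finset (Fin n)} {x w : Fin n}
    (hI : ConnSet G I) (hx : x ∈ I) (h : G.Adj x w) : ConnSet G (insert w I) := by
  refine ⟨Finset.insert_nonempty _ _, ?_⟩
  have hsub : (I : Set (Fin n)) ⊆ ((insert w I : Finset (Fin n)) : Set (Fin n)) := by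
    simp
  have key : ∀ y (hy : y ∈ (insert w I : Finset (Fin n))),
      (G.induce ((insert w I : Finset (Fin n)) : Set (Fin n))).Reachable
        ⟨x, hsub hx⟩ ⟨y, hy⟩ := by
    intro y hy
    rcases Finset.mem_insert.1 hy with rfl | hy'
    · exact SimpleGraph.Adj.reachable (by simpa using h)
    · have := hI.2.preconnected ⟨x, hx⟩ ⟨y, hy'⟩
      exact this.map (SimpleGraph.induceHomOfLE G hsub).toHom
  have : Nonempty ((insert w I : Finset (Fin n)) : Set (Fin n)) := ⟨⟨x, hsub hx⟩⟩
  exact SimpleGraph.Connected.mk fun a b => (key a.1 a.2).symm.trans (key b.1 b.2)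

lemma connSet_ind {n : ℕ} {G : SimpleGraph (Fin n)} {I : Finset (Fin n)}
    (hI : ConnSet G I) (P : Fin n → Prop) {u : Fin n} (hu : u ∈ I) (hP : P u)
    (hs : ∀ x ∈ I, ∀ y ∈ I, G.Adj x y → P x → P y) {w : Fin n} (hw : w ∈ I) : P w := by
  obtain ⟨p⟩ := hI.2.preconnected ⟨u, hu⟩ ⟨w, hw⟩
  have : ∀ (a b : (I : Set (Fin n))) (_ : (G.induce (I : Set (Fin n))).Walk a b),
      P a.1 → P b.1 := by
    intro a b p
    induction p with
    | nil => exact id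
    | cons h _ ih => exact fun ha => ih (hs _ (Subtype.property _) _ (Subtype.property _) h ha)
  exact this _ _ p hP

lemma conn_ind {n : ℕ} {G : SimpleGraph (Fin n)}
    (hG : G.Connected) (P : Fin n → Prop) {u : Fin n} (hP : P u)
    (hs : ∀ x y, G.Adj x y → P x → P y) (w : Fin n) : P w := by
  obtain ⟨p⟩ := hG.preconnected u w
  induction p with
  | nil => exact hP
  | cons h _ ih => exact ih (hs _ _ h hP)

/-- Image of an integer interval under a labelling. -/
noncomputable def seg {n : ℕ} (f : ℤ → Fin n) (a b : ℤ) : Finset (Fin n) := (Finset.Icc a b).image f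

lemma mem_seg {n : ℕ} {f : ℤ → Fin n} {a b : ℤ} {x : Fin n} :
    x ∈ seg f a b ↔ ∃ t, a ≤ t ∧ t ≤ b ∧ f t = x := by
  simp [seg, and_assoc]

lemma connSet_seg {n : ℕ} {G : SimpleGraph (Fin n)} (f : ℤ → Fin n) (a : ℤ) (k : ℕ)
    (h : ∀ t, a ≤ t → t < a + k → G.Adj (f t) (f (t + 1))) : ConnSet G (seg f a (a + k)) := by
  induction k with
  | zero => simpa [seg] using connSet_singleton G (f a)
  | succ k ih =>
    have h1 := ih (fun t h1 h2 => h t h1 (by push_cast; omega))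
    have h2 := connSet_insert h1 (x := f (a + k)) (w := f (a + k + 1))
      (mem_seg.2 ⟨_, by omega, by omega, rfl⟩) (h _ (by omega) (by push_cast; omega))
    convert h2 using 1
    ext x
    rw [Finset.mem_insert, mem_seg, mem_seg]
    constructor
    · rintro ⟨t, h1, h2, rfl⟩
      push_cast at h2
      by_cases h : t = a + k + 1
      · exact Or.inl (by rw [h])
      · exact Or.inr ⟨t, h1, by omega, rfl⟩
    · rintro (rfl | ⟨t, h1, h2, rfl⟩)
      · exact ⟨_, by omega, by push_cast; omega, rfl⟩
      · exact ⟨t, h1, by push_cast; omega, rfl⟩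

lemma connSet_seg' {n : ℕ} {G : SimpleGraph (Fin n)} (f : ℤ → Fin n) (a b : ℤ) (hab : a ≤ b)
    (h : ∀ t, a ≤ t → t < b → G.Adj (f t) (f (t + 1))) : ConnSet G (seg f a b) := by
  obtain ⟨k, rfl⟩ := Int.le.dest hab
  exact connSet_seg f a k h

/-- Consequence of modularity of the line spanned by `v`. -/
def Prop1 {n : ℕ} (G : SimpleGraph (Fin n)) (v : Fin n → ℚ) : Prop :=
  ∀ I J, ConnSet G I → ConnSet G J → I ≠ J → ∑ i ∈ I, v i ≠ 0 → ∑ i ∈ J, v i ≠ 0 →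
    (Disjoint I J ∧ ∑ i ∈ I, v i = - ∑ i ∈ J, v i ∧ ConnSet G (I ∪ J)) ∨ J ⊆ I ∨ I ⊆ J

lemma prop1_of_modular {n : ℕ} {G : SimpleGraph (Fin n)} {X : Submodule ℚ (Fin n → ℚ)}
    (hX : IsModular (csaForms G) X) (v : Fin n → ℚ) (hv : v ∈ X)
    (hXv : ∀ x ∈ X, ∃ c : ℚ, x = c • v) : Prop1 G v := by
  classical
  intro I J hI hJ hIJ hvI hvJ
  have hY : InLattice (csaForms G) (LinearMap.ker (linForm I) ⊓ LinearMap.ker (linForm J)) := by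
    refine ⟨{linForm I, linForm J}, ?_, ?_⟩
    · intro f hf
      rw [mem_csaForms]
      rcases Finset.mem_insert.1 hf with rfl | hf
      · exact ⟨I, hI, rfl⟩
      · rw [Finset.mem_singleton.1 hf]; exact ⟨J, hJ, rfl⟩
    · rw [Finset.iInf_insert, Finset.iInf_singleton]
  obtain ⟨B, hB, hBe⟩ := hX.2 _ hY
  set c : (Fin n → ℚ) →ₗ[ℚ] ℚ := linForm J v • linForm I - linForm I v • linForm J with hc
  have hle : X ⊔ (LinearMap.ker (linForm I) ⊓ LinearMap.ker (linForm J)) ≤ LinearMap.ker c := by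
    refine sup_le ?_ ?_
    · intro x hx
      obtain ⟨r, rfl⟩ := hXv x hx
      rw [LinearMap.mem_ker, hc]
      simp only [LinearMap.sub_apply, LinearMap.smul_apply, map_smul, smul_eq_mul]
      ring
    · rintro x ⟨h1, h2⟩
      have h1' : linForm I x = 0 := h1
      have h2' : linForm J x = 0 := h2
      rw [LinearMap.mem_ker, hc]
      simp [h1', h2']
  have hvI' : linForm I v ≠ 0 := by rwa [linForm_apply]
  have hvJ' : linForm J v ≠ 0 := by rwa [linForm_apply]
  have hc0 : c ≠ 0 := by
    intro h0
    apply hIJ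
    ext k
    have := LinearMap.congr_fun h0 (Pi.single k 1)
    simp only [hc, LinearMap.sub_apply, LinearMap.smul_apply, linForm_single,
      LinearMap.zero_apply, smul_eq_mul] at this
    by_cases h1 : k ∈ I <;> by_cases h2 : k ∈ J <;> simp_all
  have hBne : B.Nonempty := by
    rw [Finset.nonempty_iff_ne_empty]
    rintro rfl
    rw [hBe] at hle
    simp at hle
    exact hc0 hle
  obtain ⟨g, hg⟩ := hBne
  obtain ⟨K, hK, rfl⟩ := mem_csaForms.1 (hB hg)
  have hKle : X ⊔ (LinearMap.ker (linForm I) ⊓ LinearMap.ker (linForm J))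
      ≤ LinearMap.ker (linForm K) := by
    rw [hBe]; exact iInf₂_le _ hg
  have hKv : linForm K v = 0 := hKle (Submodule.mem_sup_left hv)
  have hspan : linForm K ∈ Submodule.span ℚ (Set.range ![linForm I, linForm J]) := by
    apply mem_span_of_iInf_ker_le_ker
    intro x hx
    rw [Submodule.mem_iInf] at hx
    exact hKle (Submodule.mem_sup_right ⟨hx 0, hx 1⟩)
  rw [Matrix.range_cons, Matrix.range_cons, Matrix.range_empty, Set.union_empty,
    Set.singleton_union, Submodule.mem_span_pair] at hspan
  obtain ⟨α, β, hαβ⟩ := hspan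
  have hrel : ∀ k, α * (if k ∈ I then 1 else 0) + β * (if k ∈ J then 1 else 0)
      = (if k ∈ K then (1:ℚ) else 0) := by
    intro k
    have := LinearMap.congr_fun hαβ (Pi.single k 1)
    simpa only [LinearMap.add_apply, LinearMap.smul_apply, linForm_single, smul_eq_mul] using this
  have hv0 : α * linForm I v + β * linForm J v = 0 := by
    rw [← hKv, ← hαβ]; simp
  obtain ⟨k0, hk0⟩ := hK.1
  have hα : α ≠ 0 := by
    rintro rfl
    have hβ : β = 0 := by simpa [hvJ'] using hv0
    have := hrel k0
    simp [hβ, hk0] at this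
  have hβ : β ≠ 0 := by
    rintro rfl
    exact hα (by simpa [hvI'] using hv0)
  have h01 : ∀ k, (if k ∈ K then (1:ℚ) else 0) = 0 ∨ (if k ∈ K then (1:ℚ) else 0) = 1 := by
    intro k; split_ifs <;> simp
  by_cases h1 : J ⊆ I
  · exact Or.inr (Or.inl h1)
  by_cases h2 : I ⊆ J
  · exact Or.inr (Or.inr h2)
  left
  obtain ⟨p, hp1, hp2⟩ := Finset.not_subset.1 h1
  obtain ⟨q, hq1, hq2⟩ := Finset.not_subset.1 h2
  have hβ1 : β = 1 := by
    have h3 := hrel p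
    have h4 := h01 p
    simp only [hp1, hp2, if_true, if_false] at h3
    rw [← h3] at h4
    simpa [hβ] using h4
  have hα1 : α = 1 := by
    have h3 := hrel q
    have h4 := h01 q
    simp only [hq1, hq2, if_true, if_false] at h3
    rw [← h3] at h4
    simpa [hα] using h4
  subst hα1 hβ1
  have hdis : Disjoint I J := by
    rw [Finset.disjoint_left]
    intro k hk1 hk2
    have h3 := hrel k
    have h4 := h01 k
    simp only [hk1, hk2, if_true] at h3
    rw [← h3] at h4
    norm_num at h4
  refine ⟨hdis, ?_, ?_⟩
  · rw [← linForm_apply, ← linForm_apply]; linarith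
  · convert hK
    ext k
    have h3 := hrel k
    rw [Finset.mem_union]
    by_cases hI' : k ∈ I <;> by_cases hJ' : k ∈ J <;> by_cases hK' : k ∈ K <;>
      simp [hI', hJ', hK'] at h3 ⊢

end CSA

namespace CSA

/-- If `f` labels a path `f a, …, f 0` where `v` is supported only at `f 0`, then a new vertex
attached to it must be attached at `f a`. -/
lemma left_end {n : ℕ} {G : SimpleGraph (Fin n)} {v : Fin n → ℚ} (hv : Prop1 G v)
    (f : ℤ → Fin n) (a : ℤ)
    (hinj : ∀ s t, a ≤ s → s ≤ 0 → a ≤ t → t ≤ 0 → f s = f t → s = t)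
    (hadj : ∀ t, a ≤ t → t < 0 → G.Adj (f t) (f (t + 1)))
    (h0 : v (f 0) ≠ 0) (hz : ∀ t, a ≤ t → t < 0 → v (f t) = 0)
    (w : Fin n) (hw : ∀ t, a ≤ t → t ≤ 0 → f t ≠ w) (hvw : v w = 0)
    (t : ℤ) (hat : a ≤ t) (ht : t ≤ 0) (hwt : G.Adj (f t) w) : t = a := by
  by_contra hne
  have hlt : a ≤ t - 1 := by omega
  have hsum : ∀ s, a ≤ s → s ≤ 0 → ∑ i ∈ seg f s 0, v i = v (f 0) := by
    intro s h1 h2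
    apply Finset.sum_eq_single_of_mem _ (mem_seg.2 ⟨0, h2, le_refl _, rfl⟩)
    intro b hb hb0
    obtain ⟨u, hu1, hu2, rfl⟩ := mem_seg.1 hb
    apply hz u (by omega)
    rcases hu2.lt_or_eq with h | h
    · exact h
    · exact absurd (by rw [h]) hb0
  have hc1 : ConnSet G (seg f (t - 1) 0) :=
    connSet_seg' f _ _ (by omega) fun u h1 h2 => hadj u (by omega) h2
  have hc2 : ConnSet G (seg f t 0) :=
    connSet_seg' f _ _ (by omega) fun u h1 h2 => hadj u (by omega) h2
  have hc3 := connSet_insert hc2 (mem_seg.2 ⟨t, le_refl _, ht, rfl⟩) hwt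
  have hwn : ∀ s, a ≤ s → w ∉ seg f s 0 := by
    intro s hs hmem
    obtain ⟨u, hu1, hu2, hu3⟩ := mem_seg.1 hmem
    exact hw u (by omega) hu2 hu3
  have hs1 := hsum (t - 1) hlt (by omega)
  have hs3 : ∑ i ∈ insert w (seg f t 0), v i = v (f 0) := by
    rw [Finset.sum_insert (hwn t hat), hsum t hat ht, hvw, zero_add]
  have hne : seg f (t - 1) 0 ≠ insert w (seg f t 0) := by
    intro h
    exact hwn (t - 1) hlt (h ▸ Finset.mem_insert_self _ _)
  rcases hv _ _ hc1 hc3 hne (by rwa [hs1]) (by rwa [hs3]) with h | h | h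
  · refine Finset.disjoint_left.1 h.1 (mem_seg.2 ⟨0, by omega, le_refl _, rfl⟩) ?_
    exact Finset.mem_insert_of_mem (mem_seg.2 ⟨0, by omega, le_refl _, rfl⟩)
  · exact hwn (t - 1) hlt (h (Finset.mem_insert_self _ _))
  · have := h (mem_seg.2 ⟨t - 1, le_refl _, by omega, rfl⟩)
    rcases Finset.mem_insert.1 this with h | h
    · exact hw _ hlt (by omega) h
    · obtain ⟨u, hu1, hu2, hu3⟩ := mem_seg.1 h
      have := hinj u (t - 1) (by omega) hu2 hlt (by omega) hu3
      omega

/-- An induced path containing the support of `v` in its middle. -/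
structure Good {n : ℕ} (G : SimpleGraph (Fin n)) (v : Fin n → ℚ) (f : ℤ → Fin n) (a b : ℤ) :
    Prop where
  ha : a ≤ 0
  hb : 0 ≤ b
  inj : ∀ s t, a ≤ s → s ≤ b → a ≤ t → t ≤ b → f s = f t → s = t
  adj : ∀ s t, a ≤ s → s ≤ b → a ≤ t → t ≤ b → (G.Adj (f s) (f t) ↔ s + 1 = t ∨ t + 1 = s)
  h0 : v (f 0) ≠ 0
  h1 : 1 ≤ b → v (f 1) ≠ 0
  supp : ∀ x, v x ≠ 0 → x = f 0 ∨ (1 ≤ b ∧ x = f 1)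

lemma Good.zero {n : ℕ} {G : SimpleGraph (Fin n)} {v : Fin n → ℚ} {f : ℤ → Fin n} {a b : ℤ}
    (h : Good G v f a b) (t : ℤ) (h1 : a ≤ t) (h2 : t ≤ b) (h3 : t ≠ 0) (h4 : t ≠ 1) :
    v (f t) = 0 := by
  by_contra hne
  have := h.ha
  have := h.hb
  rcases h.supp _ hne with h' | ⟨hb, h'⟩
  · exact h3 (h.inj _ _ h1 h2 (by omega) (by omega) h')
  · exact h4 (h.inj _ _ h1 h2 (by omega) (by omega) h')

lemma Good.left {n : ℕ} {G : SimpleGraph (Fin n)} {v : Fin n → ℚ} (hv : Prop1 G v)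
    {f : ℤ → Fin n} {a b : ℤ}
    (h : Good G v f a b) (w : Fin n) (hw : ∀ t, a ≤ t → t ≤ b → f t ≠ w) (hvw : v w = 0)
    (t : ℤ) (hat : a ≤ t) (ht : t ≤ 0) (hwt : G.Adj (f t) w) : t = a := by
  have := h.ha
  have := h.hb
  refine left_end hv f a ?_ ?_ h.h0 ?_ w ?_ hvw t hat ht hwt
  · intro s t _ _ _ _ e
    exact h.inj s t (by omega) (by omega) (by omega) (by omega) e
  · intro t _ _
    exact (h.adj _ _ (by omega) (by omega) (by omega) (by omega)).2 (by omega)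
  · intro t _ _
    exact h.zero t (by omega) (by omega) (by omega) (by omega)
  · intro t _ _
    exact hw t (by omega) (by omega)

lemma Good.right {n : ℕ} {G : SimpleGraph (Fin n)} {v : Fin n → ℚ} (hv : Prop1 G v)
    {f : ℤ → Fin n} {a b : ℤ}
    (h : Good G v f a b) (w : Fin n) (hw : ∀ t, a ≤ t → t ≤ b → f t ≠ w) (hvw : v w = 0)
    (t : ℤ) (hat : 1 ≤ t) (ht : t ≤ b) (hwt : G.Adj (f t) w) : t = b := by
  have := h.ha
  have := h.hb
  have key : 1 - t = 1 - b := by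
    refine left_end hv (fun s => f (1 - s)) (1 - b) ?_ ?_ ?_ ?_ w ?_ hvw (1 - t)
      (by omega) (by omega) (by simpa using hwt)
    · intro s t _ _ _ _ e
      have := h.inj (1 - s) (1 - t) (by omega) (by omega) (by omega) (by omega) e
      omega
    · intro t _ _
      exact (h.adj _ _ (by omega) (by omega) (by omega) (by omega)).2 (by omega)
    · simpa using h.h1 (by omega)
    · intro t _ _
      exact h.zero _ (by omega) (by omega) (by omega) (by omega)
    · intro t _ _
      exact hw _ (by omega) (by omega)
  omega

lemma Good.notBoth {n : ℕ} {G : SimpleGraph (Fin n)} {v : Fin n → ℚ} (hv : Prop1 G v)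
    {f : ℤ → Fin n} {a b : ℤ}
    (h : Good G v f a b) (w : Fin n) (hw : ∀ t, a ≤ t → t ≤ b → f t ≠ w) (hvw : v w = 0)
    (hb : 1 ≤ b) (h1 : G.Adj (f a) w) (h2 : G.Adj (f b) w) : False := by
  have ha := h.ha
  have hc1 : ConnSet G (seg f a 0) := connSet_seg' f _ _ (by omega) fun u _ _ =>
    (h.adj _ _ (by omega) (by omega) (by omega) (by omega)).2 (by omega)
  have hc2 : ConnSet G (seg f 1 b) := connSet_seg' f _ _ (by omega) fun u _ _ =>
    (h.adj _ _ (by omega) (by omega) (by omega) (by omega)).2 (by omega)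
  have hd1 := connSet_insert hc1 (mem_seg.2 ⟨a, le_refl _, ha, rfl⟩) h1
  have hd2 := connSet_insert hc2 (mem_seg.2 ⟨b, hb, le_refl _, rfl⟩) h2
  have hs1 : ∑ i ∈ insert w (seg f a 0), v i = v (f 0) := by
    apply Finset.sum_eq_single_of_mem _
      (Finset.mem_insert_of_mem (mem_seg.2 ⟨0, ha, le_refl _, rfl⟩))
    intro x hx hx0
    rcases Finset.mem_insert.1 hx with rfl | hx
    · exact hvw
    · obtain ⟨u, hu1, hu2, rfl⟩ := mem_seg.1 hx
      exact h.zero u (by omega) (by omega) (by rintro rfl; exact hx0 rfl) (by omega)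
  have hs2 : ∑ i ∈ insert w (seg f 1 b), v i = v (f 1) := by
    apply Finset.sum_eq_single_of_mem _
      (Finset.mem_insert_of_mem (mem_seg.2 ⟨1, le_refl _, hb, rfl⟩))
    intro x hx hx0
    rcases Finset.mem_insert.1 hx with rfl | hx
    · exact hvw
    · obtain ⟨u, hu1, hu2, rfl⟩ := mem_seg.1 hx
      exact h.zero u (by omega) (by omega) (by omega) (by rintro rfl; exact hx0 rfl)
  have hn1 : f 0 ∉ insert w (seg f 1 b) := by
    intro hm
    rcases Finset.mem_insert.1 hm with e | hm
    · exact hw 0 (by omega) (by omega) e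
    · obtain ⟨u, hu1, hu2, e⟩ := mem_seg.1 hm
      have := h.inj _ _ (by omega) (by omega) (by omega) (by omega) e
      omega
  have hn2 : f 1 ∉ insert w (seg f a 0) := by
    intro hm
    rcases Finset.mem_insert.1 hm with e | hm
    · exact hw 1 (by omega) (by omega) e
    · obtain ⟨u, hu1, hu2, e⟩ := mem_seg.1 hm
      have := h.inj _ _ (by omega) (by omega) (by omega) (by omega) e
      omega
  have hm1 : f 0 ∈ insert w (seg f a 0) :=
    Finset.mem_insert_of_mem (mem_seg.2 ⟨0, ha, le_refl _, rfl⟩)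
  have hm2 : f 1 ∈ insert w (seg f 1 b) :=
    Finset.mem_insert_of_mem (mem_seg.2 ⟨1, le_refl _, hb, rfl⟩)
  rcases hv _ _ hd1 hd2 (fun e => hn1 (e ▸ hm1)) (by rw [hs1]; exact h.h0)
    (by rw [hs2]; exact h.h1 hb) with h | h | h
  · exact Finset.disjoint_left.1 h.1 (Finset.mem_insert_self _ _) (Finset.mem_insert_self _ _)
  · exact hn2 (h hm2)
  · exact hn1 (h hm1)

lemma Good.extend {n : ℕ} {G : SimpleGraph (Fin n)} (hG : G.Connected) {v : Fin n → ℚ}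
    (hv : Prop1 G v) {f : ℤ → Fin n} {a b : ℤ} (h : Good G v f a b)
    (hne : ∃ w, ∀ t, a ≤ t → t ≤ b → f t ≠ w) :
    ∃ f' a' b', Good G v f' a' b' ∧ b' - a' = b - a + 1 := by
  have ha := h.ha
  have hb := h.hb
  obtain ⟨w, hw, t, hat, htb, hwt⟩ : ∃ w, (∀ t, a ≤ t → t ≤ b → f t ≠ w) ∧
      ∃ t, a ≤ t ∧ t ≤ b ∧ G.Adj (f t) w := by
    by_contra! hcon
    obtain ⟨w, hw⟩ := hne
    obtain ⟨t, h1, h2, h3⟩ := conn_ind hG (fun x => ∃ t, a ≤ t ∧ t ≤ b ∧ f t = x) (u := f 0)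
      ⟨0, ha, hb, rfl⟩ (by
        rintro x y hxy ⟨t, h1, h2, rfl⟩
        by_contra! hcon2
        exact hcon y hcon2 t h1 h2 hxy) w
    exact hw t h1 h2 h3
  have hvw : v w = 0 := by
    by_contra hne
    rcases h.supp _ hne with h' | ⟨hb, h'⟩
    · exact hw 0 ha hb h'.symm
    · exact hw 1 (by omega) hb h'.symm
  by_cases ht0 : t ≤ 0
  · have hta := h.left hv w hw hvw t hat ht0 hwt
    subst hta
    have hiff : ∀ s, t ≤ s → s ≤ b → (G.Adj (f s) w ↔ s = t) := by
      intro s h1 h2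
      constructor
      · intro hs
        by_cases hs0 : s ≤ 0
        · exact h.left hv w hw hvw s h1 hs0 hs
        · have := h.right hv w hw hvw s (by omega) h2 hs
          subst this
          exact (h.notBoth hv w hw hvw (by omega) hwt hs).elim
      · rintro rfl; exact hwt
    have hf' : ∀ s, t ≤ s → Function.update f (t - 1) w s = f s := by
      intro s hs; rw [Function.update_of_ne (by omega)]
    have hfw : Function.update f (t - 1) w (t - 1) = w := Function.update_self ..
    refine ⟨Function.update f (t - 1) w, t - 1, b, ⟨by omega, hb, ?_, ?_, ?_, ?_, ?_⟩, by omega⟩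
    · intro s u h1 h2 h3 h4 e
      rcases h1.eq_or_lt with rfl | h1
      · rcases h3.eq_or_lt with rfl | h3
        · rfl
        · rw [hfw, hf' u (by omega)] at e
          exact (hw u (by omega) h4 e.symm).elim
      · rcases h3.eq_or_lt with rfl | h3
        · rw [hfw, hf' s (by omega)] at e
          exact (hw s (by omega) h2 e).elim
        · rw [hf' s (by omega), hf' u (by omega)] at e
          exact h.inj _ _ (by omega) h2 (by omega) h4 e
    · intro s u h1 h2 h3 h4
      rcases h1.eq_or_lt with rfl | h1
      · rcases h3.eq_or_lt with rfl | h3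
        · simp only [G.irrefl, false_iff]
          omega
        · rw [hfw, hf' u (by omega), G.adj_comm, hiff u (by omega) h4]
          omega
      · rcases h3.eq_or_lt with rfl | h3
        · rw [hfw, hf' s (by omega), hiff s (by omega) h2]
          omega
        · rw [hf' s (by omega), hf' u (by omega)]
          exact h.adj _ _ (by omega) h2 (by omega) h4
    · rw [hf' 0 ha]; exact h.h0
    · rw [hf' 1 (by omega)]; exact h.h1
    · rw [hf' 0 ha, hf' 1 (by omega)]; exact h.supp
  · have hta := h.right hv w hw hvw t (by omega) htb hwt
    subst hta
    have hiff : ∀ s, a ≤ s → s ≤ t → (G.Adj (f s) w ↔ s = t) := by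
      intro s h1 h2
      constructor
      · intro hs
        by_cases hs0 : s ≤ 0
        · have := h.left hv w hw hvw s h1 hs0 hs
          subst this
          exact (h.notBoth hv w hw hvw (by omega) hs hwt).elim
        · exact h.right hv w hw hvw s (by omega) h2 hs
      · rintro rfl; exact hwt
    have hf' : ∀ s, s ≤ t → Function.update f (t + 1) w s = f s := by
      intro s hs; rw [Function.update_of_ne (by omega)]
    have hfw : Function.update f (t + 1) w (t + 1) = w := Function.update_self ..
    refine ⟨Function.update f (t + 1) w, a, t + 1, ⟨ha, by omega, ?_, ?_, ?_, ?_, ?_⟩, by omega⟩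
    · intro s u h1 h2 h3 h4 e
      rcases h2.eq_or_lt with rfl | h2
      · rcases h4.eq_or_lt with rfl | h4
        · rfl
        · rw [hfw, hf' u (by omega)] at e
          exact (hw u (by omega) (by omega) e.symm).elim
      · rcases h4.eq_or_lt with rfl | h4
        · rw [hfw, hf' s (by omega)] at e
          exact (hw s (by omega) (by omega) e).elim
        · rw [hf' s (by omega), hf' u (by omega)] at e
          exact h.inj _ _ (by omega) (by omega) (by omega) (by omega) e
    · intro s u h1 h2 h3 h4
      rcases h2.eq_or_lt with rfl | h2
      · rcases h4.eq_or_lt with rfl | h4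
        · simp only [G.irrefl, false_iff]
          omega
        · rw [hfw, hf' u (by omega), G.adj_comm, hiff u (by omega) (by omega)]
          omega
      · rcases h4.eq_or_lt with rfl | h4
        · rw [hfw, hf' s (by omega), hiff s (by omega) (by omega)]
          omega
        · rw [hf' s (by omega), hf' u (by omega)]
          exact h.adj _ _ (by omega) (by omega) (by omega) (by omega)
    · rw [hf' 0 hb]; exact h.h0
    · rw [hf' 1 (by omega)]; exact fun _ => h.h1 (by omega)
    · rw [hf' 0 hb, hf' 1 (by omega)]
      intro x hx
      rcases h.supp x hx with h' | h'
      · exact Or.inl h'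
      · exact Or.inr ⟨by omega, h'.2⟩

lemma Good.bound {n : ℕ} {G : SimpleGraph (Fin n)} {v : Fin n → ℚ}
    {f : ℤ → Fin n} {a b : ℤ} (h : Good G v f a b) : b - a + 1 ≤ n := by
  have h1 : (seg f a b).card = (Finset.Icc a b).card := by
    apply Finset.card_image_of_injOn
    intro s hs t ht e
    simp only [Finset.coe_Icc, Set.mem_Icc] at hs ht
    exact h.inj s t hs.1 hs.2 ht.1 ht.2 e
  have h2 := Finset.card_le_univ (seg f a b)
  rw [h1, Int.card_Icc, Fintype.card_fin] at h2
  omega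

lemma Good.full {n : ℕ} {G : SimpleGraph (Fin n)} (hG : G.Connected) {v : Fin n → ℚ}
    (hv : Prop1 G v) (k : ℕ) {f : ℤ → Fin n} {a b : ℤ} (h : Good G v f a b)
    (hk : (n : ℤ) ≤ b - a + 1 + k) :
    ∃ f a b, Good G v f a b ∧ ∀ w, ∃ t, a ≤ t ∧ t ≤ b ∧ f t = w := by
  induction k generalizing f a b with
  | zero =>
    by_cases hw : ∃ w, ∀ t, a ≤ t → t ≤ b → f t ≠ w
    · obtain ⟨f', a', b', h', e⟩ := h.extend hG hv hw
      have := h'.bound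
      push_cast at hk
      omega
    · push Not at hw
      exact ⟨f, a, b, h, hw⟩
  | succ k ih =>
    by_cases hw : ∃ w, ∀ t, a ≤ t → t ≤ b → f t ≠ w
    · obtain ⟨f', a', b', h', e⟩ := h.extend hG hv hw
      exact ih h' (by push_cast at hk; omega)
    · push Not at hw
      exact ⟨f, a, b, h, hw⟩

lemma Good.start {n : ℕ} {G : SimpleGraph (Fin n)} {v : Fin n → ℚ}
    (hv : Prop1 G v) (hv0 : v ≠ 0) : ∃ f a b, Good G v f a b := by
  obtain ⟨i, hi⟩ : ∃ i, v i ≠ 0 := by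
    by_contra! h
    exact hv0 (funext h)
  have pair : ∀ i j, i ≠ j → v i ≠ 0 → v j ≠ 0 → v i = - v j ∧ G.Adj i j := by
    intro i j hij h1 h2
    rcases hv {i} {j} (connSet_singleton G i) (connSet_singleton G j) (by simpa using hij)
      (by simpa using h1) (by simpa using h2) with h | h | h
    · refine ⟨by simpa using h.2.1, ?_⟩
      by_contra hadj
      have := connSet_ind h.2.2 (fun x => x = i) (u := i) (w := j) (by simp) rfl
        (by
          intro x hx y hy hxy e
          simp only [Finset.mem_union, Finset.mem_singleton] at hx hy
          subst e
          rcases hy with rfl | rfl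
          · rfl
          · exact (hadj hxy).elim) (by simp)
      exact hij this.symm
    · simp at h; exact (hij h.symm).elim
    · simp at h; exact (hij h).elim
  by_cases hj : ∃ j, j ≠ i ∧ v j ≠ 0
  · obtain ⟨j, hji, hj⟩ := hj
    obtain ⟨e, hadj⟩ := pair i j hji.symm hi hj
    refine ⟨fun t => if t ≤ 0 then i else j, 0, 1, ⟨le_refl _, by norm_num, ?_, ?_, ?_, ?_, ?_⟩⟩
    · intro s t h1 h2 h3 h4 e
      have hs : s = 0 ∨ s = 1 := by omega
      have ht : t = 0 ∨ t = 1 := by omega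
      rcases hs with rfl | rfl <;> rcases ht with rfl | rfl <;> simp_all
    · intro s t h1 h2 h3 h4
      have hs : s = 0 ∨ s = 1 := by omega
      have ht : t = 0 ∨ t = 1 := by omega
      rcases hs with rfl | rfl <;> rcases ht with rfl | rfl <;> simp [hadj, hadj.symm]
    · simpa using hi
    · simpa using hj
    · intro x hx
      by_contra! hcon
      have hxi : x ≠ i := by simpa using hcon.1
      have hxj : x ≠ j := by simpa using hcon.2
      have e1 := (pair x i hxi hx hi).1
      have e2 := (pair x j hxj hx hj).1
      apply hi
      linarith
  · push Not at hj
    refine ⟨fun _ => i, 0, 0, ⟨le_refl _, le_refl _, ?_, ?_, hi, fun h => by omega, ?_⟩⟩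
    · intros; omega
    · intros; simp; omega
    · intro x hx
      left
      by_contra hne
      exact hx (hj x hne)

lemma path_of_prop1 {n : ℕ} {G : SimpleGraph (Fin n)} (hG : G.Connected) {v : Fin n → ℚ}
    (hv : Prop1 G v) (hv0 : v ≠ 0) : ∃ m : ℕ, Nonempty (G ≃g SimpleGraph.pathGraph m) := by
  obtain ⟨f, a, b, h⟩ := Good.start hv hv0
  obtain ⟨f, a, b, h, hs⟩ := h.full hG hv n (by have := h.ha; have := h.hb; omega)
  have ha := h.ha
  have hb := h.hb
  have hbij : Function.Bijective (fun t : Fin (b - a + 1).toNat => f (a + t.val)) := by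
    constructor
    · intro s t e
      have := h.inj _ _ (by omega) (by omega) (by omega) (by omega) e
      ext; omega
    · intro w
      obtain ⟨t, h1, h2, rfl⟩ := hs w
      refine ⟨⟨(t - a).toNat, by omega⟩, ?_⟩
      simp only
      congr 1
      omega
  refine ⟨(b - a + 1).toNat, ⟨SimpleGraph.Iso.symm ⟨Equiv.ofBijective _ hbij, ?_⟩⟩⟩
  intro s t
  rw [SimpleGraph.pathGraph_adj]
  simp only [Equiv.ofBijective_apply]
  rw [h.adj _ _ (by omega) (by omega) (by omega) (by omega)]
  omega

lemma arrRank_csa {n : ℕ} (G : SimpleGraph (Fin n)) : arrRank (csaForms G) = n := by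
  have : (⨅ f ∈ csaForms G, LinearMap.ker f) = (⊥ : Submodule ℚ (Fin n → ℚ)) := by
    rw [eq_bot_iff]
    intro x hx
    simp only [Submodule.mem_iInf] at hx
    rw [Submodule.mem_bot]
    funext i
    have := hx (linForm {i}) (mem_csaForms.2 ⟨_, connSet_singleton G i, rfl⟩)
    simpa [linForm_apply] using this
  rw [arrRank, this]
  simp

lemma path_of_supersolvable {n : ℕ} {G : SimpleGraph (Fin n)} (hG : G.Connected)
    (h : IsSupersolvable (csaForms G)) : ∃ m : ℕ, Nonempty (G ≃g SimpleGraph.pathGraph m) := by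
  rw [IsSupersolvable, arrRank_csa] at h
  obtain ⟨X, hX, hanti⟩ := h
  have hn : 0 < n := by
    obtain ⟨i⟩ := hG.nonempty
    exact i.pos
  have hdim : ∀ k (hk : k < n + 1), Module.finrank ℚ (X ⟨k, hk⟩) + k ≤ n := by
    intro k
    induction k with
    | zero =>
      intro hk
      simpa using Submodule.finrank_le (X ⟨0, hk⟩)
    | succ k ih =>
      intro hk
      have h1 := ih (by omega)
      have h2 := Submodule.finrank_lt_finrank_of_lt
        (hanti (show (⟨k, by omega⟩ : Fin (n + 1)) < ⟨k + 1, hk⟩ by simp))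
      omega
  have h1 : Module.finrank ℚ (X ⟨n - 1, by omega⟩) ≤ 1 := by
    have := hdim (n - 1) (by omega)
    omega
  have h2 : X ⟨n - 1, by omega⟩ ≠ ⊥ := by
    have := hanti (show (⟨n - 1, by omega⟩ : Fin (n + 1)) < ⟨n, by omega⟩ by
      rw [Fin.mk_lt_mk]; omega)
    exact (bot_le.trans_lt this).ne'
  obtain ⟨v, hv, hv0⟩ := Submodule.exists_mem_ne_zero_of_ne_bot h2
  refine path_of_prop1 hG (prop1_of_modular (hX ⟨n - 1, by omega⟩) v hv ?_) hv0
  intro x hx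
  obtain ⟨u, hu⟩ := finrank_le_one_iff.1 h1
  obtain ⟨c, hc⟩ := hu ⟨v, hv⟩
  obtain ⟨d, hd⟩ := hu ⟨x, hx⟩
  have hc' : c • (u : Fin n → ℚ) = v := congrArg Subtype.val hc
  have hd' : d • (u : Fin n → ℚ) = x := congrArg Subtype.val hd
  have hc0 : c ≠ 0 := by
    rintro rfl
    exact hv0 (by rw [← hc', zero_smul])
  refine ⟨d * c⁻¹, ?_⟩
  rw [← hc', ← hd', smul_smul, mul_assoc, inv_mul_cancel₀ hc0, mul_one]

end CSA

namespace CSA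

/-- Vertices whose position on the path lies in `[a, b)`. -/
def ivl {n : ℕ} (pos : Fin n → ℕ) (a b : ℕ) : Finset (Fin n) :=
  Finset.univ.filter fun i => a ≤ pos i ∧ pos i < b

lemma mem_ivl {n : ℕ} {pos : Fin n → ℕ} {a b : ℕ} {i : Fin n} :
    i ∈ ivl pos a b ↔ a ≤ pos i ∧ pos i < b := by
  simp [ivl]

/-- Partial sums along the path. -/
def psum {n : ℕ} (pos : Fin n → ℕ) (j : ℕ) (x : Fin n → ℚ) : ℚ := ∑ i ∈ ivl pos 0 j, x i

lemma psum_zero {n : ℕ} (pos : Fin n → ℕ) (x : Fin n → ℚ) : psum pos 0 x = 0 := by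
  apply Finset.sum_eq_zero
  intro i hi
  have := mem_ivl.1 hi
  omega

lemma psum_succ {n : ℕ} {pos : Fin n → ℕ} (hinj : Function.Injective pos)
    (i : Fin n) (x : Fin n → ℚ) : psum pos (pos i + 1) x = psum pos (pos i) x + x i := by
  have : ivl pos 0 (pos i + 1) = insert i (ivl pos 0 (pos i)) := by
    ext j
    rw [Finset.mem_insert, mem_ivl, mem_ivl]
    constructor
    · rintro ⟨_, h⟩
      by_cases e : pos j = pos i
      · exact Or.inl (hinj e)
      · right; omega
    · rintro (rfl | h)
      · omega
      · omega
  rw [psum, this, Finset.sum_insert (by rw [mem_ivl]; omega), psum, add_comm]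

lemma linForm_ivl {n : ℕ} (pos : Fin n → ℕ) {a b : ℕ} (hab : a ≤ b) (x : Fin n → ℚ) :
    linForm (ivl pos a b) x = psum pos b x - psum pos a x := by
  have : ivl pos 0 b = ivl pos 0 a ∪ ivl pos a b := by
    ext j
    rw [Finset.mem_union, mem_ivl, mem_ivl, mem_ivl]
    omega
  rw [linForm_apply, psum, psum, this, Finset.sum_union]
  · ring
  · rw [Finset.disjoint_left]
    intro j h1 h2
    rw [mem_ivl] at h1 h2
    omega

/-- Positions of the vertices on a path. -/
structure IsPos {n : ℕ} (G : SimpleGraph (Fin n)) (pos : Fin n → ℕ) : Prop where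
  inj : Function.Injective pos
  surj : ∀ k < n, ∃ i, pos i = k
  lt : ∀ i, pos i < n
  adj : ∀ i j, G.Adj i j ↔ pos i + 1 = pos j ∨ pos j + 1 = pos i

lemma IsPos.conn_ivl {n : ℕ} {G : SimpleGraph (Fin n)} {pos : Fin n → ℕ} (h : IsPos G pos)
    (a k : ℕ) (hk : a + k < n) : ConnSet G (ivl pos a (a + k + 1)) := by
  induction k with
  | zero =>
    obtain ⟨i, hi⟩ := h.surj a (by omega)
    convert connSet_singleton G i
    ext j
    rw [mem_ivl, Finset.mem_singleton, ← h.inj.eq_iff]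
    omega
  | succ k ih =>
    have h1 := ih (by omega)
    obtain ⟨i, hi⟩ := h.surj (a + k) (by omega)
    obtain ⟨j, hj⟩ := h.surj (a + k + 1) (by omega)
    have := connSet_insert h1 (x := i) (w := j) (by rw [mem_ivl]; omega)
      ((h.adj i j).2 (by omega))
    convert this using 1
    ext l
    rw [mem_ivl, Finset.mem_insert, mem_ivl, ← h.inj.eq_iff]
    omega

lemma IsPos.eq_ivl {n : ℕ} {G : SimpleGraph (Fin n)} {pos : Fin n → ℕ} (h : IsPos G pos)
    {I : Finset (Fin n)} (hI : ConnSet G I) : ∃ a b, a ≤ b ∧ b ≤ n ∧ I = ivl pos a b := by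
  obtain ⟨p, hp, hpmin⟩ := Finset.exists_min_image I pos hI.1
  obtain ⟨q, hq, hqmax⟩ := Finset.exists_max_image I pos hI.1
  have hpq := hpmin q hq
  have hqn := h.lt q
  refine ⟨pos p, pos q + 1, by omega, by omega, ?_⟩
  ext i
  rw [mem_ivl]
  constructor
  · intro hi
    have := hpmin i hi
    have := hqmax i hi
    omega
  · rintro ⟨h1, h2⟩
    by_contra hi
    have hne : ∀ x ∈ I, pos x ≠ pos i := fun x hx e => hi (h.inj e ▸ hx)
    have h3 := hne p hp
    have h4 := hne q hq
    have := connSet_ind hI (fun x => pos x < pos i) hp (by omega) (by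
      intro x hx y hy hxy hlt
      have := (h.adj x y).1 hxy
      have := hne y hy
      omega) hq
    omega

/-- The subspace where the first `k` coordinates along the path vanish. -/
def flag {n : ℕ} (pos : Fin n → ℕ) (k : ℕ) : Submodule ℚ (Fin n → ℚ) where
  carrier := {x | ∀ i, pos i < k → x i = 0}
  add_mem' := by
    intro x y hx hy i hi
    simp [hx i hi, hy i hi]
  zero_mem' := by
    intro i _
    rfl
  smul_mem' := by
    intro c x hx i hi
    simp [hx i hi]

lemma mem_flag {n : ℕ} {pos : Fin n → ℕ} {k : ℕ} {x : Fin n → ℚ} :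
    x ∈ flag pos k ↔ ∀ i, pos i < k → x i = 0 := Iff.rfl

lemma psum_flag {n : ℕ} {pos : Fin n → ℕ} {k j : ℕ} {x : Fin n → ℚ} (hx : x ∈ flag pos k)
    (hj : j ≤ k) : psum pos j x = 0 := by
  apply Finset.sum_eq_zero
  intro i hi
  have := mem_ivl.1 hi
  exact hx i (by omega)

lemma inLattice_flag {n : ℕ} {G : SimpleGraph (Fin n)} (pos : Fin n → ℕ)
    (k : ℕ) : InLattice (csaForms G) (flag pos k) := by
  classical
  refine ⟨(csaForms G).filter fun f => flag pos k ≤ LinearMap.ker f, Finset.filter_subset _ _, ?_⟩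
  apply le_antisymm
  · refine le_iInf₂ fun f hf => (Finset.mem_filter.1 hf).2
  · intro x hx i hi
    simp only [Submodule.mem_iInf] at hx
    have := hx (linForm {i}) (Finset.mem_filter.2
      ⟨mem_csaForms.2 ⟨_, connSet_singleton G i, rfl⟩, by
        intro y hy
        simpa [linForm_apply] using hy i hi⟩)
    simpa [linForm_apply] using this

lemma modular_flag {n : ℕ} {G : SimpleGraph (Fin n)} {pos : Fin n → ℕ} (h : IsPos G pos)
    (k : ℕ) (hk : k ≤ n) : IsModular (csaForms G) (flag pos k) := by
  classical
  refine ⟨inLattice_flag pos k, ?_⟩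
  rintro Y ⟨B, hB, hYB⟩
  refine ⟨(csaForms G).filter fun f => flag pos k ⊔ Y ≤ LinearMap.ker f,
    Finset.filter_subset _ _, ?_⟩
  apply le_antisymm
  · refine le_iInf₂ fun f hf => (Finset.mem_filter.1 hf).2
  intro w hw
  simp only [Submodule.mem_iInf] at hw
  let R : ℕ → ℕ → Prop := fun p q => ∀ y ∈ Y, psum pos p y = psum pos q y
  have key0 : ∀ a b, a < b → b ≤ k → R a b → psum pos a w = psum pos b w := by
    intro a b hab hbk hR
    obtain ⟨d, rfl⟩ : ∃ d, b = a + d + 1 := ⟨b - a - 1, by omega⟩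
    have := hw (linForm (ivl pos a (a + d + 1))) (Finset.mem_filter.2
      ⟨mem_csaForms.2 ⟨_, h.conn_ivl a d (by omega), rfl⟩, by
        refine sup_le ?_ ?_
        · intro x hx
          rw [LinearMap.mem_ker, linForm_ivl pos hab.le, psum_flag hx hbk,
            psum_flag hx (by omega), sub_zero]
        · intro x hx
          rw [LinearMap.mem_ker, linForm_ivl pos hab.le, hR x hx, sub_self]⟩)
    rw [LinearMap.mem_ker, linForm_ivl pos hab.le] at this
    linarith
  have key : ∀ a b, a ≤ k → b ≤ k → R a b → psum pos a w = psum pos b w := by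
    intro a b ha hb hR
    rcases lt_trichotomy a b with hab | rfl | hab
    · exact key0 a b hab hb hR
    · rfl
    · exact (key0 b a hab ha fun y hy => (hR y hy).symm).symm
  let T : ℕ → ℚ := fun j => if hj : ∃ a, a ≤ k ∧ R a j then psum pos hj.choose w else 0
  have T_eq : ∀ a j, a ≤ k → R a j → T j = psum pos a w := by
    intro a j ha hR
    have hj : ∃ a, a ≤ k ∧ R a j := ⟨a, ha, hR⟩
    have : T j = psum pos hj.choose w := dif_pos hj
    rw [this]
    exact key _ _ hj.choose_spec.1 ha fun y hy => (hj.choose_spec.2 y hy).trans (hR y hy).symm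
  have T_congr : ∀ p q, R p q → T p = T q := by
    intro p q hR
    by_cases hp : ∃ a, a ≤ k ∧ R a p
    · obtain ⟨a, ha, hap⟩ := hp
      rw [T_eq a p ha hap, T_eq a q ha fun y hy => (hap y hy).trans (hR y hy)]
    · have hq : ¬ ∃ a, a ≤ k ∧ R a q := by
        rintro ⟨a, ha, haq⟩
        exact hp ⟨a, ha, fun y hy => (haq y hy).trans (hR y hy).symm⟩
      have e1 : T p = 0 := dif_neg hp
      have e2 : T q = 0 := dif_neg hq
      rw [e1, e2]
  let y : Fin n → ℚ := fun i => T (pos i + 1) - T (pos i)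
  have hT0 : T 0 = 0 := by
    rw [T_eq 0 0 (Nat.zero_le _) fun _ _ => rfl, psum_zero]
  have hpy : ∀ j, j ≤ n → psum pos j y = T j := by
    intro j
    induction j with
    | zero => intro _; rw [psum_zero, hT0]
    | succ j ih =>
      intro hj
      obtain ⟨i, rfl⟩ := h.surj j (by omega)
      rw [psum_succ h.inj, ih (by omega)]
      simp only [y]
      ring
  have hyY : y ∈ Y := by
    rw [hYB]
    simp only [Submodule.mem_iInf]
    intro f hf
    obtain ⟨I, hI, rfl⟩ := mem_csaForms.1 (hB hf)
    obtain ⟨a, b, hab, hbn, rfl⟩ := h.eq_ivl hI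
    have hR : R a b := by
      intro z hz
      rw [hYB] at hz
      simp only [Submodule.mem_iInf] at hz
      have := hz _ hf
      rw [LinearMap.mem_ker, linForm_ivl pos hab] at this
      linarith
    rw [LinearMap.mem_ker, linForm_ivl pos hab, hpy b hbn, hpy a (by omega), T_congr a b hR,
      sub_self]
  have hwy : w - y ∈ flag pos k := by
    intro i hi
    have e1 := T_eq (pos i + 1) _ (by omega) fun _ _ => rfl
    have e2 := T_eq (pos i) _ (by omega) fun _ _ => rfl
    have e3 := psum_succ h.inj i w
    simp only [Pi.sub_apply, y, e1, e2]
    linarith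
  have := Submodule.add_mem_sup hwy hyY
  rwa [sub_add_cancel] at this

lemma supersolvable_of_path {n : ℕ} {G : SimpleGraph (Fin n)} {m : ℕ}
    (e : G ≃g SimpleGraph.pathGraph m) : IsSupersolvable (csaForms G) := by
  have hnm : n = m := by simpa using Fintype.card_congr e.toEquiv
  subst hnm
  have h : IsPos G (fun i => (e i).val) := by
    refine ⟨?_, ?_, ?_, ?_⟩
    · intro i j hij
      exact e.injective (Fin.ext hij)
    · intro k hk
      exact ⟨e.symm ⟨k, hk⟩, by simp⟩
    · intro i; exact (e i).isLt
    · intro i j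
      rw [← e.map_adj_iff, SimpleGraph.pathGraph_adj]
  rw [IsSupersolvable, arrRank_csa]
  refine ⟨fun k => flag (fun i => (e i).val) k.val, fun k => modular_flag h _ (by omega), ?_⟩
  intro k l hkl
  have hkl' : k.val < l.val := hkl
  refine lt_of_le_of_ne ?_ ?_
  · intro x hx i hi
    exact hx i (lt_trans hi hkl')
  · intro heq
    obtain ⟨i, hi⟩ := h.surj k.val (by omega)
    have hmem : (Pi.single i 1 : Fin n → ℚ) ∈ flag (fun i => (e i).val) k.val := by
      intro j hj
      rw [Pi.single_apply, if_neg]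
      rintro rfl
      simp only at hi hj
      omega
    replace hmem := heq.ge hmem
    have := hmem i (by simp only at hi ⊢; omega)
    simp at this

end CSA

/-- For a finite connected simple graph `G`, the connected subgraph
arrangement `𝒜_G` is supersolvable if and only if `G` is a path graph. -/
theorem csa_supersolvable_iff {n : ℕ} (G : SimpleGraph (Fin n)) (hG : G.Connected) :
    IsSupersolvable (csaForms G) ↔
      ∃ m : ℕ, Nonempty (G ≃g SimpleGraph.pathGraph m) := by
  exact ⟨CSA.path_of_supersolvable hG, fun ⟨_, ⟨e⟩⟩ => CSA.supersolvable_of_path e⟩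
end

section
/- The connected subgraph arrangement 𝒜_{A_{3,2}} of the almost path graph A_{3,2} (the star graph on vertices {1,2,3,4} with central node 2 and edges {1,2}, {2,3}, {2,4}) is not factored, i.e. it admits no nice partition. -/
open Finset

namespace StarProof

/-- Combinatorial description of connected vertex sets of the star. -/
def Conn (I : Finset (Fin 4)) : Prop := 1 ∈ I ∨ I.card = 1

instance : DecidablePred Conn := fun I => by unfold Conn; infer_instance

theorem adj_iff (a b : Fin 4) : (almostPath 3 2).Adj a b ↔ a ≠ b ∧ (a = 1 ∨ b = 1) := by
  unfold almostPath
  rw [SimpleGraph.fromRel_adj]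
  revert a b
  decide

theorem connSet_iff (I : Finset (Fin 4)) : ConnSet (almostPath 3 2) I ↔ Conn I := by
  constructor
  · rintro ⟨⟨a, ha⟩, hc⟩
    by_contra hI
    unfold Conn at hI
    push Not at hI
    obtain ⟨h1, h2⟩ := hI
    have : 1 < I.card := by
      have : 0 < I.card := Finset.card_pos.mpr ⟨a, ha⟩
      omega
    obtain ⟨b, hb, hba⟩ := Finset.exists_mem_ne this a
    have hnt : Nontrivial (↑I : Set (Fin 4)) :=
      ⟨⟨a, ha⟩, ⟨b, hb⟩, fun h => hba (congrArg Subtype.val h).symm⟩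
    obtain ⟨c, hc'⟩ := hc.preconnected.exists_adj_of_nontrivial ⟨a, ha⟩
    rw [SimpleGraph.comap_adj] at hc'
    have := (adj_iff _ _).1 hc'
    rcases this with ⟨_, h | h⟩
    · exact h1 (by rw [← h]; exact ha)
    · exact h1 (by rw [← h]; exact c.2)
  · intro h
    rcases h with h | h
    · refine ⟨⟨1, h⟩, ?_⟩
      rw [SimpleGraph.connected_iff_exists_forall_reachable]
      refine ⟨⟨1, h⟩, fun w => ?_⟩
      by_cases hw : w = ⟨1, h⟩
      · rw [hw]
      · apply SimpleGraph.Adj.reachable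
        rw [SimpleGraph.comap_adj]
        refine (adj_iff _ _).2 ⟨fun h' => hw (Subtype.ext h'.symm), Or.inl rfl⟩
    · obtain ⟨a, rfl⟩ := Finset.card_eq_one.1 h
      refine ⟨⟨a, by simp⟩, ?_⟩
      rw [SimpleGraph.connected_iff_exists_forall_reachable]
      refine ⟨⟨a, by simp⟩, fun w => ?_⟩
      have : w = ⟨a, by simp⟩ := Subtype.ext (by simpa using w.2)
      rw [this]

theorem linForm_apply (I : Finset (Fin 4)) (v : Fin 4 → ℚ) : linForm I v = ∑ i ∈ I, v i := by
  simp [linForm]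

theorem linForm_inj {I J : Finset (Fin 4)} (h : linForm I = linForm J) : I = J := by
  ext i
  have := congrArg (fun f => f (Pi.single i 1)) h
  simp only [linForm_apply] at this
  by_cases h1 : i ∈ I <;> by_cases h2 : i ∈ J <;> simp_all

theorem mem_forms (f) : f ∈ csaForms (almostPath 3 2) ↔ ∃ I, Conn I ∧ linForm I = f := by
  simp [csaForms, connSet_iff]

/-- Small integer vectors used as witnesses. -/
def vecs : List (Fin 4 → ℤ) :=
  [![-1, 0, 0, 1],
   ![-1, 1, 0, -1],
   ![-1, 0, 1, 0],
   ![-1, 1, -1, 0],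
   ![0, -1, 0, 0],
   ![0, -1, 1, 1],
   ![0, 0, -1, 1],
   ![-1, 0, 0, 0],
   ![-1, 1, 0, 0],
   ![0, -1, 0, 1],
   ![0, -1, 1, 0],
   ![0, 0, -1, 0],
   ![0, 0, 0, -1]]

theorem linForm_vec (I : Finset (Fin 4)) (v : Fin 4 → ℤ) :
    linForm I (fun i => (v i : ℚ)) = ((∑ i ∈ I, v i : ℤ) : ℚ) := by
  rw [linForm_apply]; push_cast; rfl

/-- `K` is separated from the span of `I`, `J` by a small vector. -/
def Sep (I J K : Finset (Fin 4)) : Prop :=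
  ∃ t ∈ vecs, ∑ i ∈ I, t i = 0 ∧ ∑ i ∈ J, t i = 0 ∧ ∑ i ∈ K, t i ≠ 0

instance (I J K : Finset (Fin 4)) : Decidable (Sep I J K) := by unfold Sep; infer_instance

def nonAdj (I J : Finset (Fin 4)) : Prop :=
  (1 ∈ I ∧ 1 ∈ J ∧ 2 ≤ (symmDiff I J).card) ∨ (1 ∉ I ∧ 1 ∉ J ∧ I ≠ J)

instance (I J : Finset (Fin 4)) : Decidable (nonAdj I J) := by unfold nonAdj; infer_instance

set_option maxRecDepth 100000 in
theorem sep_pair : ∀ I, Conn I → ∀ J, Conn J → nonAdj I J →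
    ∀ K, Conn K → K ≠ I → K ≠ J → Sep I J K := by decide +kernel

set_option maxRecDepth 100000 in
theorem sep_triple : ∀ I, 1 ∈ I → ∀ x, x ∉ I →
    ∀ K, Conn K → K ≠ I → K ≠ insert x I → K ≠ {x} → Sep I (insert x I) K := by decide +kernel

/-- Exactly two of the three colours agree. -/
def Tri (a b l : Fin 4) : Prop := ¬ (a = b ∧ a = l) ∧ (a = b ∨ a = l ∨ b = l)

/-- Boolean universal quantifier over four colours. -/
def allC (p : Fin 4 → Bool) : Bool := p 0 && (p 1 && (p 2 && p 3))

/-- Boolean equality of colours. -/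
def same (a b : Fin 4) : Bool := Nat.beq a.val b.val

/-- Boolean negation of `Tri`. -/
def bad (a b l : Fin 4) : Bool :=
  bif same a b then same a l else !(same a l || same b l)

theorem allC_iff (p : Fin 4 → Bool) : allC p = true ↔ ∀ x, p x = true := by
  simp [allC, Fin.forall_fin_succ]

theorem same_iff : ∀ a b : Fin 4, same a b = true ↔ ¬ (a ≠ b) := by decide

theorem bad_iff : ∀ a b l : Fin 4, bad a b l = true ↔ ¬ Tri a b l := by
  unfold Tri; decide

/-- Pruned exhaustive search over all colourings. -/
def search : Bool :=
  allC fun v0 => 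
  allC fun v1 => 
  allC fun v2 => same v1 v2 || (
  allC fun v3 => same v1 v3 || (same v2 v3 || (
  allC fun v4 => same v0 v4 || (same v3 v4 || (
  allC fun v5 => same v0 v5 || (same v2 v5 || (same v4 v5 || (
  allC fun v6 => same v0 v6 || (same v1 v6 || (same v4 v6 || (same v5 v6 || (
  allC fun v7 => same v0 v7 || (same v1 v7 || (same v2 v7 || (same v3 v7 || (
  allC fun l0 => 
    bad v0 v1 l0 || (bad v2 v4 l0 || (bad v3 v5 l0 || (bad v6 v7 l0 || (
  allC fun l2 => same l0 l2 || (
    bad v0 v2 l2 || (bad v1 v4 l2 || (bad v3 v6 l2 || (bad v5 v7 l2 || (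
  allC fun l3 => same l0 l3 || (same l2 l3 || (
    bad v0 v3 l3 || (bad v1 v5 l3 || (bad v2 v6 l3 || (bad v4 v7 l3 || (false)))))))))))))))))))))))))))))))

set_option maxRecDepth 100000 in
theorem search_true : search = true := by decide +kernel

theorem colour :
    ∀ v0 : Fin 4, 
    ∀ v1 : Fin 4, 
    ∀ v2 : Fin 4, v1 ≠ v2 → 
    ∀ v3 : Fin 4, v1 ≠ v3 → v2 ≠ v3 → 
    ∀ v4 : Fin 4, v0 ≠ v4 → v3 ≠ v4 → 
    ∀ v5 : Fin 4, v0 ≠ v5 → v2 ≠ v5 → v4 ≠ v5 → 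
    ∀ v6 : Fin 4, v0 ≠ v6 → v1 ≠ v6 → v4 ≠ v6 → v5 ≠ v6 → 
    ∀ v7 : Fin 4, v0 ≠ v7 → v1 ≠ v7 → v2 ≠ v7 → v3 ≠ v7 → 
    ∀ l0 : Fin 4, 
    Tri v0 v1 l0 → Tri v2 v4 l0 → Tri v3 v5 l0 → Tri v6 v7 l0 → 
    ∀ l2 : Fin 4, l0 ≠ l2 → 
    Tri v0 v2 l2 → Tri v1 v4 l2 → Tri v3 v6 l2 → Tri v5 v7 l2 → 
    ∀ l3 : Fin 4, l0 ≠ l3 → l2 ≠ l3 → 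
    Tri v0 v3 l3 → Tri v1 v5 l3 → Tri v2 v6 l3 → Tri v4 v7 l3 → False := by
  have h := search_true
  simp only [search, allC_iff, Bool.or_eq_true, same_iff, bad_iff, ← imp_iff_not_or,
    Bool.false_eq_true] at h
  exact h

/-- The final finite colouring problem. -/
theorem comb (c : Finset (Fin 4) → Fin 4)
    (hp : ∀ I J, Conn I → Conn J → nonAdj I J → c I ≠ c J)
    (h1 : ∀ I x, 1 ∈ I → x ∉ I → ¬ (c I = c (insert x I) ∧ c I = c {x}))
    (h2 : ∀ I x, 1 ∈ I → x ∉ I → c I = c (insert x I) ∨ c I = c {x} ∨ c (insert x I) = c {x}) :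
    False := by
  have h3 : ∀ I J x, 1 ∈ I → x ∉ I → J = insert x I → Tri (c I) (c J) (c {x}) := by
    rintro I J x a b rfl; exact ⟨h1 I x a b, h2 I x a b⟩
  exact colour
    (c ({1} : Finset (Fin 4)))
    (c ({1, 0} : Finset (Fin 4)))
    (c ({1, 2} : Finset (Fin 4)))
    (hp ({1, 0} : Finset (Fin 4)) ({1, 2} : Finset (Fin 4)) (by decide) (by decide) (by decide))
    (c ({1, 3} : Finset (Fin 4)))
    (hp ({1, 0} : Finset (Fin 4)) ({1, 3} : Finset (Fin 4)) (by decide) (by decide) (by decide))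
    (hp ({1, 2} : Finset (Fin 4)) ({1, 3} : Finset (Fin 4)) (by decide) (by decide) (by decide))
    (c ({1, 0, 2} : Finset (Fin 4)))
    (hp ({1} : Finset (Fin 4)) ({1, 0, 2} : Finset (Fin 4)) (by decide) (by decide) (by decide))
    (hp ({1, 3} : Finset (Fin 4)) ({1, 0, 2} : Finset (Fin 4)) (by decide) (by decide) (by decide))
    (c ({1, 0, 3} : Finset (Fin 4)))
    (hp ({1} : Finset (Fin 4)) ({1, 0, 3} : Finset (Fin 4)) (by decide) (by decide) (by decide))
    (hp ({1, 2} : Finset (Fin 4)) ({1, 0, 3} : Finset (Fin 4)) (by decide) (by decide) (by decide))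
    (hp ({1, 0, 2} : Finset (Fin 4)) ({1, 0, 3} : Finset (Fin 4)) (by decide) (by decide) (by decide))
    (c ({1, 2, 3} : Finset (Fin 4)))
    (hp ({1} : Finset (Fin 4)) ({1, 2, 3} : Finset (Fin 4)) (by decide) (by decide) (by decide))
    (hp ({1, 0} : Finset (Fin 4)) ({1, 2, 3} : Finset (Fin 4)) (by decide) (by decide) (by decide))
    (hp ({1, 0, 2} : Finset (Fin 4)) ({1, 2, 3} : Finset (Fin 4)) (by decide) (by decide) (by decide))
    (hp ({1, 0, 3} : Finset (Fin 4)) ({1, 2, 3} : Finset (Fin 4)) (by decide) (by decide) (by decide))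
    (c ({1, 0, 2, 3} : Finset (Fin 4)))
    (hp ({1} : Finset (Fin 4)) ({1, 0, 2, 3} : Finset (Fin 4)) (by decide) (by decide) (by decide))
    (hp ({1, 0} : Finset (Fin 4)) ({1, 0, 2, 3} : Finset (Fin 4)) (by decide) (by decide) (by decide))
    (hp ({1, 2} : Finset (Fin 4)) ({1, 0, 2, 3} : Finset (Fin 4)) (by decide) (by decide) (by decide))
    (hp ({1, 3} : Finset (Fin 4)) ({1, 0, 2, 3} : Finset (Fin 4)) (by decide) (by decide) (by decide))
    (c ({0} : Finset (Fin 4)))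
    (h3 ({1} : Finset (Fin 4)) ({1, 0} : Finset (Fin 4)) 0 (by decide) (by decide) (by decide))
    (h3 ({1, 2} : Finset (Fin 4)) ({1, 0, 2} : Finset (Fin 4)) 0 (by decide) (by decide) (by decide))
    (h3 ({1, 3} : Finset (Fin 4)) ({1, 0, 3} : Finset (Fin 4)) 0 (by decide) (by decide) (by decide))
    (h3 ({1, 2, 3} : Finset (Fin 4)) ({1, 0, 2, 3} : Finset (Fin 4)) 0 (by decide) (by decide) (by decide))
    (c ({2} : Finset (Fin 4)))
    (hp ({0} : Finset (Fin 4)) ({2} : Finset (Fin 4)) (by decide) (by decide) (by decide))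
    (h3 ({1} : Finset (Fin 4)) ({1, 2} : Finset (Fin 4)) 2 (by decide) (by decide) (by decide))
    (h3 ({1, 0} : Finset (Fin 4)) ({1, 0, 2} : Finset (Fin 4)) 2 (by decide) (by decide) (by decide))
    (h3 ({1, 3} : Finset (Fin 4)) ({1, 2, 3} : Finset (Fin 4)) 2 (by decide) (by decide) (by decide))
    (h3 ({1, 0, 3} : Finset (Fin 4)) ({1, 0, 2, 3} : Finset (Fin 4)) 2 (by decide) (by decide) (by decide))
    (c ({3} : Finset (Fin 4)))
    (hp ({0} : Finset (Fin 4)) ({3} : Finset (Fin 4)) (by decide) (by decide) (by decide))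
    (hp ({2} : Finset (Fin 4)) ({3} : Finset (Fin 4)) (by decide) (by decide) (by decide))
    (h3 ({1} : Finset (Fin 4)) ({1, 3} : Finset (Fin 4)) 3 (by decide) (by decide) (by decide))
    (h3 ({1, 0} : Finset (Fin 4)) ({1, 0, 3} : Finset (Fin 4)) 3 (by decide) (by decide) (by decide))
    (h3 ({1, 2} : Finset (Fin 4)) ({1, 2, 3} : Finset (Fin 4)) 3 (by decide) (by decide) (by decide))
    (h3 ({1, 0, 2} : Finset (Fin 4)) ({1, 0, 2, 3} : Finset (Fin 4)) 3 (by decide) (by decide) (by decide))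

section
variable {s : ℕ} {π : Fin s → Finset ((Fin 4 → ℚ) →ₗ[ℚ] ℚ)}

theorem flat (h : IsNicePartition (csaForms (almostPath 3 2)) π) (I J : Finset (Fin 4))
    (hI : Conn I) (hJ : Conn J) :
    ∃ i K, Conn K ∧ ¬ Sep I J K ∧ linForm K ∈ π i ∧ ∀ L, linForm L ∈ π i →
      (∀ v, linForm I v = 0 → linForm J v = 0 → linForm L v = 0) → L = K := by
  classical
  obtain ⟨-, hsub, -, -, hn⟩ := h
  have hX : ∀ v, v ∈ (⨅ f ∈ ({linForm I, linForm J} : Finset ((Fin 4 → ℚ) →ₗ[ℚ] ℚ)),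
      LinearMap.ker f) ↔ linForm I v = 0 ∧ linForm J v = 0 := by
    intro v; simp
  obtain ⟨i, f, hf, hle, hu⟩ := hn (⨅ f ∈ ({linForm I, linForm J} : Finset ((Fin 4 → ℚ) →ₗ[ℚ] ℚ)),
      LinearMap.ker f) ⟨_, by
        intro f hf
        simp only [Finset.mem_insert, Finset.mem_singleton] at hf
        rcases hf with rfl | rfl
        · exact (mem_forms _).2 ⟨_, hI, rfl⟩
        · exact (mem_forms _).2 ⟨_, hJ, rfl⟩, rfl⟩ (by
      intro ht
      have hne : I.Nonempty := ((connSet_iff I).2 hI).1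
      obtain ⟨a, ha⟩ := hne
      have := ((hX (Pi.single a 1)).1 (by rw [ht]; trivial)).1
      simp only [linForm_apply] at this
      simp [ha] at this)
  obtain ⟨K, hK, rfl⟩ := (mem_forms _).1 (hsub i hf)
  refine ⟨i, K, hK, ?_, hf, ?_⟩
  · rintro ⟨t, -, e1, e2, e3⟩
    apply e3
    have := hle ((hX (fun i => (t i : ℚ))).2 (by
      rw [linForm_vec, linForm_vec, e1, e2]; simp))
    rw [LinearMap.mem_ker, linForm_vec] at this
    exact_mod_cast this
  · intro L hL hv
    apply linForm_inj
    apply hu _ hL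
    intro v hv'
    have := (hX v).1 hv'
    exact hv v this.1 this.2

theorem main (h : IsNicePartition (csaForms (almostPath 3 2)) π) : False := by
  classical
  have hflat := flat h
  obtain ⟨hne, hsub, hpart, hind, -⟩ := h
  choose g hg using hne
  have hs : s ≤ 4 := by
    have := (hind g hg).fintype_card_le_finrank
    simpa using this
  have hex : ∀ I : Finset (Fin 4), ∃ i : Fin s, Conn I → linForm I ∈ π i := by
    intro I
    by_cases hI : Conn I
    · obtain ⟨i, hi, -⟩ := hpart _ ((mem_forms _).2 ⟨I, hI, rfl⟩)
      exact ⟨i, fun _ => hi⟩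
    · obtain ⟨i, hi, -⟩ := hpart _ ((mem_forms _).2 ⟨{1}, Or.inl (by simp), rfl⟩)
      exact ⟨i, fun h => absurd h hI⟩
  choose k hk using hex
  have hkeq : ∀ I i, Conn I → linForm I ∈ π i → i = k I := fun I i hI hi =>
    (hpart _ ((mem_forms _).2 ⟨I, hI, rfl⟩)).unique hi (hk I hI)
  have hadd : ∀ (I : Finset (Fin 4)) x, x ∉ I → ∀ v, 
      linForm (insert x I) v = linForm {x} v + linForm I v := by
    intro I x hx v
    simp [linForm_apply, Finset.sum_insert hx]
  refine comb (fun I => Fin.castLE hs (k I)) ?_ ?_ ?_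
  · intro I J hI hJ hIJ he
    have he : k I = k J := Fin.castLE_injective hs he
    have hne : I ≠ J := by
      rintro rfl; simp [nonAdj] at hIJ
    obtain ⟨i, K, hK, hsep, hKi, hu⟩ := hflat I J hI hJ
    have hi := hkeq K i hK hKi
    have : K = I ∨ K = J := by
      by_contra hc
      push Not at hc
      exact hsep (sep_pair I hI J hJ hIJ K hK hc.1 hc.2)
    have hki : i = k I := by rcases this with rfl | rfl <;> simp_all
    have a1 := hu I (by rw [hki]; exact hk I hI) (fun v h1 h2 => h1)
    have a2 := hu J (by rw [hki, he]; exact hk J hJ) (fun v h1 h2 => h2)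
    exact hne (a1.trans a2.symm)
  · rintro I x hI hx ⟨he, he'⟩
    have he : k I = k (insert x I) := Fin.castLE_injective hs he
    have he' : k I = k {x} := Fin.castLE_injective hs he'
    have hI' : Conn I := Or.inl hI
    have hJ : Conn (insert x I) := Or.inl (by simp [hI])
    obtain ⟨i, K, hK, hsep, hKi, hu⟩ := hflat I (insert x I) hI' hJ
    have hi := hkeq K i hK hKi
    have : K = I ∨ K = insert x I ∨ K = {x} := by
      by_contra hc
      push Not at hc
      exact hsep (sep_triple I hI x hx K hK hc.1 hc.2.1 hc.2.2)
    have hki : i = k I := by rcases this with rfl | rfl | rfl <;> simp_all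
    have a1 := hu I (by rw [hki]; exact hk I hI') (fun v h1 h2 => h1)
    have a2 := hu _ (by rw [hki, he]; exact hk _ hJ) (fun v h1 h2 => h2)
    apply hx
    rw [a1, ← a2]; simp
  · intro I x hI hx
    have hI' : Conn I := Or.inl hI
    have hJ : Conn (insert x I) := Or.inl (by simp [hI])
    have hx' : Conn {x} := Or.inr (by simp)
    by_contra hc
    push Not at hc
    obtain ⟨c1, c2, c3⟩ := hc
    have c1 : k I ≠ k (insert x I) := fun h => c1 (by rw [h])
    have c2 : k I ≠ k {x} := fun h => c2 (by rw [h])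
    have c3 : k (insert x I) ≠ k {x} := fun h => c3 (by rw [h])
    let G : Fin s → ((Fin 4 → ℚ) →ₗ[ℚ] ℚ) := fun i =>
      if i = k I then linForm I else if i = k (insert x I) then linForm (insert x I) else
      if i = k {x} then linForm {x} else g i
    have hG : ∀ i, G i ∈ π i := by
      intro i
      simp only [G]
      split_ifs with h1 h2 h3
      · rw [h1]; exact hk _ hI'
      · rw [h2]; exact hk _ hJ
      · rw [h3]; exact hk _ hx'
      · exact hg i
    have hl := (hind G hG).comp ![k I, k (insert x I), k {x}] (by
      intro a b hab
      fin_cases a <;> fin_cases b <;> simp_all)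
    rw [Fintype.linearIndependent_iff] at hl
    have := hl ![1, -1, 1] (by
      have g1 : G (k I) = linForm I := by simp [G]
      have g2 : G (k (insert x I)) = linForm (insert x I) := by simp [G, c1.symm]
      have g3 : G (k {x}) = linForm {x} := by simp [G, c2.symm, c3.symm]
      rw [Fin.sum_univ_three]
      simp only [Function.comp_apply, Matrix.cons_val, g1, g2, g3]
      apply LinearMap.ext
      intro v
      simp [hadd I x hx v]) 0
    simp at this

end

end StarProof

/-- The connected subgraph arrangement of the almost path graph
`A_{3,2}` (the star graph on `{1,2,3,4}` with central node `2` and edges `{1,2}`,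
`{2,3}`, `{2,4}`) is not factored: it admits no nice partition. -/
theorem csa_star_not_factored : ¬ IsFactored (csaForms (almostPath 3 2)) := by
  rintro ⟨s, π, h⟩
  exact StarProof.main h
end
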